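/- As T → ∞, 𝒥_−(T) ≫ T (log T)^{−1/2}; that is, there is a constant c > 0 such that the measure of the set of t ∈ (T,2T] with Z(t) < 0 is at least c · T (log T)^{−1/2} for all sufficiently large T. -/

import Mathlib

open MeasureTheory

/-- The phase factor `e^{iθ(t)} = π^{-it/2} Γ(1/4+it/2)/|Γ(1/4+it/2)|`. -/
noncomputable def eTheta (t : ℝ) : ℂ :=
  (Real.pi : ℂ) ^ (-(Complex.I * (t : ℂ)) / 2) *
    (Complex.Gamma (1 / 4 + Complex.I * (t : ℂ) / 2) /
      ‖Complex.Gamma (1 / 4 + Complex.I * (t : ℂ) / 2)‖)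

/-- Hardy's function `Z(t) = e^{iθ(t)} ζ(1/2+it)` (a real number for real `t`). -/
noncomputable def HardyZ (t : ℝ) : ℝ :=
  (eTheta t * riemannZeta (1 / 2 + Complex.I * (t : ℂ))).re

/-- `𝒥₋(T)`: Lebesgue measure of `{T < t ≤ 2T : Z(t) < 0}`. -/
noncomputable def Jmeasminus (T : ℝ) : ℝ :=
  (volume {t : ℝ | t ∈ Set.Ioc T (2 * T) ∧ HardyZ t < 0}).toReal

/-- The fractional part of `x`, cut off to the half-line `x > 1`. -/
noncomputable def fractTail (x : ℝ) : ℂ := (Set.Ioi (1 : ℝ)).indicator (fun x ↦ ((Int.fract x : ℝ) : ℂ)) x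

lemma norm_fractTail_le (x : ℝ) : ‖fractTail x‖ ≤ 1 := by
  unfold fractTail Set.indicator
  split_ifs
  · rw [Complex.norm_real, Real.norm_of_nonneg (Int.fract_nonneg x)]
    exact (Int.fract_lt_one x).le
  · simp

lemma measurable_fractTail : Measurable fractTail := by
  unfold fractTail
  exact (Complex.measurable_ofReal.comp measurable_fract).indicator measurableSet_Ioi

lemma locallyIntegrable_fractTail : LocallyIntegrable fractTail := by
  have h : LocallyIntegrable (fun _ : ℝ ↦ (1 : ℝ)) := locallyIntegrable_const 1
  refine h.mono measurable_fractTail.aestronglyMeasurable (Filter.Eventually.of_forall fun x ↦ ?_)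
  simpa using norm_fractTail_le x

lemma fractTail_isBigO_atTop : fractTail =O[Filter.atTop] fun x : ℝ ↦ x ^ (-(0 : ℝ)) := by
  refine Asymptotics.IsBigO.of_bound 1 (Filter.Eventually.of_forall fun x ↦ ?_)
  simpa using norm_fractTail_le x

lemma fractTail_isBigO_zero (b : ℝ) :
    fractTail =O[nhdsWithin 0 (Set.Ioi 0)] fun x : ℝ ↦ x ^ (-b) := by
  refine Asymptotics.IsBigO.of_bound 1 ?_
  have : ∀ᶠ x : ℝ in nhdsWithin 0 (Set.Ioi 0), x < 1 :=
    (eventually_lt_nhds one_pos).filter_mono nhdsWithin_le_nhds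
  filter_upwards [this] with x hx
  have : fractTail x = 0 := Set.indicator_of_notMem (by simp [hx.le]) _
  rw [this]; simp

lemma differentiableAt_mellin_fractTail {s : ℂ} (hs : 0 < s.re) :
    DifferentiableAt ℂ (fun s ↦ mellin fractTail (-s)) s := by
  have h := mellin_differentiableAt_of_isBigO_rpow (s := -s) (b := (-s).re - 1)
    (locallyIntegrable_fractTail.locallyIntegrableOn _)
    fractTail_isBigO_atTop (by simpa using hs) (fractTail_isBigO_zero _) (by linarith)
  exact h.comp s differentiableAt_id.neg

lemma mellin_fractTail_eq (s : ℂ) :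
    mellin fractTail (-s) = ∫ x in Set.Ioi (1 : ℝ), ((Int.fract x : ℝ) : ℂ) * (x : ℂ) ^ (-(s + 1)) := by
  unfold mellin
  have h1 : ∀ x ∈ Set.Ioi (0 : ℝ), ((x : ℂ) ^ (-s - 1)) • fractTail x =
      (Set.Ioi (1 : ℝ)).indicator (fun x : ℝ ↦ ((Int.fract x : ℝ) : ℂ) * (x : ℂ) ^ (-(s + 1))) x := by
    intro x _
    unfold fractTail Set.indicator
    split_ifs
    · rw [smul_eq_mul, mul_comm]; congr 2; ring
    · simp
  rw [setIntegral_congr_fun measurableSet_Ioi h1, setIntegral_indicator measurableSet_Ioi]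
  congr 2
  ext x; simp only [Set.mem_inter_iff, Set.mem_Ioi]; constructor
  · exact fun h ↦ h.2
  · exact fun h ↦ ⟨by linarith, h⟩

lemma norm_mellin_fractTail_le {s : ℂ} (hs : 0 < s.re) : ‖mellin fractTail (-s)‖ ≤ 1 / s.re := by
  rw [mellin_fractTail_eq]
  have hint : IntegrableOn (fun x : ℝ ↦ x ^ (-(s.re + 1))) (Set.Ioi 1) :=
    integrableOn_Ioi_rpow_of_lt (by linarith) one_pos
  have h2 : ∫ x in Set.Ioi (1 : ℝ), x ^ (-(s.re + 1)) = 1 / s.re := by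
    rw [integral_Ioi_rpow_of_lt (by linarith) one_pos]
    rw [show -(s.re + 1) + 1 = -s.re by ring]; simp
  rw [← h2]
  refine norm_integral_le_of_norm_le hint ?_
  filter_upwards [ae_restrict_mem measurableSet_Ioi] with x hx
  have hx0 : 0 < x := lt_trans one_pos hx
  rw [norm_mul, Complex.norm_real, Real.norm_of_nonneg (Int.fract_nonneg x),
    Complex.norm_cpow_eq_rpow_re_of_pos hx0]
  have : (-(s + 1)).re = -(s.re + 1) := by simp
  rw [this]
  exact mul_le_of_le_one_left (Real.rpow_nonneg hx0.le _) (Int.fract_lt_one x).le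

lemma riemannZeta₁_eq_sub_mul {s : ℂ} (hs : s ≠ 1) :
    riemannZeta₁ s = (s - 1) * riemannZeta s := by
  rw [riemannZeta_eq_inv_sub_mul hs, mul_inv_cancel_left₀ (sub_ne_zero.2 hs)]

lemma riemannZeta₁_eq_of_one_lt {s : ℂ} (hs : 1 < s.re) :
    riemannZeta₁ s = s - s * (s - 1) * mellin fractTail (-s) := by
  have hs1 : s ≠ 1 := fun h ↦ by simp [h] at hs
  have hs0 : s - 1 ≠ 0 := sub_ne_zero.2 hs1
  have hz : riemannZeta s = s * ∫ t in Set.Ioi (1 : ℝ),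
      ((⌊t⌋₊ : ℝ) : ℂ) * (t : ℂ) ^ (-(s + 1)) := by
    have := LSeries_eq_mul_integral_of_nonneg (fun _ ↦ 1) (r := 1) zero_le_one hs
      (by
        refine Asymptotics.IsBigO.of_bound 1 (Filter.Eventually.of_forall fun n ↦ ?_)
        simp) (fun _ ↦ zero_le_one)
    rw [← LSeries_one_eq_riemannZeta hs]
    convert this using 1
    · simp; rfl
    · simp
  have hi1 : IntegrableOn (fun t : ℝ ↦ (t : ℂ) ^ (-s)) (Set.Ioi 1) :=
    integrableOn_Ioi_cpow_of_lt (by simpa using hs) one_pos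
  have hv : ∫ t in Set.Ioi (1 : ℝ), (t : ℂ) ^ (-s) = 1 / (s - 1) := by
    rw [integral_Ioi_cpow_of_lt (by simpa using hs) one_pos]
    simp only [Complex.ofReal_one, Complex.one_cpow]
    rw [show -s + 1 = -(s - 1) by ring, neg_div_neg_eq]
  have hi2 : IntegrableOn (fun x : ℝ ↦ ((Int.fract x : ℝ) : ℂ) * (x : ℂ) ^ (-(s + 1)))
      (Set.Ioi 1) := by
    have hg : IntegrableOn (fun t : ℝ ↦ (t : ℂ) ^ (-(s + 1))) (Set.Ioi 1) :=
      integrableOn_Ioi_cpow_of_lt (by simp; linarith) one_pos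
    refine Integrable.bdd_mul (c := 1) hg
      (Complex.measurable_ofReal.comp measurable_fract).aestronglyMeasurable
      (Filter.Eventually.of_forall fun x ↦ ?_)
    rw [Complex.norm_real, Real.norm_of_nonneg (Int.fract_nonneg x)]
    exact (Int.fract_lt_one x).le
  have hsplit : ∫ t in Set.Ioi (1 : ℝ), ((⌊t⌋₊ : ℝ) : ℂ) * (t : ℂ) ^ (-(s + 1)) =
      1 / (s - 1) - mellin fractTail (-s) := by
    rw [mellin_fractTail_eq, ← hv, ← integral_sub hi1 hi2]
    refine setIntegral_congr_fun measurableSet_Ioi fun t (ht : 1 < t) ↦ ?_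
    have ht0 : (0 : ℝ) < t := lt_trans one_pos ht
    have hfl : ((⌊t⌋₊ : ℝ)) = t - Int.fract t := by
      rw [natCast_floor_eq_intCast_floor ht0.le, ← Int.self_sub_fract]
    have htc : (t : ℂ) ≠ 0 := by exact_mod_cast ht0.ne'
    have : (t : ℂ) ^ (-s) = t * (t : ℂ) ^ (-(s + 1)) := by
      rw [show -s = 1 + -(s + 1) by ring, Complex.cpow_add _ _ htc, Complex.cpow_one]
    simp only [hfl, this]
    push_cast; ring
  rw [riemannZeta₁_eq_sub_mul hs1, hz, hsplit]
  field_simp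

lemma riemannZeta₁_eq {s : ℂ} (hs : 0 < s.re) :
    riemannZeta₁ s = s - s * (s - 1) * mellin fractTail (-s) := by
  have hopen : IsOpen {s : ℂ | 0 < s.re} := isOpen_lt continuous_const Complex.continuous_re
  have hconn : IsPreconnected {s : ℂ | 0 < s.re} :=
    (convex_halfSpace_re_gt 0).isPreconnected
  have h1 : AnalyticOnNhd ℂ riemannZeta₁ {s : ℂ | 0 < s.re} :=
    (differentiable_riemannZeta₁.differentiableOn).analyticOnNhd hopen
  have h2 : AnalyticOnNhd ℂ (fun s ↦ s - s * (s - 1) * mellin fractTail (-s)) {s : ℂ | 0 < s.re} := by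
    refine DifferentiableOn.analyticOnNhd (fun z hz ↦ ?_) hopen
    have := differentiableAt_mellin_fractTail (s := z) hz
    exact (by fun_prop : DifferentiableAt ℂ
      (fun s ↦ s - s * (s - 1) * mellin fractTail (-s)) z).differentiableWithinAt
  refine h1.eqOn_of_preconnected_of_eventuallyEq h2 hconn (z₀ := 2) (by simp) ?_ hs
  have : ∀ᶠ z : ℂ in nhds 2, 1 < z.re :=
    (isOpen_lt continuous_const Complex.continuous_re).mem_nhds (by simp)
  filter_upwards [this] with z hz using riemannZeta₁_eq_of_one_lt hz

lemma norm_riemannZeta₁_le {s : ℂ} (hs : 0 < s.re) :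
    ‖riemannZeta₁ s‖ ≤ ‖s‖ + ‖s‖ * ‖s - 1‖ / s.re := by
  rw [riemannZeta₁_eq hs]
  refine (norm_sub_le _ _).trans ?_
  rw [norm_mul, norm_mul]
  have := mul_le_mul_of_nonneg_left (norm_mellin_fractTail_le hs)
    (mul_nonneg (norm_nonneg s) (norm_nonneg (s - 1)))
  rw [mul_one_div] at this
  linarith

lemma one_add_sq_le_two_mul {a b : ℝ} (h : |b - a| ≤ 1 / 4) : 1 + a ^ 2 ≤ 2 * (1 + b ^ 2) := by
  have h1 := abs_le.1 h
  nlinarith [sq_nonneg (2 * b - a), sq_nonneg (b - a), h1.1, h1.2]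

lemma integrable_bound_shift (B y : ℝ) : Integrable fun t : ℝ ↦ B / (1 + (y + t) ^ 2) := by
  have := (integrable_inv_one_add_sq.comp_add_left y).const_mul B
  simpa [div_eq_mul_inv] using this

/-- Log-convexity of `L¹` norms along vertical lines. -/
theorem integral_norm_le_of_three_lines {H : ℂ → ℂ} {B : ℝ}
    (hH : ∀ s : ℂ, 0 < s.re → DifferentiableAt ℂ H s)
    (hB : ∀ s : ℂ, 1 / 4 ≤ s.re → s.re ≤ 3 → ‖H s‖ ≤ B / (1 + s.im ^ 2))
    {σ : ℝ} (h1 : 1 / 2 ≤ σ) (h2 : σ ≤ 2) :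
    ∫ t : ℝ, ‖H (σ + t * Complex.I)‖ ≤
      (∫ t : ℝ, ‖H ((1 / 2 : ℝ) + t * Complex.I)‖) ^ (1 - (σ - 1 / 2) / (2 - 1 / 2)) *
        (∫ t : ℝ, ‖H ((2 : ℝ) + t * Complex.I)‖) ^ ((σ - 1 / 2) / (2 - 1 / 2)) := by
  have hB0 : 0 ≤ B := by
    have := (norm_nonneg _).trans (hB 1 (by norm_num) (by norm_num))
    simpa using this
  have hcont : ∀ z : ℂ, 0 < z.re → Continuous fun t : ℝ ↦ H (z + t * Complex.I) := by
    intro z hz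
    refine continuous_iff_continuousAt.2 fun t ↦ ?_
    have : ContinuousAt H (z + t * Complex.I) := (hH _ (by simpa using hz)).continuousAt
    exact ContinuousAt.comp (f := fun t : ℝ ↦ z + t * Complex.I) this (by fun_prop)
  set φ : ℝ → ℂ := fun t ↦
    (starRingEnd ℂ) (H (σ + t * Complex.I)) / ‖H (σ + t * Complex.I)‖ with hφ
  have hφm : Measurable φ := by
    have := (hcont σ (by simp; linarith)).measurable
    exact (Complex.continuous_conj.measurable.comp this).div
      (Complex.measurable_ofReal.comp this.norm)
  have hφ1 : ∀ t, ‖φ t‖ ≤ 1 := by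
    intro t
    simp only [hφ, norm_div, RCLike.norm_conj, Complex.norm_real, norm_norm]
    exact div_self_le_one _
  have hbd : ∀ z : ℂ, 1 / 4 ≤ z.re → z.re ≤ 3 → ∀ t : ℝ,
      ‖H (z + t * Complex.I)‖ ≤ B / (1 + (z.im + t) ^ 2) := by
    intro z hz1 hz2 t
    simpa using hB (z + t * Complex.I) (by simpa using hz1) (by simpa using hz2)
  have hint : ∀ z : ℂ, 1 / 4 ≤ z.re → z.re ≤ 3 → Integrable fun t : ℝ ↦ H (z + t * Complex.I) :=
    fun z hz1 hz2 ↦ (integrable_bound_shift B z.im).mono'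
      (hcont z (by linarith)).aestronglyMeasurable (Filter.Eventually.of_forall (hbd z hz1 hz2))
  have hint2 : ∀ z : ℂ, 1 / 4 ≤ z.re → z.re ≤ 3 →
      Integrable fun t : ℝ ↦ H (z + t * Complex.I) * φ t := fun z hz1 hz2 ↦
    (hint z hz1 hz2).mul_bdd (c := 1) hφm.aestronglyMeasurable (Filter.Eventually.of_forall hφ1)
  set f : ℂ → ℂ := fun z ↦ ∫ t : ℝ, H (z + t * Complex.I) * φ t with hf
  have hfb : ∀ z : ℂ, 1 / 4 ≤ z.re → z.re ≤ 3 → ‖f z‖ ≤ ∫ t : ℝ, ‖H (z + t * Complex.I)‖ := by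
    intro z hz1 hz2
    refine (norm_integral_le_integral_norm _).trans (integral_mono (hint2 z hz1 hz2).norm
      (hint z hz1 hz2).norm fun t ↦ ?_)
    simp only [norm_mul]
    exact mul_le_of_le_one_right (norm_nonneg _) (hφ1 t)
  have hinv : ∀ z : ℂ, ∫ t : ℝ, ‖H (z + t * Complex.I)‖ =
      ∫ t : ℝ, ‖H ((z.re : ℂ) + t * Complex.I)‖ := by
    intro z
    rw [← integral_add_left_eq_self (fun t : ℝ ↦ ‖H ((z.re : ℂ) + t * Complex.I)‖) z.im]
    congr 1; ext t; congr 2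
    conv_lhs => rw [← Complex.re_add_im z]
    push_cast; ring
  have hdiff : ∀ z : ℂ, 1 / 2 ≤ z.re → z.re ≤ 2 → DifferentiableAt ℂ f z := by
    intro z hz1 hz2
    have hball : ∀ w ∈ Metric.ball z (1 / 8), 3 / 8 ≤ w.re ∧ w.re ≤ 17 / 8 ∧ |w.im - z.im| ≤ 1 / 8 := by
      intro w hw
      rw [mem_ball_iff_norm] at hw
      have a := (Complex.abs_re_le_norm (w - z)).trans hw.le
      have b := (Complex.abs_im_le_norm (w - z)).trans hw.le
      simp only [Complex.sub_re, Complex.sub_im] at a b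
      have := abs_le.1 a
      exact ⟨by linarith, by linarith, b⟩
    have key := hasDerivAt_integral_of_dominated_loc_of_deriv_le (μ := volume)
      (F := fun w (t : ℝ) ↦ H (w + t * Complex.I) * φ t)
      (F' := fun w (t : ℝ) ↦ deriv H (w + t * Complex.I) * φ t)
      (x₀ := z) (s := Metric.ball z (1 / 8))
      (bound := fun t ↦ (16 * B) / (1 + (z.im + t) ^ 2))
      (Metric.ball_mem_nhds z (by norm_num)) ?_ (hint2 z (by linarith) (by linarith)) ?_ ?_
      (integrable_bound_shift _ _) ?_
    · exact key.2.differentiableAt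
    · filter_upwards [Metric.ball_mem_nhds z (show (0 : ℝ) < 1 / 8 by norm_num)] with w hw
      obtain ⟨a, b, -⟩ := hball w hw
      exact (hint2 w (by linarith) (by linarith)).aestronglyMeasurable
    · refine AEStronglyMeasurable.mul ?_ hφm.aestronglyMeasurable
      exact ((measurable_deriv H).comp (by fun_prop)).aestronglyMeasurable
    · refine Filter.Eventually.of_forall fun t w hw ↦ ?_
      obtain ⟨a, b, c⟩ := hball w hw
      rw [norm_mul]
      refine (mul_le_of_le_one_right (norm_nonneg _) (hφ1 t)).trans ?_
      have hC : ∀ v ∈ Metric.sphere (w + t * Complex.I) (1 / 8 : ℝ),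
          ‖H v‖ ≤ 2 * B / (1 + (z.im + t) ^ 2) := by
        intro v hv
        rw [mem_sphere_iff_norm] at hv
        have a' := (Complex.abs_re_le_norm (v - (w + t * Complex.I))).trans hv.le
        have b' := (Complex.abs_im_le_norm (v - (w + t * Complex.I))).trans hv.le
        simp only [Complex.sub_re, Complex.sub_im, Complex.add_re, Complex.add_im,
          Complex.mul_re, Complex.mul_im, Complex.ofReal_re, Complex.ofReal_im, Complex.I_re,
          Complex.I_im, mul_zero, mul_one, sub_zero, add_zero] at a' b'
        have a'' := abs_le.1 a'
        have b'' := abs_le.1 b'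
        have c'' := abs_le.1 c
        refine (hB v (by linarith) (by linarith)).trans ?_
        rw [div_le_div_iff₀ (by positivity) (by positivity)]
        have := one_add_sq_le_two_mul (a := z.im + t) (b := v.im)
          (abs_le.2 ⟨by linarith, by linarith⟩)
        nlinarith
      have hd : DiffContOnCl ℂ H (Metric.ball (w + t * Complex.I) (1 / 8)) := by
        refine DifferentiableOn.diffContOnCl fun v hv ↦ (hH v ?_).differentiableWithinAt
        have := Metric.closure_ball_subset_closedBall hv
        rw [mem_closedBall_iff_norm] at this
        have a' := (Complex.abs_re_le_norm (v - (w + t * Complex.I))).trans this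
        simp only [Complex.sub_re, Complex.add_re, 
          Complex.mul_re, Complex.ofReal_re, Complex.ofReal_im, Complex.I_re,
          Complex.I_im, mul_zero, mul_one, sub_zero, add_zero] at a'
        have a'' := abs_le.1 a'
        linarith
      refine (Complex.norm_deriv_le_of_forall_mem_sphere_norm_le (by norm_num) hd hC).trans ?_
      exact le_of_eq (by ring)
    · refine Filter.Eventually.of_forall fun t w hw ↦ ?_
      obtain ⟨a, b, c⟩ := hball w hw
      have : HasDerivAt H (deriv H (w + t * Complex.I)) (w + t * Complex.I) :=
        (hH _ (by simp; linarith)).hasDerivAt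
      exact (this.comp_add_const w (t * Complex.I)).mul_const _
  have hcl : closure (Complex.HadamardThreeLines.verticalStrip (1 / 2) 2) ⊆
      Complex.HadamardThreeLines.verticalClosedStrip (1 / 2) 2 :=
    closure_minimal (Set.preimage_mono Set.Ioo_subset_Icc_self)
      (isClosed_Icc.preimage Complex.continuous_re)
  have hdc : DiffContOnCl ℂ f (Complex.HadamardThreeLines.verticalStrip (1 / 2) 2) := by
    refine DifferentiableOn.diffContOnCl fun v hv ↦ ?_
    have := hcl hv
    exact (hdiff v this.1 this.2).differentiableWithinAt
  have hbdd : BddAbove ((norm ∘ f) '' Complex.HadamardThreeLines.verticalClosedStrip (1 / 2) 2) := by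
    refine ⟨∫ t : ℝ, B / (1 + t ^ 2), ?_⟩
    rintro _ ⟨z, hz, rfl⟩
    obtain ⟨hz1, hz2⟩ : 1 / 2 ≤ z.re ∧ z.re ≤ 2 := hz
    refine (hfb z (by linarith) (by linarith)).trans ?_
    rw [← integral_add_left_eq_self (fun t : ℝ ↦ B / (1 + t ^ 2)) z.im]
    exact integral_mono (hint z (by linarith) (by linarith)).norm (integrable_bound_shift _ _)
      (hbd z (by linarith) (by linarith))
  have key := Complex.HadamardThreeLines.norm_le_interp_of_mem_verticalClosedStrip'
    (z := (σ : ℂ)) (by norm_num : (1 / 2 : ℝ) < 2) (by exact ⟨by simpa using h1, by simpa using h2⟩)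
    hdc hbdd
    (a := ∫ t : ℝ, ‖H ((1 / 2 : ℝ) + t * Complex.I)‖) (b := ∫ t : ℝ, ‖H ((2 : ℝ) + t * Complex.I)‖)
    (by
      intro z hz
      have hz : z.re = 1 / 2 := hz
      refine (hfb z (by linarith) (by linarith)).trans ?_
      rw [hinv, hz])
    (by
      intro z hz
      have hz : z.re = 2 := hz
      refine (hfb z (by linarith) (by linarith)).trans ?_
      rw [hinv, hz])
  have hfσ : f σ = ((∫ t : ℝ, ‖H (σ + t * Complex.I)‖ : ℝ) : ℂ) := by
    rw [← integral_complex_ofReal]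
    refine integral_congr_ae (Filter.Eventually.of_forall fun t ↦ ?_)
    simp only [hφ]
    rw [← mul_div_assoc, Complex.mul_conj, Complex.normSq_eq_norm_sq]
    by_cases h0 : ‖H (σ + t * Complex.I)‖ = 0
    · simp [h0]
    · have : ((‖H (σ + t * Complex.I)‖ : ℝ) : ℂ) ≠ 0 := by exact_mod_cast h0
      push_cast
      field_simp
  rw [hfσ, Complex.norm_real, Complex.ofReal_re, Real.norm_of_nonneg
    (integral_nonneg fun _ ↦ norm_nonneg _)] at key
  exact key

open Finset in
/-- The coefficients of the power series `(1 - X)⁻ᶻ`. -/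
noncomputable def binomCoef (z : ℝ) (k : ℕ) : ℝ := ∏ j ∈ range k, (z + j) / (1 + j)

lemma binomCoef_zero (z : ℝ) : binomCoef z 0 = 1 := by simp [binomCoef]

lemma binomCoef_succ (z : ℝ) (k : ℕ) : (k + 1) * binomCoef z (k + 1) = (z + k) * binomCoef z k := by
  rw [binomCoef, binomCoef, Finset.prod_range_succ]
  have : (1 + (k : ℝ)) ≠ 0 := by positivity
  field_simp
  ring

lemma binomCoef_one_left (k : ℕ) : binomCoef 1 k = 1 :=
  Finset.prod_eq_one fun j _ ↦ div_self (by positivity)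

lemma binomCoef_one_right (z : ℝ) : binomCoef z 1 = z := by simp [binomCoef]

lemma binomCoef_nonneg {z : ℝ} (hz : 0 ≤ z) (k : ℕ) : 0 ≤ binomCoef z k :=
  Finset.prod_nonneg fun j _ ↦ by positivity

lemma binomCoef_le_one {z : ℝ} (hz : 0 ≤ z) (hz1 : z ≤ 1) (k : ℕ) : binomCoef z k ≤ 1 :=
  Finset.prod_le_one (fun j _ ↦ by positivity) fun j _ ↦ by
    rw [div_le_one (by positivity)]; linarith

lemma binomCoef_half_sq_le (k : ℕ) : binomCoef (1 / 2) k ^ 2 ≤ binomCoef (1 / 4) k := by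
  rw [binomCoef, binomCoef, ← Finset.prod_pow]
  refine Finset.prod_le_prod (fun j _ ↦ by positivity) fun j _ ↦ ?_
  rw [div_pow, div_le_div_iff₀ (by positivity) (by positivity)]
  have : (0 : ℝ) ≤ j := by positivity
  nlinarith [mul_nonneg this this]

open Finset in
lemma sum_binomCoef_mul (z w : ℝ) (k : ℕ) :
    ∑ i ∈ range (k + 1), binomCoef z i * binomCoef w (k - i) = binomCoef (z + w) k := by
  induction k with
  | zero => simp [binomCoef]
  | succ k ih =>
    have hk : (k + 1 : ℝ) ≠ 0 := by positivity
    rw [← mul_right_inj' hk, binomCoef_succ, ← ih, mul_sum, mul_sum]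
    have h1 : ∀ i ∈ range (k + 1 + 1), ((k : ℝ) + 1) * (binomCoef z i * binomCoef w (k + 1 - i)) =
        i * binomCoef z i * binomCoef w (k + 1 - i) +
          binomCoef z i * (((k + 1 - i : ℕ) : ℝ) * binomCoef w (k + 1 - i)) := by
      intro i hi
      rw [mem_range] at hi
      rw [Nat.cast_sub (by lia)]; push_cast; ring
    rw [sum_congr rfl h1, sum_add_distrib, sum_range_succ', sum_range_succ _ (k + 1)]
    simp only [Nat.cast_zero, zero_mul, add_zero, Nat.sub_self, mul_zero]
    rw [← sum_add_distrib]
    refine sum_congr rfl fun i hi ↦ ?_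
    rw [mem_range] at hi
    have e1 : k + 1 - (i + 1) = k - i := by lia
    have e2 : k + 1 - i = (k - i) + 1 := by lia
    rw [e1, e2]
    have a1 := binomCoef_succ z i
    have a2 := binomCoef_succ w (k - i)
    push_cast at a1 a2 ⊢
    rw [a1, a2, Nat.cast_sub (by lia)]
    ring

/-- The coefficients of the Dirichlet series of `ζ(s)ᶻ`. -/
noncomputable def zetaPow (z : ℝ) : ArithmeticFunction ℝ where
  toFun n := if n = 0 then 0 else n.factorization.prod fun _ k ↦ binomCoef z k
  map_zero' := by simp

lemma zetaPow_apply (z : ℝ) {n : ℕ} (hn : n ≠ 0) :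
    zetaPow z n = n.factorization.prod fun _ k ↦ binomCoef z k := by
  simp [zetaPow, hn]

lemma isMultiplicative_zetaPow (z : ℝ) : (zetaPow z).IsMultiplicative := by
  refine ArithmeticFunction.IsMultiplicative.iff_ne_zero.2 ⟨?_, fun {m n} hm hn h ↦ ?_⟩
  · simp [zetaPow_apply]
  · rw [zetaPow_apply z hm, zetaPow_apply z hn, zetaPow_apply z (mul_ne_zero hm hn),
      Nat.factorization_mul_of_coprime h, Finsupp.prod_add_index_of_disjoint]
    simpa using h.disjoint_primeFactors

lemma zetaPow_prime_pow (z : ℝ) {p : ℕ} (hp : p.Prime) (k : ℕ) :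
    zetaPow z (p ^ k) = binomCoef z k := by
  rw [zetaPow_apply z (pow_ne_zero _ hp.ne_zero), hp.factorization_pow,
    Finsupp.prod_single_index]
  exact binomCoef_zero z

lemma zetaPow_mul (z w : ℝ) : zetaPow z * zetaPow w = zetaPow (z + w) := by
  rw [ArithmeticFunction.IsMultiplicative.eq_iff_eq_on_prime_powers _
    ((isMultiplicative_zetaPow z).mul (isMultiplicative_zetaPow w)) _
    (isMultiplicative_zetaPow _)]
  intro p k hp
  rw [ArithmeticFunction.mul_apply, Nat.sum_divisorsAntidiagonal (fun a b ↦ zetaPow z a * zetaPow w b),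
    Nat.sum_divisors_prime_pow hp, zetaPow_prime_pow _ hp, ← sum_binomCoef_mul]
  refine Finset.sum_congr rfl fun i hi ↦ ?_
  rw [Finset.mem_range] at hi
  rw [Nat.pow_div (by lia) hp.pos, zetaPow_prime_pow _ hp, zetaPow_prime_pow _ hp]

lemma zetaPow_one {n : ℕ} (hn : n ≠ 0) : zetaPow 1 n = 1 := by
  rw [zetaPow_apply _ hn]
  exact Finset.prod_eq_one fun p _ ↦ binomCoef_one_left _

lemma zetaPow_nonneg {z : ℝ} (hz : 0 ≤ z) (n : ℕ) : 0 ≤ zetaPow z n := by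
  by_cases hn : n = 0
  · simp [hn]
  · rw [zetaPow_apply _ hn]
    exact Finset.prod_nonneg fun p _ ↦ binomCoef_nonneg hz _

lemma zetaPow_le_one {z : ℝ} (hz : 0 ≤ z) (hz1 : z ≤ 1) (n : ℕ) : zetaPow z n ≤ 1 := by
  by_cases hn : n = 0
  · simp [hn]
  · rw [zetaPow_apply _ hn]
    exact Finset.prod_le_one (fun p _ ↦ binomCoef_nonneg hz _) fun p _ ↦ binomCoef_le_one hz hz1 _

lemma zetaPow_half_sq_le (n : ℕ) : zetaPow (1 / 2) n ^ 2 ≤ zetaPow (1 / 4) n := by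
  by_cases hn : n = 0
  · simp [hn]
  · rw [zetaPow_apply _ hn, zetaPow_apply _ hn, Finsupp.prod, ← Finset.prod_pow]
    exact Finset.prod_le_prod (fun p _ ↦ sq_nonneg _) fun p _ ↦ binomCoef_half_sq_le _

lemma zetaPow_half_sq_of_squarefree {n : ℕ} (hn : Squarefree n) :
    zetaPow (1 / 2) n ^ 2 = zetaPow (1 / 4) n := by
  rw [zetaPow_apply _ hn.ne_zero, zetaPow_apply _ hn.ne_zero, Finsupp.prod, ← Finset.prod_pow]
  refine Finset.prod_congr rfl fun p hp ↦ ?_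
  have h1 : n.factorization p = 1 := by
    refine le_antisymm (hn.natFactorization_le_one p) (Nat.one_le_iff_ne_zero.2 ?_)
    exact Finsupp.mem_support_iff.1 hp
  simp only [h1, binomCoef_one_right]; norm_num

/-- The logarithmic partial sum `∑_{n ≤ N} f(n)/n`. -/
noncomputable def logSum (f : ArithmeticFunction ℝ) (N : ℕ) : ℝ := ∑ n ∈ Finset.Ioc 0 N, f n / n

lemma logSum_nonneg {f : ArithmeticFunction ℝ} (hf : ∀ n, 0 ≤ f n) (N : ℕ) : 0 ≤ logSum f N :=
  Finset.sum_nonneg fun n _ ↦ div_nonneg (hf n) (Nat.cast_nonneg n)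

/-- The arithmetic function `f(n)/n`. -/
noncomputable def divSelf (f : ArithmeticFunction ℝ) : ArithmeticFunction ℝ where
  toFun n := f n / n
  map_zero' := by simp

lemma divSelf_apply (f : ArithmeticFunction ℝ) (n : ℕ) : divSelf f n = f n / n := rfl

open Finset in
lemma logSum_mul_eq (f g : ArithmeticFunction ℝ) (N : ℕ) :
    logSum (f * g) N = ∑ x ∈ Ioc 0 N ×ˢ Ioc 0 N with x.1 * x.2 ≤ N, f x.1 / x.1 * (g x.2 / x.2) := by
  have h := ArithmeticFunction.sum_Ioc_mul_eq_sum_prod_filter (divSelf f) (divSelf g) N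
  simp only [divSelf_apply] at h
  rw [← h, logSum]
  refine sum_congr rfl fun n hn ↦ ?_
  rw [ArithmeticFunction.mul_apply, ArithmeticFunction.mul_apply, sum_div]
  refine sum_congr rfl fun x hx ↦ ?_
  rw [← (Nat.mem_divisorsAntidiagonal.1 hx).1]
  simp only [divSelf_apply]
  push_cast
  rw [mul_div_mul_comm]

open Finset in
lemma logSum_mul_le {f g : ArithmeticFunction ℝ} (hf : ∀ n, 0 ≤ f n) (hg : ∀ n, 0 ≤ g n) (N : ℕ) :
    logSum (f * g) N ≤ logSum f N * logSum g N := by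
  rw [logSum_mul_eq, logSum, logSum, sum_mul_sum, ← sum_product']
  refine sum_le_sum_of_subset_of_nonneg (filter_subset _ _) fun x _ _ ↦ ?_
  have := hf x.1; have := hg x.2
  positivity

open Finset in
lemma le_logSum_mul {f g : ArithmeticFunction ℝ} (hf : ∀ n, 0 ≤ f n) (hg : ∀ n, 0 ≤ g n) (N M : ℕ) :
    logSum f N * logSum g M ≤ logSum (f * g) (N * M) := by
  rw [logSum_mul_eq, logSum, logSum, sum_mul_sum, ← sum_product']
  refine sum_le_sum_of_subset_of_nonneg ?_ fun x _ _ ↦ ?_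
  · intro x hx
    simp only [mem_product, mem_Ioc, mem_filter] at hx ⊢
    obtain ⟨⟨a, b⟩, c, d⟩ := hx
    have hN : 1 ≤ N := by lia
    have hM : 1 ≤ M := by lia
    exact ⟨⟨⟨a, by nlinarith⟩, c, by nlinarith⟩, Nat.mul_le_mul b d⟩
  · have := hf x.1; have := hg x.2
    positivity

lemma logSum_zetaPow_one (N : ℕ) : logSum (zetaPow 1) N = harmonic N := by
  rw [harmonic_eq_sum_Icc, logSum]
  push_cast
  refine Finset.sum_congr rfl fun n hn ↦ ?_
  rw [Finset.mem_Icc] at hn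
  rw [zetaPow_one (by lia), one_div]

lemma logSum_zetaPow_quarter_pow_le {N : ℕ} :
    logSum (zetaPow (1 / 4)) N ^ 4 ≤ 1 + 4 * Real.log N := by
  have h4 : ∀ n, 0 ≤ zetaPow (1 / 4) n := zetaPow_nonneg (by norm_num)
  have h2 : ∀ n, 0 ≤ zetaPow (1 / 2) n := zetaPow_nonneg (by norm_num)
  have a := le_logSum_mul h4 h4 N N
  rw [zetaPow_mul, show (1 / 4 + 1 / 4 : ℝ) = 1 / 2 by norm_num] at a
  have b := le_logSum_mul h2 h2 (N * N) (N * N)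
  rw [zetaPow_mul, show (1 / 2 + 1 / 2 : ℝ) = 1 by norm_num, logSum_zetaPow_one] at b
  have c := harmonic_le_one_add_log (N * N * (N * N))
  have e : Real.log ((N * N * (N * N) : ℕ) : ℝ) = 4 * Real.log N := by
    rw [show N * N * (N * N) = N ^ 4 by ring]; push_cast; rw [Real.log_pow]; norm_num
  rw [e] at c
  have h0 := logSum_nonneg h4 N
  calc logSum (zetaPow (1 / 4)) N ^ 4
      = (logSum (zetaPow (1 / 4)) N * logSum (zetaPow (1 / 4)) N) ^ 2 := by ring
    _ ≤ logSum (zetaPow (1 / 2)) (N * N) ^ 2 := by gcongr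
    _ ≤ 1 + 4 * Real.log N := by rw [sq]; linarith

lemma sum_half_sq_div_pow_le (N : ℕ) :
    (∑ n ∈ Finset.Ioc 0 N, zetaPow (1 / 2) n ^ 2 / n) ^ 4 ≤ 1 + 4 * Real.log N := by
  refine le_trans ?_ (logSum_zetaPow_quarter_pow_le (N := N))
  refine pow_le_pow_left₀ (Finset.sum_nonneg fun n _ ↦ by positivity) ?_ 4
  exact Finset.sum_le_sum fun n _ ↦ by gcongr; exact zetaPow_half_sq_le n

lemma mul_eq_mul_on_squarefree {f f' g g' : ArithmeticFunction ℝ}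
    (h : ∀ n, Squarefree n → f n = g n) (h' : ∀ n, Squarefree n → f' n = g' n) :
    ∀ n, Squarefree n → (f * f') n = (g * g') n := by
  intro n hn
  rw [ArithmeticFunction.mul_apply, ArithmeticFunction.mul_apply]
  refine Finset.sum_congr rfl fun x hx ↦ ?_
  have := (Nat.mem_divisorsAntidiagonal.1 hx).1
  rw [h _ (hn.squarefree_of_dvd ⟨_, this.symm⟩),
    h' _ (hn.squarefree_of_dvd ⟨_, by rw [← this, mul_comm]⟩)]

lemma sum_Ioc_inv_sq_le_two (N : ℕ) : ∑ n ∈ Finset.Ioc 0 N, ((n : ℝ) ^ 2)⁻¹ ≤ 2 := by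
  have h : ∀ N : ℕ, ∑ n ∈ Finset.Ioc 0 (N + 1), ((n : ℝ) ^ 2)⁻¹ ≤ 2 - 1 / (N + 1) := by
    intro N
    induction N with
    | zero => norm_num
    | succ N ih =>
      rw [← Finset.insert_Ioc_right_eq_Ioc_add_one (by lia), Finset.sum_insert (by simp)]
      push_cast
      have : (((N : ℝ) + 1 + 1) ^ 2)⁻¹ ≤ 1 / ((N : ℝ) + 1) - 1 / (N + 1 + 1) := by
        rw [div_sub_div _ _ (by positivity) (by positivity), inv_eq_one_div,
          div_le_div_iff₀ (by positivity) (by positivity)]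
        ring_nf
        have : (0 : ℝ) ≤ N := by positivity
        nlinarith
      linarith
  rcases N with _ | N
  · simp
  · refine (h N).trans ?_
    have : (0 : ℝ) ≤ 1 / (N + 1) := by positivity
    linarith

open Finset in
lemma log_succ_le_two_mul_sum_squarefree (N : ℕ) :
    Real.log (N + 1) ≤ 2 * ∑ n ∈ Ioc 0 N with Squarefree n, (1 : ℝ) / n := by
  have h1 := log_add_one_le_harmonic N
  rw [harmonic_eq_sum_Icc] at h1
  push_cast at h1
  refine h1.trans ?_
  have hex : ∀ n : ℕ, ∃ x : ℕ × ℕ, x.2 ^ 2 * x.1 = n ∧ Squarefree x.1 := fun n ↦ by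
    obtain ⟨a, b, h, h'⟩ := Nat.sq_mul_squarefree n
    exact ⟨(a, b), h, h'⟩
  choose i hi hi' using hex
  have hinj : Set.InjOn i (Icc 1 N : Finset ℕ) := fun m _ n _ h ↦ by rw [← hi m, ← hi n, h]
  have : ∑ n ∈ Icc 1 N, ((n : ℝ))⁻¹ =
      ∑ x ∈ (Icc 1 N).image i, (1 : ℝ) / x.1 * ((x.2 : ℝ) ^ 2)⁻¹ := by
    rw [sum_image hinj]
    refine sum_congr rfl fun n _ ↦ ?_
    conv_lhs => rw [← hi n]
    push_cast
    rw [mul_inv, one_div, mul_comm]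
  rw [this]
  calc _ ≤ ∑ x ∈ ((Ioc 0 N).filter Squarefree) ×ˢ Ioc 0 N, (1 : ℝ) / x.1 * ((x.2 : ℝ) ^ 2)⁻¹ := by
        refine sum_le_sum_of_subset_of_nonneg ?_ fun x _ _ ↦ by positivity
        intro x hx
        obtain ⟨n, hn, rfl⟩ := mem_image.1 hx
        rw [mem_Icc] at hn
        have h := hi n
        have h2 : (i n).2 ≠ 0 := fun h0 ↦ by rw [h0] at h; lia
        have h1 : (i n).1 ≠ 0 := fun h0 ↦ by rw [h0] at h; lia
        have h1' : 1 ≤ (i n).1 := Nat.one_le_iff_ne_zero.2 h1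
        have h2' : 1 ≤ (i n).2 := Nat.one_le_iff_ne_zero.2 h2
        simp only [mem_product, mem_filter, mem_Ioc]
        have h3 : 1 ≤ (i n).2 ^ 2 := Nat.one_le_pow _ _ h2'
        have h4 : (i n).2 ≤ (i n).2 ^ 2 := Nat.le_self_pow (by lia) _
        exact ⟨⟨⟨h1', by nlinarith⟩, hi' n⟩, h2', by nlinarith⟩
    _ = (∑ n ∈ Ioc 0 N with Squarefree n, (1 : ℝ) / n) * ∑ n ∈ Ioc 0 N, ((n : ℝ) ^ 2)⁻¹ := by
        rw [sum_mul_sum, ← sum_product']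
    _ ≤ _ := by
        rw [mul_comm]
        exact mul_le_mul_of_nonneg_right (sum_Ioc_inv_sq_le_two N)
          (sum_nonneg fun n _ ↦ by positivity)

lemma log_le_sum_half_sq_div_pow (N : ℕ) :
    Real.log (N + 1) ≤ 2 * (∑ n ∈ Finset.Ioc 0 N, zetaPow (1 / 2) n ^ 2 / n) ^ 4 := by
  refine (log_succ_le_two_mul_sum_squarefree N).trans ?_
  set A : ArithmeticFunction ℝ := ⟨fun n ↦ zetaPow (1 / 2) n ^ 2, by simp⟩ with hA
  have hA0 : ∀ n, 0 ≤ A n := fun n ↦ sq_nonneg _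
  have hAd : ∀ n, Squarefree n → A n = zetaPow (1 / 4) n := fun n hn ↦
    zetaPow_half_sq_of_squarefree hn
  have h2 := mul_eq_mul_on_squarefree hAd hAd
  have h4 := mul_eq_mul_on_squarefree h2 h2
  rw [zetaPow_mul, zetaPow_mul, show (1 / 4 + 1 / 4 + (1 / 4 + 1 / 4) : ℝ) = 1 by norm_num] at h4
  have hAA0 : ∀ n, 0 ≤ (A * A) n := fun n ↦ by
    rw [ArithmeticFunction.mul_apply]
    exact Finset.sum_nonneg fun x _ ↦ mul_nonneg (hA0 _) (hA0 _)
  have hAAAA0 : ∀ n, 0 ≤ (A * A * (A * A)) n := fun n ↦ by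
    rw [ArithmeticFunction.mul_apply]
    exact Finset.sum_nonneg fun x _ ↦ mul_nonneg (hAA0 _) (hAA0 _)
  have e : ∑ n ∈ Finset.Ioc 0 N, zetaPow (1 / 2) n ^ 2 / n = logSum A N := rfl
  rw [e]
  gcongr
  calc _ = ∑ n ∈ Finset.Ioc 0 N with Squarefree n, (A * A * (A * A)) n / n := by
        refine Finset.sum_congr rfl fun n hn ↦ ?_
        have hn := (Finset.mem_filter.1 hn).2
        rw [h4 n hn, zetaPow_one hn.ne_zero]
    _ ≤ logSum (A * A * (A * A)) N :=
        Finset.sum_le_sum_of_subset_of_nonneg (Finset.filter_subset _ _) fun n _ _ ↦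
          div_nonneg (hAAAA0 n) (Nat.cast_nonneg n)
    _ ≤ logSum (A * A) N * logSum (A * A) N := logSum_mul_le hAA0 hAA0 N
    _ ≤ (logSum A N * logSum A N) * (logSum A N * logSum A N) :=
        mul_le_mul (logSum_mul_le hA0 hA0 N) (logSum_mul_le hA0 hA0 N)
          (logSum_nonneg hAA0 N) (mul_nonneg (logSum_nonneg hA0 N) (logSum_nonneg hA0 N))
    _ = logSum A N ^ 4 := by ring

/-- The Gaussian window of width `Δ` centred at `τ`. -/
noncomputable def gaussWindow (Δ τ t : ℝ) : ℝ := Real.exp (-((t - τ) / Δ) ^ 2)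

lemma gaussWindow_pos (Δ τ t : ℝ) : 0 < gaussWindow Δ τ t := Real.exp_pos _

lemma gaussWindow_le_one (Δ τ t : ℝ) : gaussWindow Δ τ t ≤ 1 :=
  Real.exp_le_one_iff.2 (neg_nonpos.2 (sq_nonneg _))

lemma continuous_gaussWindow (Δ τ : ℝ) : Continuous (gaussWindow Δ τ) := by
  unfold gaussWindow; fun_prop

lemma gaussWindow_eq_comp (Δ τ : ℝ) :
    gaussWindow Δ τ = fun t ↦ (fun t ↦ Real.exp (-(Δ ^ 2)⁻¹ * t ^ 2)) (t - τ) := by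
  ext t; unfold gaussWindow; congr 1; rw [div_pow]; ring

lemma integrable_gaussWindow {Δ : ℝ} (hΔ : 0 < Δ) (τ : ℝ) : Integrable (gaussWindow Δ τ) := by
  rw [gaussWindow_eq_comp]
  exact (integrable_exp_neg_mul_sq (by positivity)).comp_sub_right τ

lemma integral_gaussWindow {Δ : ℝ} (hΔ : 0 < Δ) (τ : ℝ) :
    ∫ t, gaussWindow Δ τ t = √Real.pi * Δ := by
  rw [gaussWindow_eq_comp, integral_sub_right_eq_self (fun t ↦ Real.exp (-(Δ ^ 2)⁻¹ * t ^ 2)),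
    integral_gaussian, div_inv_eq_mul, Real.sqrt_mul Real.pi_pos.le, Real.sqrt_sq hΔ.le]

lemma integral_cexp_mul_gaussWindow {Δ : ℝ} (hΔ : 0 < Δ) (τ l : ℝ) :
    ∫ t : ℝ, Complex.exp (Complex.I * l * t) * (gaussWindow Δ τ t : ℂ) =
      (√Real.pi * Δ * Real.exp (-(l * Δ) ^ 2 / 4) : ℝ) * Complex.exp (Complex.I * l * τ) := by
  have hb : 0 < (((Δ ^ 2)⁻¹ : ℝ) : ℂ).re := by rw [Complex.ofReal_re]; positivity
  have h := fourierIntegral_gaussian hb (l : ℂ)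
  rw [← integral_sub_right_eq_self _ τ] at h
  have e1 : ((Real.pi : ℂ) / (((Δ ^ 2)⁻¹ : ℝ) : ℂ)) ^ (1 / 2 : ℂ) = ((√Real.pi * Δ : ℝ) : ℂ) := by
    rw [← Complex.ofReal_div, show (1 / 2 : ℂ) = ((1 / 2 : ℝ) : ℂ) by push_cast; rfl,
      ← Complex.ofReal_cpow (by positivity), ← Real.sqrt_eq_rpow, div_inv_eq_mul,
      Real.sqrt_mul Real.pi_pos.le, Real.sqrt_sq hΔ.le]
  have e2 : Complex.exp (-(l : ℂ) ^ 2 / (4 * (((Δ ^ 2)⁻¹ : ℝ) : ℂ))) =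
      ((Real.exp (-(l * Δ) ^ 2 / 4) : ℝ) : ℂ) := by
    rw [Complex.ofReal_exp]; congr 1
    have : (Δ : ℂ) ≠ 0 := by exact_mod_cast hΔ.ne'
    push_cast; field_simp
  rw [e1, e2, ← Complex.ofReal_mul] at h
  rw [← h, ← integral_mul_const]
  refine integral_congr_ae (Filter.Eventually.of_forall fun t ↦ ?_)
  simp only
  rw [← Complex.exp_add, ← Complex.exp_add, gaussWindow_eq_comp]
  simp only [Complex.ofReal_exp]
  rw [← Complex.exp_add]
  congr 1
  push_cast; ring

lemma integral_cos_mul_gaussWindow {Δ : ℝ} (hΔ : 0 < Δ) (τ l : ℝ) :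
    ∫ t : ℝ, Real.cos (l * t) * gaussWindow Δ τ t =
      √Real.pi * Δ * Real.exp (-(l * Δ) ^ 2 / 4) * Real.cos (l * τ) := by
  have h := congrArg Complex.re (integral_cexp_mul_gaussWindow hΔ τ l)
  have hre : ∀ x : ℝ, (Complex.exp (Complex.I * l * x)).re = Real.cos (l * x) := fun x ↦ by
    rw [show Complex.I * l * x = ((l * x : ℝ) : ℂ) * Complex.I by push_cast; ring,
      Complex.exp_ofReal_mul_I_re]
  have hint : Integrable fun t : ℝ ↦
      Complex.exp (Complex.I * l * t) * (gaussWindow Δ τ t : ℂ) := by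
    refine (integrable_gaussWindow hΔ τ).ofReal.bdd_mul (c := 1)
      (by fun_prop) (Filter.Eventually.of_forall fun t ↦ ?_)
    rw [show Complex.I * l * t = ((l * t : ℝ) : ℂ) * Complex.I by push_cast; ring,
      Complex.norm_exp_ofReal_mul_I]
  have h2 := integral_re hint
  simp only [RCLike.re_eq_complex_re] at h2
  rw [← h2, Complex.re_ofReal_mul, hre] at h
  rw [← h]
  refine integral_congr_ae (Filter.Eventually.of_forall fun t ↦ ?_)
  simp only [Complex.re_mul_ofReal, hre]

/-- The Dirichlet polynomial with real coefficients `a` and length `N`. -/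
noncomputable def dirPoly (a : ℕ → ℝ) (N : ℕ) (s : ℂ) : ℂ :=
  ∑ n ∈ Finset.Ioc 0 N, (a n : ℂ) * (n : ℂ) ^ (-s)

lemma differentiable_dirPoly (a : ℕ → ℝ) (N : ℕ) : Differentiable ℂ (dirPoly a N) := by
  unfold dirPoly
  refine Differentiable.fun_sum fun n hn ↦ ?_
  have : (n : ℂ) ≠ 0 := by rw [Finset.mem_Ioc] at hn; exact_mod_cast (by lia : n ≠ 0)
  exact (differentiable_id.neg.const_cpow (Or.inl this)).const_mul _

lemma dirPoly_term_eq (c σ t : ℝ) {n : ℕ} (hn : 0 < n) :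
    (c : ℂ) * (n : ℂ) ^ (-((σ : ℂ) + t * Complex.I)) =
      ((c * (n : ℝ) ^ (-σ) : ℝ) : ℂ) * Complex.exp (((-(Real.log n * t) : ℝ) : ℂ) * Complex.I) := by
  have hn' : (n : ℂ) ≠ 0 := by exact_mod_cast hn.ne'
  rw [neg_add, Complex.cpow_add _ _ hn', Complex.ofReal_mul, mul_assoc]
  congr 2
  · rw [Complex.ofReal_cpow (by positivity)]; push_cast; rfl
  · rw [Complex.cpow_def_of_ne_zero hn', ← Complex.natCast_log]
    congr 1; push_cast; ring

lemma norm_sq_dirPoly (a : ℕ → ℝ) (N : ℕ) (σ t : ℝ) :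
    ‖dirPoly a N (σ + t * Complex.I)‖ ^ 2 = ∑ m ∈ Finset.Ioc 0 N, ∑ n ∈ Finset.Ioc 0 N,
      (a m * (m : ℝ) ^ (-σ)) * (a n * (n : ℝ) ^ (-σ)) *
        Real.cos ((Real.log n - Real.log m) * t) := by
  have h : dirPoly a N (σ + t * Complex.I) = ∑ n ∈ Finset.Ioc 0 N,
      ((a n * (n : ℝ) ^ (-σ) : ℝ) : ℂ) *
        Complex.exp (((-(Real.log n * t) : ℝ) : ℂ) * Complex.I) :=
    Finset.sum_congr rfl fun n hn ↦ dirPoly_term_eq _ _ _ (Finset.mem_Ioc.1 hn).1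
  rw [h, Complex.sq_norm, Complex.normSq_apply]
  simp only [Complex.re_sum, Complex.im_sum, Complex.re_ofReal_mul, Complex.im_ofReal_mul,
    Complex.exp_ofReal_mul_I_re, Complex.exp_ofReal_mul_I_im, Finset.sum_mul_sum]
  rw [← Finset.sum_add_distrib]
  refine Finset.sum_congr rfl fun m _ ↦ ?_
  rw [← Finset.sum_add_distrib]
  refine Finset.sum_congr rfl fun n _ ↦ ?_
  rw [show (Real.log n - Real.log m) * t = -(Real.log m * t) - -(Real.log n * t) by ring,
    Real.cos_sub]
  ring

lemma norm_dirPoly_le {a : ℕ → ℝ} (h0 : ∀ n, 0 ≤ a n) (h1 : ∀ n, a n ≤ 1) (N : ℕ) {s : ℂ}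
    (hs : 0 ≤ s.re) : ‖dirPoly a N s‖ ≤ N := by
  refine (norm_sum_le _ _).trans ?_
  calc _ ≤ ∑ n ∈ Finset.Ioc 0 N, (1 : ℝ) := by
        refine Finset.sum_le_sum fun n hn ↦ ?_
        have hn := (Finset.mem_Ioc.1 hn).1
        rw [norm_mul, Complex.norm_real, Real.norm_of_nonneg (h0 n),
          Complex.norm_natCast_cpow_of_pos hn]
        refine mul_le_one₀ (h1 n) (by positivity) ?_
        exact Real.rpow_le_one_of_one_le_of_nonpos (by exact_mod_cast hn) (by simpa using hs)
    _ = N := by simp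

lemma inv_le_abs_log_sub_log {m n N : ℕ} (hm : 0 < m) (hn : 0 < n) (hmN : m ≤ N) (hnN : n ≤ N)
    (hmn : m ≠ n) : (1 : ℝ) / N ≤ |Real.log n - Real.log m| := by
  have key : ∀ {m n : ℕ}, 0 < m → n ≤ N → m < n → (1 : ℝ) / N ≤ Real.log n - Real.log m := by
    intro m n hm hnN h
    have hm' : (0 : ℝ) < m := by exact_mod_cast hm
    have hn' : (0 : ℝ) < n := by exact_mod_cast hm.trans h
    have h1 := Real.one_sub_inv_le_log_of_pos (div_pos hn' hm')
    rw [Real.log_div hn'.ne' hm'.ne'] at h1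
    refine le_trans ?_ h1
    have h2 : (m : ℝ) + 1 ≤ n := by exact_mod_cast h
    have h3 : (n : ℝ) ≤ N := by exact_mod_cast hnN
    calc (1 : ℝ) / N ≤ 1 / n := by gcongr
      _ ≤ (n - m) / n := by gcongr; linarith
      _ = 1 - (n / m : ℝ)⁻¹ := by rw [inv_div, sub_div, div_self hn'.ne']
  rcases lt_or_gt_of_ne hmn with h | h
  · exact (key hm hnN h).trans (le_abs_self _)
  · rw [abs_sub_comm]; exact (key hn hmN h).trans (le_abs_self _)

/-- Gaussian mean value theorem for short Dirichlet polynomials. -/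
theorem abs_integral_norm_sq_dirPoly_sub_le {a : ℕ → ℝ} (h0 : ∀ n, 0 ≤ a n) (h1 : ∀ n, a n ≤ 1)
    {N : ℕ} {σ : ℝ} (hσ : 0 ≤ σ) {Δ : ℝ} (hΔ0 : 0 < Δ) (hΔ : (N : ℝ) ^ 2 ≤ Δ) (τ : ℝ) :
    |(∫ t : ℝ, ‖dirPoly a N (σ + t * Complex.I)‖ ^ 2 * gaussWindow Δ τ t) -
      ∑ n ∈ Finset.Ioc 0 N, √Real.pi * Δ * (a n ^ 2 * (n : ℝ) ^ (-(2 * σ)))| ≤ 4 * (√Real.pi * Δ) := by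
  set c : ℕ → ℝ := fun n ↦ a n * (n : ℝ) ^ (-σ) with hc
  have hc0 : ∀ n, 0 ≤ c n := fun n ↦ mul_nonneg (h0 n) (by positivity)
  have hc1 : ∀ n, 0 < n → c n ≤ 1 := fun n hn ↦ mul_le_one₀ (h1 n) (by positivity)
    (Real.rpow_le_one_of_one_le_of_nonpos (by exact_mod_cast hn) (by linarith))
  have hP : 0 < √Real.pi * Δ := mul_pos (Real.sqrt_pos.2 Real.pi_pos) hΔ0
  have hint : ∀ l : ℝ, Integrable fun t ↦ Real.cos (l * t) * gaussWindow Δ τ t := fun l ↦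
    (integrable_gaussWindow hΔ0 τ).bdd_mul (c := 1) (by fun_prop)
      (Filter.Eventually.of_forall fun t ↦ by simpa using Real.abs_cos_le_one _)
  have e1 : ∫ t : ℝ, ‖dirPoly a N (σ + t * Complex.I)‖ ^ 2 * gaussWindow Δ τ t =
      ∑ m ∈ Finset.Ioc 0 N, ∑ n ∈ Finset.Ioc 0 N, c m * c n *
        (√Real.pi * Δ * Real.exp (-((Real.log n - Real.log m) * Δ) ^ 2 / 4) *
          Real.cos ((Real.log n - Real.log m) * τ)) := by
    simp_rw [← integral_cos_mul_gaussWindow hΔ0, norm_sq_dirPoly, Finset.sum_mul, mul_assoc _ (Real.cos _)]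
    rw [integral_finsetSum _ fun m _ ↦ integrable_finsetSum _ fun n _ ↦ (hint _).const_mul _]
    refine Finset.sum_congr rfl fun m _ ↦ ?_
    rw [integral_finsetSum _ fun n _ ↦ (hint _).const_mul _]
    exact Finset.sum_congr rfl fun n _ ↦ integral_const_mul _ _
  have e2 : ∑ n ∈ Finset.Ioc 0 N, √Real.pi * Δ * (a n ^ 2 * (n : ℝ) ^ (-(2 * σ))) =
      ∑ m ∈ Finset.Ioc 0 N, ∑ n ∈ Finset.Ioc 0 N,
        if m = n then √Real.pi * Δ * (c m * c n) else 0 := by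
    refine Finset.sum_congr rfl fun m hm ↦ ?_
    rw [Finset.sum_ite_eq, if_pos hm]
    have : (m : ℝ) ^ (-(2 * σ)) = (m : ℝ) ^ (-σ) * (m : ℝ) ^ (-σ) := by
      rw [← Real.rpow_add (by exact_mod_cast (Finset.mem_Ioc.1 hm).1)]; congr 1; ring
    rw [this]; simp only [hc]; ring
  rw [e1, e2, ← Finset.sum_sub_distrib]
  simp_rw [← Finset.sum_sub_distrib]
  have hterm : ∀ m ∈ Finset.Ioc 0 N, ∀ n ∈ Finset.Ioc 0 N,
      |c m * c n * (√Real.pi * Δ * Real.exp (-((Real.log n - Real.log m) * Δ) ^ 2 / 4) *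
          Real.cos ((Real.log n - Real.log m) * τ)) -
        (if m = n then √Real.pi * Δ * (c m * c n) else 0)| ≤
      √Real.pi * Δ * Real.exp (-(N : ℝ) ^ 2 / 4) := by
    intro m hm n hn
    rw [Finset.mem_Ioc] at hm hn
    split_ifs with hmn
    · subst hmn
      simp only [sub_self, zero_mul, Real.cos_zero]
      rw [show c m * c m * (√Real.pi * Δ * Real.exp (-0 ^ 2 / 4) * 1) - √Real.pi * Δ * (c m * c m) = 0
        by norm_num; ring, abs_zero]
      positivity
    · have hN : (0 : ℝ) < N := by exact_mod_cast (by lia : 0 < N)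
      have hlog := inv_le_abs_log_sub_log hm.1 hn.1 hm.2 hn.2 hmn
      set l := Real.log n - Real.log m
      have hl : (N : ℝ) ^ 2 ≤ (l * Δ) ^ 2 := by
        rw [← sq_abs (l * Δ), abs_mul, abs_of_pos hΔ0]
        have : (N : ℝ) ≤ |l| * Δ := by
          calc (N : ℝ) = 1 / N * N ^ 2 := by field_simp
            _ ≤ |l| * Δ := by gcongr
        gcongr
      have hE : 0 ≤ √Real.pi * Δ * Real.exp (-(l * Δ) ^ 2 / 4) := by positivity
      rw [sub_zero, abs_mul (c m * c n), abs_of_nonneg (mul_nonneg (hc0 m) (hc0 n)),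
        abs_mul _ (Real.cos _), abs_of_nonneg hE]
      calc _ ≤ 1 * 1 * (√Real.pi * Δ * Real.exp (-(l * Δ) ^ 2 / 4) * 1) := by
            have := hc0 m; have := hc0 n; have := hc1 m hm.1; have := hc1 n hn.1
            have := Real.abs_cos_le_one (l * τ)
            gcongr
        _ ≤ _ := by
            rw [one_mul, one_mul, mul_one]
            gcongr
  calc _ ≤ ∑ m ∈ Finset.Ioc 0 N, ∑ n ∈ Finset.Ioc 0 N,
        √Real.pi * Δ * Real.exp (-(N : ℝ) ^ 2 / 4) := by
        refine (Finset.abs_sum_le_sum_abs _ _).trans (Finset.sum_le_sum fun m hm ↦ ?_)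
        exact (Finset.abs_sum_le_sum_abs _ _).trans (Finset.sum_le_sum fun n hn ↦ hterm m hm n hn)
    _ = 4 * (√Real.pi * Δ) * ((N : ℝ) ^ 2 / 4 * Real.exp (-((N : ℝ) ^ 2 / 4))) := by
        simp only [Finset.sum_const, Nat.card_Ioc, nsmul_eq_mul, tsub_zero]
        rw [neg_div]; ring
    _ ≤ 4 * (√Real.pi * Δ) * 1 := by
        gcongr
        rw [Real.exp_neg, ← div_eq_mul_inv, div_le_one (Real.exp_pos _)]
        linarith [Real.add_one_le_exp ((N : ℝ) ^ 2 / 4)]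
    _ = _ := mul_one _

open ArithmeticFunction in
lemma norm_riemannZeta_sub_dirPoly_sq_le (N : ℕ) {s : ℂ} (hs : s.re = 2) :
    ‖riemannZeta s - dirPoly (zetaPow (1 / 2)) N s ^ 2‖ ≤ 2 / (N + 1) := by
  obtain ⟨a, ha'⟩ : ∃ a : ArithmeticFunction ℝ,
      ∀ n, a n = if n ≤ N then zetaPow (1 / 2) n else 0 :=
    ⟨⟨fun n ↦ if n ≤ N then zetaPow (1 / 2) n else 0, by simp⟩, fun n ↦ rfl⟩
  have hz0 : ∀ n, 0 ≤ zetaPow (1 / 2) n := zetaPow_nonneg (by norm_num)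
  have ha0 : ∀ n, 0 ≤ a n := fun n ↦ by
    rw [ha']; split_ifs
    exacts [hz0 n, le_rfl]
  have hale : ∀ n, a n ≤ zetaPow (1 / 2) n := fun n ↦ by
    rw [ha']; split_ifs
    exacts [le_rfl, hz0 n]
  have hsq : zetaPow (1 / 2) * zetaPow (1 / 2) = zetaPow 1 := by
    rw [zetaPow_mul]; norm_num
  have hb0 : ∀ n, 0 ≤ (a * a) n := fun n ↦ by
    rw [mul_apply]; exact Finset.sum_nonneg fun x _ ↦ mul_nonneg (ha0 _) (ha0 _)
  have hb1 : ∀ n, n ≠ 0 → (a * a) n ≤ 1 := fun n hn ↦ by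
    rw [← zetaPow_one hn, ← hsq, mul_apply, mul_apply]
    exact Finset.sum_le_sum fun x _ ↦ mul_le_mul (hale _) (hale _) (ha0 _) (hz0 _)
  have hbN : ∀ n, n ≠ 0 → n ≤ N → (a * a) n = 1 := fun n hn hnN ↦ by
    rw [← zetaPow_one hn, ← hsq, mul_apply, mul_apply]
    refine Finset.sum_congr rfl fun x hx ↦ ?_
    have h := (Nat.mem_divisorsAntidiagonal.1 hx).1
    have h1 : x.1 ≤ N := (Nat.le_of_dvd (Nat.pos_of_ne_zero hn) ⟨_, h.symm⟩).trans hnN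
    have h2 : x.2 ≤ N :=
      (Nat.le_of_dvd (Nat.pos_of_ne_zero hn) ⟨_, by rw [← h, mul_comm]⟩).trans hnN
    rw [ha', ha', if_pos h1, if_pos h2]
  obtain ⟨A, hA'⟩ : ∃ A : ArithmeticFunction ℂ, ∀ n, A n = (a n : ℂ) :=
    ⟨⟨fun n ↦ (a n : ℂ), by simp⟩, fun n ↦ rfl⟩
  have hAA : ∀ n, (A * A) n = ((a * a) n : ℂ) := fun n ↦ by
    rw [mul_apply, mul_apply]; push_cast; simp only [hA']
  have hsupp : ∀ n ∉ Finset.Ioc 0 N, LSeries.term A s n = 0 := by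
    intro n hn
    rcases Nat.eq_zero_or_pos n with rfl | h0
    · simp
    · rw [Finset.mem_Ioc, not_and] at hn
      rw [LSeries.term_of_ne_zero h0.ne', hA', ha', if_neg (hn h0)]; simp
  have hLA : LSeries A s = dirPoly (zetaPow (1 / 2)) N s := by
    rw [LSeries, tsum_eq_sum hsupp, dirPoly]
    refine Finset.sum_congr rfl fun n hn ↦ ?_
    rw [Finset.mem_Ioc] at hn
    rw [LSeries.term_of_ne_zero hn.1.ne', hA', ha', if_pos hn.2, Complex.cpow_neg, div_eq_mul_inv]
  have hAs : LSeriesSummable A s := summable_of_ne_finset_zero hsupp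
  have h1s : LSeriesSummable 1 s := LSeriesSummable_one_iff.2 (by rw [hs]; norm_num)
  have hAAs : LSeriesSummable ⇑(A * A) s := LSeriesSummable_mul hAs hAs
  have key : riemannZeta s - dirPoly (zetaPow (1 / 2)) N s ^ 2 = LSeries ((1 : ℕ → ℂ) - ⇑(A * A)) s := by
    rw [LSeries_sub h1s hAAs, LSeries_one_eq_riemannZeta (by rw [hs]; norm_num), LSeries_mul' hAs hAs, hLA, sq]
  rw [key]
  have hterm : ∀ n, ‖LSeries.term ((1 : ℕ → ℂ) - ⇑(A * A)) s n‖ ≤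
      if N < n then ((n : ℝ) ^ 2)⁻¹ else 0 := by
    intro n
    rcases Nat.eq_zero_or_pos n with rfl | h0
    · simp
    · rw [LSeries.term_of_ne_zero h0.ne', Pi.sub_apply, Pi.one_apply, hAA, norm_div,
        Complex.norm_natCast_cpow_of_pos h0, hs]
      split_ifs with h
      · rw [← Complex.ofReal_one, ← Complex.ofReal_sub, Complex.norm_real,
          Real.norm_of_nonneg (by linarith [hb1 n h0.ne']), ← one_div, Real.rpow_two]
        gcongr
        linarith [hb0 n]
      · rw [hbN n h0.ne' (by lia)]; simp
  have hsum : ∀ m, ∑ n ∈ Finset.range m, (if N < n then ((n : ℝ) ^ 2)⁻¹ else 0) ≤ 2 / (N + 1) := by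
    intro m
    rw [← Finset.sum_filter]
    refine le_of_eq_of_le ?_ (sum_Ioo_inv_sq_le N m)
    refine Finset.sum_congr ?_ fun _ _ ↦ rfl
    ext n; simp only [Finset.mem_filter, Finset.mem_range, Finset.mem_Ioo]; tauto
  have hnn : ∀ n, 0 ≤ if N < n then ((n : ℝ) ^ 2)⁻¹ else 0 := fun n ↦ by
    split_ifs <;> positivity
  have hs2 := summable_of_sum_range_le hnn hsum
  exact (tsum_of_norm_bounded hs2.hasSum hterm).trans (Real.tsum_le_of_sum_range_le hnn hsum)

lemma norm_riemannZeta_le_two {s : ℂ} (hs : s.re = 2) : ‖riemannZeta s‖ ≤ 2 := by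
  simpa [dirPoly] using norm_riemannZeta_sub_dirPoly_sq_le 0 hs

lemma one_add_sq_sq_mul_gaussWindow_le {Δ : ℝ} (hΔ : 0 < Δ) (τ t : ℝ) :
    (1 + t ^ 2) ^ 2 * gaussWindow Δ τ t ≤ 2 * (1 + 2 * τ ^ 2 + 2 * Δ ^ 2) ^ 2 := by
  set u := (t - τ) / Δ with hu
  have ht : t = τ + Δ * u := by rw [hu]; field_simp; ring
  have h1 : 1 + t ^ 2 ≤ (1 + 2 * τ ^ 2 + 2 * Δ ^ 2) * (1 + u ^ 2) := by
    rw [ht]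
    nlinarith [sq_nonneg (τ - Δ * u), sq_nonneg (τ * u), sq_nonneg Δ, sq_nonneg u]
  have h2 : (1 + u ^ 2) ^ 2 ≤ 2 * Real.exp (u ^ 2) := by
    have := Real.quadratic_le_exp_of_nonneg (sq_nonneg u)
    nlinarith
  have hg : gaussWindow Δ τ t = (Real.exp (u ^ 2))⁻¹ := by
    rw [gaussWindow, ← hu, Real.exp_neg]
  rw [hg, ← div_eq_mul_inv, div_le_iff₀ (Real.exp_pos _)]
  calc (1 + t ^ 2) ^ 2 ≤ ((1 + 2 * τ ^ 2 + 2 * Δ ^ 2) * (1 + u ^ 2)) ^ 2 := by gcongr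
    _ = (1 + 2 * τ ^ 2 + 2 * Δ ^ 2) ^ 2 * (1 + u ^ 2) ^ 2 := by ring
    _ ≤ (1 + 2 * τ ^ 2 + 2 * Δ ^ 2) ^ 2 * (2 * Real.exp (u ^ 2)) := by gcongr
    _ = _ := by ring

lemma integrable_mul_gaussWindow_of_le {F : ℝ → ℝ} (hF : Continuous F) {K : ℝ}
    (h : ∀ t, ‖F t‖ ≤ K * (1 + t ^ 2)) {Δ : ℝ} (hΔ : 0 < Δ) (τ : ℝ) :
    Integrable fun t ↦ F t * gaussWindow Δ τ t := by
  have hK : 0 ≤ K := by simpa using (norm_nonneg _).trans (h 0)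
  refine (integrable_inv_one_add_sq.const_mul (K * (2 * (1 + 2 * τ ^ 2 + 2 * Δ ^ 2) ^ 2))).mono'
    (hF.mul (continuous_gaussWindow Δ τ)).aestronglyMeasurable
    (Filter.Eventually.of_forall fun t ↦ ?_)
  rw [norm_mul, Real.norm_of_nonneg (gaussWindow_pos Δ τ t).le]
  have h2 := one_add_sq_sq_mul_gaussWindow_le hΔ τ t
  have h3 : 0 < 1 + t ^ 2 := by positivity
  rw [← div_eq_mul_inv, le_div_iff₀ h3]
  calc ‖F t‖ * gaussWindow Δ τ t * (1 + t ^ 2)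
      ≤ (K * (1 + t ^ 2)) * gaussWindow Δ τ t * (1 + t ^ 2) := by
        have := (gaussWindow_pos Δ τ t).le; gcongr; exact h t
    _ = K * ((1 + t ^ 2) ^ 2 * gaussWindow Δ τ t) := by ring
    _ ≤ _ := by gcongr

/-- A regularised version of `ζ(s) - P(s)` localised by a Gaussian at height `τ`. -/
noncomputable def zetaKernel (P : ℂ → ℂ) (Δ τ : ℝ) (s : ℂ) : ℂ :=
  (riemannZeta₁ s - (s - 1) * P s) / (s + 1) * Complex.exp (((s - Complex.I * τ) / Δ) ^ 2)

lemma norm_cexp_sq_eq (Δ τ : ℝ) (s : ℂ) :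
    ‖Complex.exp (((s - Complex.I * τ) / Δ) ^ 2)‖ =
      Real.exp ((s.re / Δ) ^ 2) * gaussWindow Δ τ s.im := by
  rw [Complex.norm_exp, gaussWindow, ← Real.exp_add]
  congr 1
  simp [sq, Complex.div_ofReal_re, Complex.div_ofReal_im]
  ring

lemma norm_im_le_norm_add_one {s : ℂ} (hs : 0 ≤ s.re) : 1 ≤ ‖s + 1‖ ∧ ‖s‖ ≤ ‖s + 1‖ ∧
    ‖s - 1‖ ≤ ‖s + 1‖ := by
  refine ⟨?_, ?_, ?_⟩
  · have := Complex.re_le_norm (s + 1)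
    simp at this; linarith
  · rw [← sq_le_sq₀ (norm_nonneg _) (norm_nonneg _), Complex.sq_norm, Complex.sq_norm,
      Complex.normSq_apply, Complex.normSq_apply]
    simp; nlinarith
  · rw [← sq_le_sq₀ (norm_nonneg _) (norm_nonneg _), Complex.sq_norm, Complex.sq_norm,
      Complex.normSq_apply, Complex.normSq_apply]
    simp; nlinarith

lemma norm_sub_one_le {s : ℂ} (h1 : 1 / 4 ≤ s.re) (h2 : s.re ≤ 3) :
    ‖s - 1‖ ≤ 3 * (1 + s.im ^ 2) := by
  have := Complex.norm_le_abs_re_add_abs_im (s - 1)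
  have h3 : |(s - 1).re| ≤ 2 := abs_le.2 ⟨by simp; linarith, by simp; linarith⟩
  have h4 : |(s - 1).im| ≤ 1 + s.im ^ 2 := by
    simp only [Complex.sub_im, Complex.one_im, sub_zero]
    nlinarith [sq_abs s.im, sq_nonneg (|s.im| - 1), abs_nonneg s.im]
  nlinarith [sq_nonneg s.im]

lemma norm_zetaKernel_fst_le {P : ℂ → ℂ} {K : ℝ} (hP : ∀ s : ℂ, 0 ≤ s.re → ‖P s‖ ≤ K) {s : ℂ}
    (h1 : 1 / 4 ≤ s.re) (h2 : s.re ≤ 3) :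
    ‖(riemannZeta₁ s - (s - 1) * P s) / (s + 1)‖ ≤ (13 + K) * (1 + s.im ^ 2) := by
  have h0 : 0 ≤ s.re := by linarith
  obtain ⟨a, b, c⟩ := norm_im_le_norm_add_one h0
  have ha : 0 < ‖s + 1‖ := by linarith
  have hz := norm_riemannZeta₁_le (s := s) (by linarith)
  have hz2 : ‖s‖ * ‖s - 1‖ / s.re ≤ 4 * (‖s‖ * ‖s - 1‖) := by
    rw [div_le_iff₀ (by linarith)]
    have : 0 ≤ ‖s‖ * ‖s - 1‖ := by positivity
    nlinarith
  have hK : 0 ≤ K := (norm_nonneg _).trans (hP s h0)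
  rw [norm_div, div_le_iff₀ ha]
  have h3 := norm_sub_one_le h1 h2
  have h4 : 1 ≤ 1 + s.im ^ 2 := by nlinarith [sq_nonneg s.im]
  calc _ ≤ ‖riemannZeta₁ s‖ + ‖s - 1‖ * ‖P s‖ := by
        rw [← norm_mul]; exact norm_sub_le _ _
    _ ≤ (‖s‖ + 4 * (‖s‖ * ‖s - 1‖)) + ‖s - 1‖ * K := by
        have := hP s h0
        gcongr
        linarith
    _ ≤ (‖s + 1‖ * (1 + s.im ^ 2) + 4 * (‖s + 1‖ * (3 * (1 + s.im ^ 2)))) +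
        ‖s + 1‖ * K * (1 + s.im ^ 2) := by
        gcongr ?_ + 4 * (?_ * ?_) + ?_
        · nlinarith
        · have : ‖s - 1‖ * K ≤ ‖s + 1‖ * K := by gcongr
          have h5 : 0 ≤ ‖s + 1‖ * K := by positivity
          nlinarith
    _ = _ := by ring

section
variable {P : ℂ → ℂ} {K : ℝ} (hPd : Differentiable ℂ P) (hP : ∀ s : ℂ, 0 ≤ s.re → ‖P s‖ ≤ K)
  {Δ : ℝ} (hΔ : 1 ≤ Δ) (τ : ℝ)

lemma differentiableAt_zetaKernel (hPd : Differentiable ℂ P) {s : ℂ} (hs : 0 < s.re) :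
    DifferentiableAt ℂ (zetaKernel P Δ τ) s := by
  have h1 : s + 1 ≠ 0 := fun h ↦ by
    have := congrArg Complex.re h; simp at this; linarith
  have h2 := differentiable_riemannZeta₁ s
  have h3 := hPd s
  unfold zetaKernel
  fun_prop (disch := assumption)

lemma norm_zetaKernel_le (hP : ∀ s : ℂ, 0 ≤ s.re → ‖P s‖ ≤ K) (hΔ : 1 ≤ Δ) {s : ℂ}
    (h1 : 1 / 4 ≤ s.re) (h2 : s.re ≤ 3) : ‖zetaKernel P Δ τ s‖ ≤
      ((13 + K) * Real.exp 9 * (2 * (1 + 2 * τ ^ 2 + 2 * Δ ^ 2) ^ 2)) / (1 + s.im ^ 2) := by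
  have hK : 0 ≤ K := (norm_nonneg _).trans (hP s (by linarith))
  have hg := (gaussWindow_pos Δ τ s.im).le
  have h4 : 0 < 1 + s.im ^ 2 := by positivity
  rw [zetaKernel, norm_mul, norm_cexp_sq_eq, le_div_iff₀ h4]
  have h3 : (s.re / Δ) ^ 2 ≤ 9 := by
    have : s.re / Δ ≤ 3 := by rw [div_le_iff₀ (by linarith)]; linarith
    have : 0 ≤ s.re / Δ := by positivity
    nlinarith
  calc _ ≤ ((13 + K) * (1 + s.im ^ 2)) * (Real.exp 9 * gaussWindow Δ τ s.im) * (1 + s.im ^ 2) := by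
        gcongr
        exact norm_zetaKernel_fst_le hP h1 h2
    _ = (13 + K) * Real.exp 9 * ((1 + s.im ^ 2) ^ 2 * gaussWindow Δ τ s.im) := by ring
    _ ≤ _ := by
        have := one_add_sq_sq_mul_gaussWindow_le (Δ := Δ) (by linarith) τ s.im
        gcongr

/-- `∫ ‖zetaKernel(σ + it)‖ dt`. -/
noncomputable def kernelMass (P : ℂ → ℂ) (Δ τ σ : ℝ) : ℝ :=
  ∫ t : ℝ, ‖zetaKernel P Δ τ (σ + t * Complex.I)‖

lemma kernelMass_nonneg (P : ℂ → ℂ) (Δ τ σ : ℝ) : 0 ≤ kernelMass P Δ τ σ :=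
  integral_nonneg fun _ ↦ norm_nonneg _

lemma kernelMass_le (hPd : Differentiable ℂ P) (hP : ∀ s : ℂ, 0 ≤ s.re → ‖P s‖ ≤ K) (hΔ : 1 ≤ Δ)
    {σ : ℝ} (h1 : 1 / 2 ≤ σ) (h2 : σ ≤ 2) : kernelMass P Δ τ σ ≤
      kernelMass P Δ τ (1 / 2) ^ (1 - (σ - 1 / 2) / (2 - 1 / 2)) *
        kernelMass P Δ τ 2 ^ ((σ - 1 / 2) / (2 - 1 / 2)) :=
  integral_norm_le_of_three_lines (fun _ hs ↦ differentiableAt_zetaKernel τ hPd hs)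
    (fun _ h1 h2 ↦ norm_zetaKernel_le τ hP hΔ h1 h2) h1 h2

lemma integrable_zetaKernel (hPd : Differentiable ℂ P) (hP : ∀ s : ℂ, 0 ≤ s.re → ‖P s‖ ≤ K)
    (hΔ : 1 ≤ Δ) {σ : ℝ} (h1 : 1 / 4 ≤ σ) (h2 : σ ≤ 3) :
    Integrable fun t : ℝ ↦ ‖zetaKernel P Δ τ (σ + t * Complex.I)‖ := by
  have hc : Continuous fun t : ℝ ↦ zetaKernel P Δ τ (σ + t * Complex.I) := by
    refine continuous_iff_continuousAt.2 fun t ↦ ?_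
    have : ContinuousAt (zetaKernel P Δ τ) (σ + t * Complex.I) :=
      (differentiableAt_zetaKernel τ hPd (by simp; linarith)).continuousAt
    exact ContinuousAt.comp (f := fun t : ℝ ↦ (σ + t * Complex.I : ℂ)) this (by fun_prop)
  refine Integrable.norm ((integrable_bound_shift ((13 + K) * Real.exp 9 *
    (2 * (1 + 2 * τ ^ 2 + 2 * Δ ^ 2) ^ 2)) 0).mono' hc.aestronglyMeasurable
    (Filter.Eventually.of_forall fun t ↦ ?_))
  simpa using norm_zetaKernel_le (s := σ + t * Complex.I) τ hP hΔ (by simpa using h1)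
    (by simpa using h2)

end

lemma norm_zetaKernel_le_norm_sub (P : ℂ → ℂ) (Δ τ : ℝ) {s : ℂ} (hs : 0 ≤ s.re) (hs1 : s ≠ 1) :
    ‖zetaKernel P Δ τ s‖ ≤
      Real.exp ((s.re / Δ) ^ 2) * (‖riemannZeta s - P s‖ * gaussWindow Δ τ s.im) := by
  obtain ⟨a, -, c⟩ := norm_im_le_norm_add_one hs
  have hg := (gaussWindow_pos Δ τ s.im).le
  have h : ‖(riemannZeta₁ s - (s - 1) * P s) / (s + 1)‖ ≤ ‖riemannZeta s - P s‖ := by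
    rw [riemannZeta₁_eq_sub_mul hs1, ← mul_sub, norm_div, norm_mul, div_le_iff₀ (by linarith),
      mul_comm]
    gcongr
  rw [zetaKernel, norm_mul, norm_cexp_sq_eq]
  calc _ ≤ ‖riemannZeta s - P s‖ * (Real.exp ((s.re / Δ) ^ 2) * gaussWindow Δ τ s.im) := by gcongr
    _ = _ := by ring

lemma continuous_riemannZeta_vertical {σ : ℝ} (hσ : σ ≠ 1) :
    Continuous fun t : ℝ ↦ riemannZeta (σ + t * Complex.I) := by
  refine continuous_iff_continuousAt.2 fun t ↦ ?_
  have : ContinuousAt riemannZeta (σ + t * Complex.I) :=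
    (differentiableAt_riemannZeta fun h ↦ hσ (by simpa using congrArg Complex.re h)).continuousAt
  exact ContinuousAt.comp (f := fun t : ℝ ↦ (σ + t * Complex.I : ℂ)) this (by fun_prop)

lemma norm_riemannZeta_half_le (t : ℝ) :
    ‖riemannZeta ((1 / 2 : ℝ) + t * Complex.I)‖ ≤ 30 * (1 + t ^ 2) := by
  set s : ℂ := (1 / 2 : ℝ) + t * Complex.I with hs
  have hre : s.re = 1 / 2 := by simp [hs]
  have him : s.im = t := by simp [hs]
  have hs1 : s ≠ 1 := fun h ↦ by
    have := congrArg Complex.re h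
    rw [hre] at this; norm_num at this
  have h1 := norm_riemannZeta₁_le (s := s) (by rw [hre]; norm_num)
  rw [riemannZeta₁_eq_sub_mul hs1, norm_mul, hre] at h1
  have h2 : ‖s‖ = ‖s - 1‖ := by
    rw [← sq_eq_sq₀ (norm_nonneg _) (norm_nonneg _), Complex.sq_norm, Complex.sq_norm,
      Complex.normSq_apply, Complex.normSq_apply]
    simp [hre]; norm_num
  have h3 : 0 < ‖s - 1‖ := norm_pos_iff.2 (sub_ne_zero.2 hs1)
  have h4 := norm_sub_one_le (s := s) (by rw [hre]; norm_num) (by rw [hre]; norm_num)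
  rw [him] at h4
  rw [h2] at h1
  have h5 : ‖riemannZeta s‖ ≤ 1 + 2 * ‖s - 1‖ := by
    refine le_of_mul_le_mul_left (h1.trans (le_of_eq ?_)) h3
    ring
  nlinarith [sq_nonneg t]

lemma continuous_dirPoly_vertical (a : ℕ → ℝ) (N : ℕ) (σ : ℝ) :
    Continuous fun t : ℝ ↦ dirPoly a N (σ + t * Complex.I) := by
  have := (differentiable_dirPoly a N).continuous
  fun_prop

/-- The Gaussian-weighted mean of `|ζ(1/2 + it)|`. -/
noncomputable def zetaMean (Δ τ : ℝ) : ℝ :=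
  ∫ t : ℝ, ‖riemannZeta ((1 / 2 : ℝ) + t * Complex.I)‖ * gaussWindow Δ τ t

/-- The square of the Dirichlet polynomial approximating `ζ^(1/2)`. -/
noncomputable def sqPoly (N : ℕ) (s : ℂ) : ℂ := dirPoly (zetaPow (1 / 2)) N s ^ 2

/-- `∑_{n ≤ N} d_{1/2}(n)² n^{-2σ}`. -/
noncomputable def sqSum (N : ℕ) (σ : ℝ) : ℝ :=
  ∑ n ∈ Finset.Ioc 0 N, zetaPow (1 / 2) n ^ 2 * (n : ℝ) ^ (-(2 * σ))

lemma zetaPow_half_nonneg (n : ℕ) : 0 ≤ zetaPow (1 / 2) n := zetaPow_nonneg (by norm_num) n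

lemma zetaPow_half_le_one (n : ℕ) : zetaPow (1 / 2) n ≤ 1 :=
  zetaPow_le_one (by norm_num) (by norm_num) n

lemma norm_halfPoly_le (N : ℕ) {s : ℂ} (hs : 0 ≤ s.re) :
    ‖dirPoly (zetaPow (1 / 2)) N s‖ ≤ N :=
  norm_dirPoly_le zetaPow_half_nonneg zetaPow_half_le_one N hs

lemma differentiable_sqPoly (N : ℕ) : Differentiable ℂ (sqPoly N) :=
  (differentiable_dirPoly _ N).pow 2

lemma norm_sqPoly_le (N : ℕ) (s : ℂ) (hs : 0 ≤ s.re) : ‖sqPoly N s‖ ≤ (N : ℝ) ^ 2 := by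
  rw [sqPoly, norm_pow]
  have := norm_halfPoly_le N hs
  gcongr

lemma integrable_norm_sqPoly_mul_gaussWindow (N : ℕ) {σ : ℝ} (hσ : 0 ≤ σ) {Δ : ℝ} (hΔ : 0 < Δ)
    (τ : ℝ) : Integrable fun t : ℝ ↦
      ‖dirPoly (zetaPow (1 / 2)) N (σ + t * Complex.I)‖ ^ 2 * gaussWindow Δ τ t := by
  refine integrable_mul_gaussWindow_of_le (K := (N : ℝ) ^ 2)
    ((continuous_dirPoly_vertical _ N σ).norm.pow 2) (fun t ↦ ?_) hΔ τ
  have := norm_sqPoly_le N (σ + t * Complex.I) (by simpa using hσ)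
  rw [sqPoly, norm_pow] at this
  simp only [Pi.pow_apply]
  rw [norm_pow, norm_norm]
  nlinarith [sq_nonneg t, mul_nonneg (sq_nonneg (N : ℝ)) (sq_nonneg t)]

lemma integral_norm_sqPoly_le (N : ℕ) {Δ : ℝ} (hΔ0 : 0 < Δ) (hΔ : (N : ℝ) ^ 2 ≤ Δ) (τ : ℝ)
    {σ : ℝ} (hσ : 0 ≤ σ) :
    |(∫ t : ℝ, ‖dirPoly (zetaPow (1 / 2)) N (σ + t * Complex.I)‖ ^ 2 * gaussWindow Δ τ t) -
      √Real.pi * Δ * sqSum N σ| ≤ 4 * (√Real.pi * Δ) := by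
  have := abs_integral_norm_sq_dirPoly_sub_le zetaPow_half_nonneg zetaPow_half_le_one hσ hΔ0 hΔ τ
  rwa [← Finset.mul_sum] at this

lemma integrable_zeta_half_mul_gaussWindow {Δ : ℝ} (hΔ : 0 < Δ) (τ : ℝ) :
    Integrable fun t : ℝ ↦
      ‖riemannZeta ((1 / 2 : ℝ) + t * Complex.I)‖ * gaussWindow Δ τ t :=
  integrable_mul_gaussWindow_of_le (continuous_riemannZeta_vertical (by norm_num)).norm
    (fun t ↦ by rw [norm_norm]; exact norm_riemannZeta_half_le t) hΔ τ

lemma kernelMass_le_integral {P : ℂ → ℂ} {K : ℝ} (hPd : Differentiable ℂ P)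
    (hP : ∀ s : ℂ, 0 ≤ s.re → ‖P s‖ ≤ K) {Δ : ℝ} (hΔ : 1 ≤ Δ) (τ : ℝ) {σ : ℝ} (h1 : 1 / 2 ≤ σ)
    (h2 : σ ≤ 2) (h3 : σ ≠ 1) {B : ℝ → ℝ}
    (hB : ∀ t : ℝ, ‖riemannZeta (σ + t * Complex.I) - P (σ + t * Complex.I)‖ ≤ B t)
    (hBi : Integrable fun t ↦ B t * gaussWindow Δ τ t) :
    kernelMass P Δ τ σ ≤ Real.exp 4 * ∫ t : ℝ, B t * gaussWindow Δ τ t := by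
  rw [kernelMass, ← integral_const_mul]
  refine integral_mono (integrable_zetaKernel τ hPd hP hΔ (by linarith) (by linarith))
    (hBi.const_mul _) fun t ↦ ?_
  have hs : ((σ : ℂ) + t * Complex.I) ≠ 1 := fun h ↦ h3 (by simpa using congrArg Complex.re h)
  refine (norm_zetaKernel_le_norm_sub P Δ τ (by simp; linarith) hs).trans ?_
  have hre : ((σ : ℂ) + t * Complex.I).re = σ := by simp
  have him : ((σ : ℂ) + t * Complex.I).im = t := by simp
  rw [hre, him]
  have h4 : (σ / Δ) ^ 2 ≤ 4 := by
    have : σ / Δ ≤ 2 := by rw [div_le_iff₀ (by linarith)]; linarith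
    have : 0 ≤ σ / Δ := by positivity
    nlinarith
  have hg := (gaussWindow_pos Δ τ t).le
  gcongr
  exact hB t

lemma kernelMass_bounds {N : ℕ} {Δ : ℝ} (hΔ1 : 1 ≤ Δ) (hΔ : (N : ℝ) ^ 2 ≤ Δ) (τ : ℝ) :
    kernelMass (fun _ ↦ 0) Δ τ (1 / 2) ≤ Real.exp 4 * zetaMean Δ τ ∧
    kernelMass (fun _ ↦ 0) Δ τ 2 ≤ Real.exp 4 * (2 * (√Real.pi * Δ)) ∧
    kernelMass (sqPoly N) Δ τ (1 / 2) ≤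
      Real.exp 4 * (zetaMean Δ τ + √Real.pi * Δ * (sqSum N (1 / 2) + 4)) ∧
    kernelMass (sqPoly N) Δ τ 2 ≤ Real.exp 4 * (2 / (N + 1) * (√Real.pi * Δ)) := by
  have hΔ0 : 0 < Δ := by linarith
  have z1 : Differentiable ℂ (fun _ : ℂ ↦ (0 : ℂ)) := by fun_prop
  have z2 : ∀ s : ℂ, 0 ≤ s.re → ‖(fun _ : ℂ ↦ (0 : ℂ)) s‖ ≤ 0 := fun _ _ ↦ by simp
  have w1 := differentiable_sqPoly N
  have w2 := norm_sqPoly_le N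
  have i1 := integrable_zeta_half_mul_gaussWindow hΔ0 τ
  have i2 := integrable_norm_sqPoly_mul_gaussWindow N (σ := 1 / 2) (by norm_num) hΔ0 τ
  refine ⟨kernelMass_le_integral z1 z2 hΔ1 τ le_rfl (by norm_num) (by norm_num) (fun t ↦ ?_) i1,
    ?_, ?_, ?_⟩
  · simp
  · have := kernelMass_le_integral z1 z2 hΔ1 τ (σ := 2) (by norm_num) le_rfl (by norm_num)
      (B := fun _ ↦ 2) (fun t ↦ by simpa using norm_riemannZeta_le_two (by simp))
      ((integrable_gaussWindow hΔ0 τ).const_mul 2)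
    rwa [integral_const_mul, integral_gaussWindow hΔ0] at this
  · have := kernelMass_le_integral w1 w2 hΔ1 τ (σ := 1 / 2) le_rfl (by norm_num) (by norm_num)
      (B := fun t ↦ ‖riemannZeta ((1 / 2 : ℝ) + t * Complex.I)‖ +
        ‖dirPoly (zetaPow (1 / 2)) N ((1 / 2 : ℝ) + t * Complex.I)‖ ^ 2)
      (fun t ↦ by rw [sqPoly, ← norm_pow]; exact norm_sub_le _ _)
      ((i1.add i2).congr (Filter.Eventually.of_forall fun t ↦ by simp [add_mul]))
    simp_rw [add_mul] at this
    rw [integral_add i1 i2] at this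
    have h3 := (abs_le.1 (integral_norm_sqPoly_le N hΔ0 hΔ τ (σ := 1 / 2) (by norm_num))).2
    refine this.trans ?_
    rw [zetaMean]
    gcongr
    linarith
  · have := kernelMass_le_integral w1 w2 hΔ1 τ (σ := 2) (by norm_num) le_rfl (by norm_num)
      (B := fun _ ↦ 2 / (N + 1))
      (fun t ↦ norm_riemannZeta_sub_dirPoly_sq_le N (by simp))
      ((integrable_gaussWindow hΔ0 τ).const_mul _)
    rwa [integral_const_mul, integral_gaussWindow hΔ0] at this

lemma norm_sq_halfPoly_mul_gaussWindow_le (N : ℕ) {Δ : ℝ} (τ : ℝ) {σ : ℝ} (h1 : 1 / 2 ≤ σ)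
    (h2 : σ ≤ 2) (t : ℝ) :
    ‖dirPoly (zetaPow (1 / 2)) N (σ + t * Complex.I)‖ ^ 2 * gaussWindow Δ τ t ≤
      5 / 2 * (‖zetaKernel (fun _ ↦ 0) Δ τ (σ + t * Complex.I)‖ +
        ‖zetaKernel (sqPoly N) Δ τ (σ + t * Complex.I)‖) +
      (Set.Icc (-2) 2).indicator (fun _ ↦ (N : ℝ) ^ 2) t := by
  have hg := (gaussWindow_pos Δ τ t).le
  by_cases ht : t ∈ Set.Icc (-2 : ℝ) 2
  · rw [Set.indicator_of_mem ht]
    have := norm_sqPoly_le N (σ + t * Complex.I) (by simp; linarith)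
    rw [sqPoly, norm_pow] at this
    have h3 : ‖dirPoly (zetaPow (1 / 2)) N (σ + t * Complex.I)‖ ^ 2 * gaussWindow Δ τ t ≤
      (N : ℝ) ^ 2 * 1 := by
      gcongr
      exact gaussWindow_le_one _ _ _
    linarith [norm_nonneg (zetaKernel (fun _ ↦ 0) Δ τ (σ + t * Complex.I)),
      norm_nonneg (zetaKernel (sqPoly N) Δ τ (σ + t * Complex.I))]
  · rw [Set.indicator_of_notMem ht, add_zero]
    set s : ℂ := σ + t * Complex.I with hs
    have hre : s.re = σ := by simp [hs]
    have him : s.im = t := by simp [hs]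
    have ht2 : 4 < t ^ 2 := by
      by_contra! h
      exact ht ⟨by nlinarith, by nlinarith⟩
    obtain ⟨a, -, -⟩ := norm_im_le_norm_add_one (s := s) (by rw [hre]; linarith)
    have h3 : ‖s + 1‖ ≤ 5 / 2 * ‖s - 1‖ := by
      rw [← sq_le_sq₀ (norm_nonneg _) (by positivity), mul_pow, Complex.sq_norm, Complex.sq_norm,
        Complex.normSq_apply, Complex.normSq_apply]
      simp [hre, him]
      nlinarith [sq_nonneg (σ - 1)]
    have h4 : (s - 1) * sqPoly N s / (s + 1) * Complex.exp (((s - Complex.I * τ) / Δ) ^ 2) =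
        zetaKernel (fun _ ↦ 0) Δ τ s - zetaKernel (sqPoly N) Δ τ s := by
      rw [zetaKernel, zetaKernel]; ring
    have h5 := norm_sub_le (zetaKernel (fun _ ↦ 0) Δ τ s) (zetaKernel (sqPoly N) Δ τ s)
    rw [← h4, norm_mul, norm_cexp_sq_eq, norm_div, norm_mul, him] at h5
    have h6 : ‖sqPoly N s‖ ≤ 5 / 2 * (‖s - 1‖ * ‖sqPoly N s‖ / ‖s + 1‖) := by
      rw [mul_div_assoc', le_div_iff₀ (by linarith)]
      nlinarith [norm_nonneg (sqPoly N s)]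
    have h7 : 1 ≤ Real.exp ((s.re / Δ) ^ 2) := Real.one_le_exp (sq_nonneg _)
    rw [← norm_pow]
    calc ‖sqPoly N s‖ * gaussWindow Δ τ t
        ≤ 5 / 2 * (‖s - 1‖ * ‖sqPoly N s‖ / ‖s + 1‖) * (1 * gaussWindow Δ τ t) := by
          rw [one_mul]; gcongr
      _ ≤ 5 / 2 * (‖s - 1‖ * ‖sqPoly N s‖ / ‖s + 1‖) *
          (Real.exp ((s.re / Δ) ^ 2) * gaussWindow Δ τ t) := by gcongr
      _ ≤ _ := by linarith

lemma sqSum_le_kernelMass {N : ℕ} {Δ : ℝ} (hΔ1 : 1 ≤ Δ) (hΔ : (N : ℝ) ^ 2 ≤ Δ) (τ : ℝ) {σ : ℝ}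
    (h1 : 1 / 2 ≤ σ) (h2 : σ ≤ 2) :
    √Real.pi * Δ * (sqSum N σ - 4) ≤
      5 / 2 * (kernelMass (fun _ ↦ 0) Δ τ σ + kernelMass (sqPoly N) Δ τ σ) + 4 * Δ := by
  have hΔ0 : 0 < Δ := by linarith
  have h3 := (abs_le.1 (integral_norm_sqPoly_le N hΔ0 hΔ τ (σ := σ) (by linarith))).1
  have j1 := integrable_zetaKernel (P := fun _ ↦ 0) (K := 0) τ (by fun_prop) (by simp) hΔ1
    (σ := σ) (by linarith) (by linarith)
  have j2 := integrable_zetaKernel τ (differentiable_sqPoly N) (norm_sqPoly_le N) hΔ1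
    (σ := σ) (by linarith) (by linarith)
  have j3 : Integrable ((Set.Icc (-2 : ℝ) 2).indicator (fun _ ↦ (N : ℝ) ^ 2)) :=
    (integrable_indicator_iff measurableSet_Icc).2 (integrableOn_const (by simp))
  have j4 : Integrable fun t : ℝ ↦ 5 / 2 * (‖zetaKernel (fun _ ↦ 0) Δ τ (σ + t * Complex.I)‖ +
      ‖zetaKernel (sqPoly N) Δ τ (σ + t * Complex.I)‖) := (j1.add j2).const_mul (5 / 2)
  have h4 := integral_mono (integrable_norm_sqPoly_mul_gaussWindow N (by linarith) hΔ0 τ)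
    (j4.add j3)
    (norm_sq_halfPoly_mul_gaussWindow_le N (Δ := Δ) τ h1 h2)
  have h5 : ∫ t, (Set.Icc (-2 : ℝ) 2).indicator (fun _ ↦ (N : ℝ) ^ 2) t = 4 * (N : ℝ) ^ 2 := by
    rw [integral_indicator measurableSet_Icc]
    simp; norm_num
  simp only [Pi.add_apply] at h4
  rw [integral_add j4 j3, integral_const_mul, h5, integral_add j1 j2] at h4
  rw [kernelMass, kernelMass]
  linarith

lemma sqSum_half_le {N : ℕ} (hN : 1 ≤ Real.log N) :
    sqSum N (1 / 2) ≤ 2 * Real.log N ^ (1 / 4 : ℝ) := by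
  have h0 : 0 ≤ Real.log N := by linarith
  have h1 : sqSum N (1 / 2) = ∑ n ∈ Finset.Ioc 0 N, zetaPow (1 / 2) n ^ 2 / n := by
    refine Finset.sum_congr rfl fun n _ ↦ ?_
    rw [show (-(2 * (1 / 2)) : ℝ) = -1 by norm_num, Real.rpow_neg_one, ← div_eq_mul_inv]
  have h2 : sqSum N (1 / 2) ^ 4 ≤ (2 * Real.log N ^ (1 / 4 : ℝ)) ^ 4 := by
    rw [h1, mul_pow, ← Real.rpow_natCast (Real.log N ^ (1 / 4 : ℝ)), ← Real.rpow_mul h0]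
    have := sum_half_sq_div_pow_le N
    norm_num at *
    linarith
  exact le_of_pow_le_pow_left₀ (by norm_num) (by positivity) h2

lemma le_sqSum {N : ℕ} (hN : 24 ≤ Real.log N) :
    Real.exp (-2) * (Real.log N ^ (1 / 4 : ℝ) / 3) ≤ sqSum N (1 / 2 + 24 / Real.log N) := by
  set L := Real.log N with hL
  have h0 : 0 ≤ L := by linarith
  have hN0 : 0 < (N : ℝ) := by
    by_contra! h
    have : (N : ℝ) = 0 := le_antisymm h (Nat.cast_nonneg _)
    rw [hL, this, Real.log_zero] at hN; norm_num at hN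
  set M := ⌊Real.exp (L / 24)⌋₊ with hM
  have hM1 : L / 24 ≤ Real.log (M + 1) := by
    rw [Real.le_log_iff_exp_le (by positivity)]
    exact (Nat.lt_floor_add_one _).le
  have hMN : M ≤ N := by
    have : (M : ℝ) ≤ N := by
      calc (M : ℝ) ≤ Real.exp (L / 24) := Nat.floor_le (Real.exp_pos _).le
        _ ≤ Real.exp L := Real.exp_le_exp.2 (by linarith)
        _ = N := Real.exp_log hN0
    exact_mod_cast this
  set A := ∑ n ∈ Finset.Ioc 0 M, zetaPow (1 / 2) n ^ 2 / n with hA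
  have hA0 : 0 ≤ A := Finset.sum_nonneg fun n _ ↦ by positivity
  have h2 : (L ^ (1 / 4 : ℝ) / 3) ^ 4 ≤ A ^ 4 := by
    rw [div_pow, ← Real.rpow_natCast (L ^ (1 / 4 : ℝ)), ← Real.rpow_mul h0]
    have := log_le_sum_half_sq_div_pow M
    norm_num at *
    linarith
  have h3 : L ^ (1 / 4 : ℝ) / 3 ≤ A := le_of_pow_le_pow_left₀ (by norm_num) hA0 h2
  calc _ ≤ Real.exp (-2) * A := by gcongr
    _ = ∑ n ∈ Finset.Ioc 0 M, Real.exp (-2) * (zetaPow (1 / 2) n ^ 2 / n) := Finset.mul_sum _ _ _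
    _ ≤ ∑ n ∈ Finset.Ioc 0 M, zetaPow (1 / 2) n ^ 2 * (n : ℝ) ^ (-(2 * (1 / 2 + 24 / L))) := by
      refine Finset.sum_le_sum fun n hn ↦ ?_
      obtain ⟨hn1, hn2⟩ := Finset.mem_Ioc.1 hn
      have hn0 : 0 < (n : ℝ) := by exact_mod_cast hn1
      have e1 : (n : ℝ) ^ (-(2 * (1 / 2 + 24 / L))) = (n : ℝ)⁻¹ * (n : ℝ) ^ (-(48 / L)) := by
        rw [← Real.rpow_neg_one, ← Real.rpow_add hn0]; congr 1; ring
      have e2 : Real.exp (-2) ≤ (n : ℝ) ^ (-(48 / L)) := by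
        rw [Real.rpow_def_of_pos hn0]
        apply Real.exp_le_exp.2
        have : Real.log n ≤ L / 24 := by
          rw [Real.log_le_iff_le_exp hn0]
          refine le_trans ?_ (Nat.floor_le (Real.exp_pos (L / 24)).le)
          exact_mod_cast hn2
        have h5 : 0 < L := by linarith
        have : Real.log n * (48 / L) ≤ L / 24 * (48 / L) := by gcongr
        have h6 : L / 24 * (48 / L) = 2 := by field_simp; norm_num
        linarith
      rw [e1, div_eq_mul_inv]
      calc _ = zetaPow (1 / 2) n ^ 2 * ((n : ℝ)⁻¹ * Real.exp (-2)) := by ring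
        _ ≤ _ := by gcongr
    _ ≤ _ := by
      refine Finset.sum_le_sum_of_subset_of_nonneg (Finset.Ioc_subset_Ioc_right hMN) ?_
      intro n _ _
      positivity

lemma rpow_mul_rpow_le_add {a b θ : ℝ} (ha : 0 ≤ a) (hb : 0 ≤ b) (h0 : 0 ≤ θ) (h1 : θ ≤ 1) :
    a ^ (1 - θ) * b ^ θ ≤ a + b := by
  have := Real.geom_mean_le_arith_mean2_weighted (sub_nonneg.2 h1) h0 ha hb (by ring)
  nlinarith

lemma mul_sqSum_sub_le {N : ℕ} {Δ : ℝ} (hN1 : 1 ≤ (N : ℝ)) (hΔ : (N : ℝ) ^ 2 ≤ Δ) (τ : ℝ)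
    (hL : 24 ≤ Real.log N) :
    √Real.pi * Δ * (sqSum N (1 / 2 + 24 / Real.log N) - 4) ≤
      5 / 2 * (Real.exp 4 * zetaMean Δ τ + Real.exp 4 * (2 * (√Real.pi * Δ)) +
        Real.exp (-12) * (zetaMean Δ τ + √Real.pi * Δ * (sqSum N (1 / 2) + 4))) + 4 * Δ := by
  have hΔ1 : 1 ≤ Δ := by nlinarith
  have hL0 : 0 < Real.log N := by linarith
  have hL24 : 24 / Real.log N ≤ 1 := by rw [div_le_iff₀ hL0]; linarith
  have hL24' : 0 ≤ 24 / Real.log N := by positivity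
  obtain ⟨b1, b2, b3, b4⟩ := kernelMass_bounds hΔ1 hΔ τ
  have hX0 : 0 ≤ zetaMean Δ τ := integral_nonneg fun t ↦
    mul_nonneg (norm_nonneg _) (gaussWindow_pos Δ τ t).le
  have hA0 : 0 ≤ sqSum N (1 / 2) := Finset.sum_nonneg fun n _ ↦ by positivity
  have hw0 : 0 < √Real.pi * Δ := by positivity
  have hmain := sqSum_le_kernelMass hΔ1 hΔ τ (σ := 1 / 2 + 24 / Real.log N)
    (by linarith) (by linarith)
  have k1 := kernelMass_le (P := fun _ ↦ 0) (K := 0) τ (by fun_prop) (by simp) hΔ1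
    (σ := 1 / 2 + 24 / Real.log N) (by linarith) (by linarith)
  have k2 := kernelMass_le τ (differentiable_sqPoly N) (norm_sqPoly_le N) hΔ1
    (σ := 1 / 2 + 24 / Real.log N) (by linarith) (by linarith)
  obtain ⟨θ, hθ⟩ : ∃ θ, θ = (1 / 2 + 24 / Real.log N - 1 / 2) / (2 - 1 / 2) := ⟨_, rfl⟩
  have hθL : θ * Real.log N = 16 := by rw [hθ]; field_simp; norm_num
  have hθ0 : 0 ≤ θ := by rw [hθ]; apply div_nonneg <;> linarith
  have hθ1 : θ ≤ 1 := by rw [hθ, div_le_one (by norm_num)]; linarith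
  rw [← hθ] at k1 k2
  have n1 := fun (P : ℂ → ℂ) s ↦ kernelMass_nonneg P Δ τ s
  have m1 := n1 (sqPoly N) (1 / 2)
  have m2 := n1 (sqPoly N) 2
  have k3 := k1.trans ((rpow_mul_rpow_le_add (n1 _ _) (n1 _ _) hθ0 hθ1).trans (add_le_add b1 b2))
  generalize √Real.pi * Δ = w at *
  generalize zetaMean Δ τ = X at *
  generalize sqSum N (1 / 2) = A at *
  generalize kernelMass (sqPoly N) Δ τ (1 / 2) = u₁ at *
  generalize kernelMass (sqPoly N) Δ τ 2 = u₂ at *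
  generalize kernelMass (sqPoly N) Δ τ (1 / 2 + 24 / Real.log N) = u at *
  have h0 : 0 < X + w * (A + 4) := by positivity
  obtain ⟨Y, hY⟩ : ∃ Y, Y = Real.exp 4 * (X + w * (A + 4)) := ⟨_, rfl⟩
  have hY0 : 0 < Y := by rw [hY]; positivity
  have b4b : u₂ ≤ Y / N := by
    refine b4.trans ?_
    rw [hY, mul_div_assoc]
    have : 2 / ((N : ℝ) + 1) * w ≤ (X + w * (A + 4)) / N := by
      rw [div_mul_eq_mul_div, div_le_div_iff₀ (by positivity) (by linarith)]
      have : 2 * w ≤ X + w * (A + 4) := by nlinarith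
      nlinarith
    gcongr
  have hNθ : (N : ℝ) ^ (-θ) = Real.exp (-16) := by
    rw [Real.rpow_def_of_pos (by linarith), ← hθL]; congr 1; ring
  have hE1 : Real.exp 4 * Real.exp (-16) = Real.exp (-12) := by rw [← Real.exp_add]; norm_num
  have k4 : u ≤ Real.exp (-12) * (X + w * (A + 4)) := by
    refine k2.trans ?_
    calc u₁ ^ (1 - θ) * u₂ ^ θ ≤ Y ^ (1 - θ) * (Y / N) ^ θ := by
          have : 0 ≤ 1 - θ := by linarith
          rw [← hY] at b3
          gcongr
      _ = Y ^ (1 - θ) * Y ^ θ * (N : ℝ) ^ (-θ) := by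
          rw [Real.div_rpow hY0.le (by linarith), Real.rpow_neg (by linarith)]; ring
      _ = Y * Real.exp (-16) := by
          rw [← Real.rpow_add hY0, hNθ]; simp
      _ = _ := by rw [← hE1, hY]; ring
  linarith

theorem exists_le_zetaMean : ∃ c > (0 : ℝ), ∃ N₀ : ℕ, ∀ N ≥ N₀, ∀ Δ : ℝ, (N : ℝ) ^ 2 ≤ Δ →
    ∀ τ : ℝ, c * Δ * Real.log N ^ (1 / 4 : ℝ) ≤ zetaMean Δ τ := by
  have hlim2 : Filter.Tendsto (fun N : ℕ ↦ Real.log N) Filter.atTop Filter.atTop :=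
    Real.tendsto_log_atTop.comp tendsto_natCast_atTop_atTop
  have hlim : Filter.Tendsto (fun N : ℕ ↦ Real.log N ^ (1 / 4 : ℝ)) Filter.atTop Filter.atTop :=
    (tendsto_rpow_atTop (by norm_num)).comp hlim2
  obtain ⟨E, hE⟩ : ∃ E, E = Real.exp 4 := ⟨_, rfl⟩
  have hE0 : 0 < E := by rw [hE]; positivity
  obtain ⟨N₁, hN₁⟩ := Filter.eventually_atTop.1
    ((hlim.eventually_ge_atTop (1000 * E ^ 2)).and (hlim2.eventually_ge_atTop 24))
  refine ⟨1 / (100 * E ^ 2), by positivity, max N₁ 1, fun N hN Δ hΔ τ ↦ ?_⟩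
  obtain ⟨hl, hL⟩ := hN₁ N (le_trans (le_max_left _ _) hN)
  have hN1 : 1 ≤ (N : ℝ) := by exact_mod_cast le_trans (le_max_right _ _) hN
  have hΔ1 : 1 ≤ Δ := by nlinarith
  have hX0 : 0 ≤ zetaMean Δ τ := integral_nonneg fun t ↦
    mul_nonneg (norm_nonneg _) (gaussWindow_pos Δ τ t).le
  have hA := sqSum_half_le (N := N) (by linarith)
  have hAs := le_sqSum hL
  have hmain := mul_sqSum_sub_le hN1 hΔ τ hL
  have hsp : 1 ≤ √Real.pi := by
    rw [Real.one_le_sqrt]; linarith [Real.pi_gt_three]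
  have hwΔ : Δ ≤ √Real.pi * Δ := by nlinarith
  have hE12 : 1000 * Real.exp (-12) ≤ Real.exp (-2) := by
    have h1 : Real.exp (-2) = Real.exp (-12) * Real.exp 1 ^ 10 := by
      rw [← Real.exp_nat_mul, ← Real.exp_add]; norm_num
    have h2 : (2 : ℝ) ^ 10 ≤ Real.exp 1 ^ 10 := by
      have := Real.exp_one_gt_d9
      gcongr; linarith
    rw [h1]
    nlinarith [Real.exp_pos (-12)]
  have hE2 : 1 ≤ E * Real.exp (-2) := by
    rw [hE, ← Real.exp_add]; exact Real.one_le_exp (by norm_num)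
  have hEE : Real.exp (-12) ≤ E := by rw [hE]; exact Real.exp_le_exp.2 (by norm_num)
  have hE3 : 1 ≤ E := by rw [hE]; exact Real.one_le_exp (by norm_num)
  have hq0 := Real.exp_pos (-12)
  have hp0 := Real.exp_pos (-2)
  rw [← hE] at hmain
  generalize √Real.pi * Δ = w at *
  generalize zetaMean Δ τ = X at *
  generalize sqSum N (1 / 2) = A at *
  generalize sqSum N (1 / 2 + 24 / Real.log N) = S at *
  generalize Real.log N ^ (1 / 4 : ℝ) = l at *
  generalize Real.exp (-2) = p at *
  generalize Real.exp (-12) = q at *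
  clear hlim hlim2 hN₁ hN
  have hw0 : 0 < w := by linarith
  have hl0 : 0 < l := by nlinarith
  have hpl : 1000 * E ≤ p * l := by
    calc 1000 * E ≤ 1000 * E * (E * p) := by nlinarith
      _ = p * (1000 * E ^ 2) := by ring
      _ ≤ p * l := by gcongr
  have g1 : w * (p * l / 3) ≤ w * S := by gcongr; linarith
  have g2 : q * (w * (A + 4)) ≤ q * (w * (2 * l + 4)) := by gcongr
  have g3 : (1000 * q) * (w * l) ≤ p * (w * l) := by gcongr
  have g4 : q * X ≤ E * X := by gcongr
  have g5 : q * w ≤ E * w := by gcongr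
  have g6 : w * (1000 * E) ≤ w * (p * l) := by gcongr
  have g7 : w ≤ E * w := by nlinarith
  have g8 : w * (p * l) ≤ 100 * (E * X) := by nlinarith
  have g9 : w * l ≤ 100 * E ^ 2 * X := by
    calc w * l ≤ (w * l) * (E * p) := by
          have : 0 < w * l := by positivity
          nlinarith
      _ = E * (w * (p * l)) := by ring
      _ ≤ E * (100 * (E * X)) := by gcongr
      _ = _ := by ring
  rw [mul_assoc, one_div_mul_eq_div, div_le_iff₀ (by positivity)]
  nlinarith

/-- The theta function along a rotated ray. -/
noncomputable def rotTheta (w : ℂ) (x : ℝ) : ℂ := jacobiTheta (Complex.I * w * x)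

lemma im_rot (w : ℂ) (x : ℝ) : (Complex.I * w * x).im = w.re * x := by simp

lemma hasSum_rotTheta {w : ℂ} (hw : 0 < w.re) {x : ℝ} (hx : 0 < x) :
    HasSum (fun n : ℕ ↦ Complex.exp (-((Real.pi * (n + 1) ^ 2 * x : ℝ) * w)))
      ((rotTheta w x - 1) / 2) := by
  have h := hasSum_nat_jacobiTheta (τ := Complex.I * w * x) (by rw [im_rot]; positivity)
  refine h.congr_fun fun n ↦ ?_
  congr 1
  push_cast
  linear_combination (-(Real.pi : ℂ) * (n + 1) ^ 2 * w * x) * Complex.I_sq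

lemma sum_exp_neg_sq_le {y : ℝ} (hy : 0 < y) (K : ℕ) :
    ∑ n ∈ Finset.range K, Real.exp (-(Real.pi * ((n : ℝ) + 1) ^ 2 * y)) ≤ 1 / (2 * √y) := by
  have hb : 0 < Real.pi * y := by positivity
  have h1 : AntitoneOn (fun t : ℝ ↦ Real.exp (-(Real.pi * y) * t ^ 2)) (Set.Icc 0 (0 + K)) := by
    intro s hs t ht hst
    apply Real.exp_le_exp.2
    have := hs.1
    have : s ^ 2 ≤ t ^ 2 := by gcongr
    nlinarith
  have h2 := h1.sum_le_integral
  have h3 : ∫ t in (0 : ℝ)..(0 + K), Real.exp (-(Real.pi * y) * t ^ 2) ≤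
      ∫ t in Set.Ioi (0 : ℝ), Real.exp (-(Real.pi * y) * t ^ 2) := by
    rw [intervalIntegral.integral_of_le (by simp)]
    exact setIntegral_mono_set (integrable_exp_neg_mul_sq hb).integrableOn
      (Filter.Eventually.of_forall fun _ ↦ (Real.exp_pos _).le)
      (Filter.Eventually.of_forall fun _ h ↦ h.1)
  rw [integral_gaussian_Ioi] at h3
  have h4 : √(Real.pi / (Real.pi * y)) / 2 = 1 / (2 * √y) := by
    rw [show Real.pi / (Real.pi * y) = 1 / y by field_simp, Real.sqrt_div zero_le_one,
      Real.sqrt_one]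
    field_simp
  rw [← h4]
  refine le_trans (le_of_eq (Finset.sum_congr rfl fun n _ ↦ ?_)) (h2.trans h3)
  congr 1
  push_cast
  ring

lemma norm_exp_rot (w : ℂ) (x : ℝ) (n : ℕ) :
    ‖Complex.exp (-((Real.pi * (n + 1) ^ 2 * x : ℝ) * w))‖ =
      Real.exp (-(Real.pi * ((n : ℝ) + 1) ^ 2 * (w.re * x))) := by
  rw [Complex.norm_exp]
  congr 1
  rw [Complex.neg_re, Complex.re_ofReal_mul]
  ring

lemma norm_sum_rot_le {w : ℂ} (hw : 0 < w.re) {x : ℝ} (hx : 0 < x) (K : ℕ) :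
    ‖∑ n ∈ Finset.range K, Complex.exp (-((Real.pi * (n + 1) ^ 2 * x : ℝ) * w))‖ ≤
      1 / (2 * √(w.re * x)) := by
  refine (norm_sum_le _ _).trans (le_trans (le_of_eq ?_) (sum_exp_neg_sq_le (mul_pos hw hx) K))
  exact Finset.sum_congr rfl fun n _ ↦ norm_exp_rot w x n

lemma norm_rotTheta_sub_one_le {w : ℂ} (hw : 0 < w.re) {x : ℝ} (hx : 0 < x) :
    ‖rotTheta w x - 1‖ ≤ 1 / √(w.re * x) := by
  have h := le_of_tendsto' (hasSum_rotTheta hw hx).tendsto_sum_nat.norm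
    (norm_sum_rot_le hw hx)
  rw [norm_div, Complex.norm_ofNat, div_le_iff₀ (by norm_num)] at h
  refine h.trans (le_of_eq ?_)
  field_simp

lemma rotTheta_inv {w : ℂ} (hw : 0 < w.re) {x : ℝ} (hx : 0 < x) :
    rotTheta w (1 / x) = (w⁻¹ ^ (1 / 2 : ℂ) * ((x ^ (1 / 2 : ℝ) : ℝ) : ℂ)) * rotTheta w⁻¹ x := by
  have hw0 : w ≠ 0 := fun h ↦ by simp [h] at hw
  have hx0 : (x : ℂ) ≠ 0 := by exact_mod_cast hx.ne'
  have h := jacobiTheta₂_functional_equation 0 (Complex.I * w⁻¹ * x)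
  rw [zero_div, ← jacobiTheta_eq_jacobiTheta₂, ← jacobiTheta_eq_jacobiTheta₂] at h
  have e1 : -Complex.I * (Complex.I * w⁻¹ * x) = (x : ℂ) * w⁻¹ := by
    linear_combination (-w⁻¹ * x) * Complex.I_sq
  have e2 : -1 / (Complex.I * w⁻¹ * x) = Complex.I * w * ((1 / x : ℝ) : ℂ) := by
    push_cast
    field_simp
    linear_combination -Complex.I_sq
  have e3 : ((x : ℂ) * w⁻¹) ^ (1 / 2 : ℂ) = w⁻¹ ^ (1 / 2 : ℂ) * ((x ^ (1 / 2 : ℝ) : ℝ) : ℂ) := by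
    rw [Complex.cpow_def_of_ne_zero (by simp [hx0, hw0]), Complex.log_ofReal_mul hx (by simp [hw0]),
      Complex.cpow_def_of_ne_zero (by simp [hw0]), Complex.ofReal_cpow hx.le,
      Complex.cpow_def_of_ne_zero hx0, ← Complex.exp_add, Complex.ofReal_log hx.le]
    congr 1
    push_cast
    ring
  have h0 : ((x : ℂ) * w⁻¹) ^ (1 / 2 : ℂ) ≠ 0 := by
    rw [Complex.cpow_def_of_ne_zero (by simp [hx0, hw0])]
    exact Complex.exp_ne_zero _
  rw [e1, e2] at h
  simp only [ne_eq, OfNat.ofNat_ne_zero, not_false_eq_true, zero_pow, mul_zero, zero_div,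
    Complex.exp_zero, mul_one] at h
  rw [rotTheta, rotTheta, h, ← e3, ← mul_assoc, mul_one_div_cancel h0, one_mul]

lemma continuousOn_rotTheta {w : ℂ} (hw : 0 < w.re) :
    ContinuousOn (rotTheta w) (Set.Ioi 0) := by
  intro x hx
  have h : ContinuousAt jacobiTheta (Complex.I * w * x) :=
    continuousAt_jacobiTheta (by rw [im_rot]; exact mul_pos hw hx)
  exact (ContinuousAt.comp (f := fun x : ℝ ↦ (Complex.I * w * x : ℂ)) h
    (by fun_prop)).continuousWithinAt

lemma isBigO_rotTheta_sub_one {w : ℂ} (hw : 0 < w.re) (r : ℝ) :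
    (fun x ↦ rotTheta w x - 1) =O[Filter.atTop] (· ^ r) := by
  have h1 : Filter.Tendsto (fun x : ℝ ↦ (Complex.I * w * x : ℂ)) Filter.atTop
      (Filter.comap Complex.im Filter.atTop) := by
    rw [Filter.tendsto_comap_iff]
    simp only [Function.comp_def, im_rot]
    exact Filter.tendsto_id.const_mul_atTop hw
  have h2 := isBigO_at_im_infty_jacobiTheta_sub_one.comp_tendsto h1
  refine h2.trans ?_
  have h3 := (isLittleO_exp_neg_mul_rpow_atTop (a := Real.pi * w.re) (by positivity) r).isBigO
  refine h3.congr_left fun x ↦ ?_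
  simp only [Function.comp_def, im_rot]
  congr 1; ring

lemma inv_re_pos {w : ℂ} (hw : 0 < w.re) : 0 < w⁻¹.re := by
  rw [Complex.inv_re]
  exact div_pos hw (Complex.normSq_pos.2 fun h ↦ by simp [h] at hw)

/-- The functional-equation pair of `rotTheta w` and `rotTheta w⁻¹`. -/
noncomputable def rotPair (w : ℂ) (hw : 0 < w.re) : WeakFEPair ℂ where
  f := rotTheta w
  g := rotTheta w⁻¹
  k := 1 / 2
  ε := w⁻¹ ^ (1 / 2 : ℂ)
  f₀ := 1
  g₀ := 1
  hf_int := (continuousOn_rotTheta hw).locallyIntegrableOn measurableSet_Ioi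
  hg_int := (continuousOn_rotTheta (inv_re_pos hw)).locallyIntegrableOn measurableSet_Ioi
  hk := by norm_num
  hε := by
    have hw0 : w ≠ 0 := fun h ↦ by simp [h] at hw
    rw [Complex.cpow_def_of_ne_zero (by simp [hw0])]
    exact Complex.exp_ne_zero _
  h_feq := fun _ hx ↦ rotTheta_inv hw hx
  hf_top := isBigO_rotTheta_sub_one hw
  hg_top := isBigO_rotTheta_sub_one (inv_re_pos hw)

lemma norm_cpow_mul_exp_neg_mul (a r : ℂ) {t : ℝ} (ht : 0 < t) :
    ‖(t : ℂ) ^ a * Complex.exp (-(r * t))‖ = t ^ a.re * Real.exp (-r.re * t ^ (1 : ℝ)) := by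
  rw [norm_mul, Complex.norm_cpow_eq_rpow_re_of_pos ht, Complex.norm_exp, Real.rpow_one]
  simp

lemma continuousOn_cpow_mul_exp_neg_mul (a r : ℂ) :
    ContinuousOn (fun t : ℝ ↦ (t : ℂ) ^ a * Complex.exp (-(r * t))) (Set.Ioi 0) := by
  intro t ht
  have h0 : (t : ℂ) ∈ Complex.slitPlane := Complex.ofReal_mem_slitPlane.2 ht
  have h1 : ContinuousAt (fun t : ℝ ↦ (t : ℂ) ^ a) t :=
    ContinuousAt.cpow (Complex.continuous_ofReal.continuousAt) continuousAt_const h0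
  exact (h1.mul (by fun_prop)).continuousWithinAt

lemma integrableOn_cpow_mul_exp_neg_mul {a : ℂ} (ha : -1 < a.re) {r : ℂ} (hr : 0 < r.re) :
    IntegrableOn (fun t : ℝ ↦ (t : ℂ) ^ a * Complex.exp (-(r * t))) (Set.Ioi 0) := by
  refine Integrable.mono' (integrableOn_rpow_mul_exp_neg_mul_rpow ha one_pos hr)
    ((continuousOn_cpow_mul_exp_neg_mul a r).aestronglyMeasurable measurableSet_Ioi) ?_
  filter_upwards [ae_restrict_mem measurableSet_Ioi] with t ht
  exact (norm_cpow_mul_exp_neg_mul a r ht).le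

lemma differentiableOn_integral_cpow_mul_exp_neg_mul {a : ℂ} (ha : 0 < a.re) :
    DifferentiableOn ℂ
      (fun r : ℂ ↦ ∫ t in Set.Ioi (0 : ℝ), (t : ℂ) ^ (a - 1) * Complex.exp (-(r * t)))
      {r | 0 < r.re} := by
  intro r₀ hr₀
  have hr₀' : 0 < r₀.re := hr₀
  have ho : IsOpen {r : ℂ | r₀.re / 2 < r.re} := isOpen_lt continuous_const Complex.continuous_re
  have hs : {r : ℂ | r₀.re / 2 < r.re} ∈ nhds r₀ := ho.mem_nhds (half_lt_self hr₀')
  have ha1 : -1 < (a - 1).re := by simp; linarith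
  have ha2 : -1 < a.re := by linarith
  have h := hasDerivAt_integral_of_dominated_loc_of_deriv_le (μ := volume.restrict (Set.Ioi 0))
    (F := fun (r : ℂ) (t : ℝ) ↦ (t : ℂ) ^ (a - 1) * Complex.exp (-(r * t)))
    (F' := fun (r : ℂ) (t : ℝ) ↦ (t : ℂ) ^ (a - 1) * (Complex.exp (-(r * t)) * (-t)))
    (bound := fun t : ℝ ↦ t ^ a.re * Real.exp (-(r₀.re / 2) * t ^ (1 : ℝ)))
    hs ?_ (integrableOn_cpow_mul_exp_neg_mul ha1 hr₀') ?_ ?_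
    (integrableOn_rpow_mul_exp_neg_mul_rpow ha2 one_pos (half_pos hr₀')) ?_
  · exact h.2.differentiableAt.differentiableWithinAt
  · exact Filter.Eventually.of_forall fun r ↦
      (continuousOn_cpow_mul_exp_neg_mul _ r).aestronglyMeasurable measurableSet_Ioi
  · refine ContinuousOn.aestronglyMeasurable ?_ measurableSet_Ioi
    refine ((continuousOn_cpow_mul_exp_neg_mul (a - 1) r₀).mul
      (g := fun t : ℝ ↦ (-(t : ℂ))) (by fun_prop)).congr fun t _ ↦ ?_
    simp only [Pi.mul_apply]; ring
  · filter_upwards [ae_restrict_mem measurableSet_Ioi] with t ht r hr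
    have ht' : 0 < t := ht
    have hr' : r₀.re / 2 < r.re := hr
    rw [← mul_assoc, norm_mul, norm_cpow_mul_exp_neg_mul _ _ ht, norm_neg, Complex.norm_real,
      Real.norm_of_nonneg ht'.le, mul_right_comm, ← Real.rpow_add_one ht'.ne']
    simp only [Complex.sub_re, Complex.one_re, sub_add_cancel, Real.rpow_one]
    gcongr
  · filter_upwards [ae_restrict_mem measurableSet_Ioi] with t ht r hr
    refine HasDerivAt.const_mul _ (HasDerivAt.cexp ?_)
    exact (hasDerivAt_mul_const (x := r) (t : ℂ)).fun_neg

lemma frequently_of_forall_real {p : ℂ → Prop} {x₀ : ℝ} {U : Set ℝ} (hU : U ∈ nhds x₀)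
    (h : ∀ x ∈ U, p (x : ℂ)) : ∃ᶠ z in nhdsWithin (x₀ : ℂ) {(x₀ : ℂ)}ᶜ, p z := by
  have ht : Filter.Tendsto (fun x : ℝ ↦ (x : ℂ)) (nhdsWithin x₀ {x₀}ᶜ)
      (nhdsWithin (x₀ : ℂ) {(x₀ : ℂ)}ᶜ) := by
    refine Complex.continuous_ofReal.continuousWithinAt.tendsto_nhdsWithin fun x hx ↦ ?_
    simpa using hx
  refine ht.frequently (Filter.Eventually.frequently ?_)
  filter_upwards [nhdsWithin_le_nhds hU] with x hx using h x hx

lemma integral_cpow_mul_cexp_neg_mul {a r : ℂ} (ha : 0 < a.re) (hr : 0 < r.re) :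
    ∫ t in Set.Ioi (0 : ℝ), (t : ℂ) ^ (a - 1) * Complex.exp (-(r * t)) =
      (1 / r) ^ a * Complex.Gamma a := by
  have ho : IsOpen {r : ℂ | 0 < r.re} := isOpen_lt continuous_const Complex.continuous_re
  have hc : IsPreconnected {r : ℂ | 0 < r.re} := (convex_halfSpace_re_gt 0).isPreconnected
  have h1 := (differentiableOn_integral_cpow_mul_exp_neg_mul ha).analyticOnNhd ho
  have h2 : AnalyticOnNhd ℂ (fun r : ℂ ↦ (1 / r) ^ a * Complex.Gamma a) {r | 0 < r.re} := by
    refine DifferentiableOn.analyticOnNhd (fun z hz ↦ ?_) ho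
    have hz' : 0 < z.re := hz
    have hz0 : z ≠ 0 := fun h ↦ by simp [h] at hz'
    have hs : 1 / z ∈ Complex.slitPlane := by
      rw [one_div]; exact Or.inl (inv_re_pos hz')
    have hd : DifferentiableAt ℂ (fun z : ℂ ↦ 1 / z) z := by fun_prop (disch := assumption)
    exact ((hd.cpow_const hs).mul_const _).differentiableWithinAt
  refine h1.eqOn_of_preconnected_of_frequently_eq h2 hc (z₀ := ((1 : ℝ) : ℂ)) (by simp)
    (frequently_of_forall_real (Ioi_mem_nhds zero_lt_one) fun x hx ↦ ?_) hr
  exact Complex.integral_cpow_mul_exp_neg_mul_Ioi ha hx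

lemma ofReal_mul_cpow {c : ℝ} (hc : 0 < c) {z : ℂ} (hz : z ≠ 0) (s : ℂ) :
    ((c : ℂ) * z) ^ s = (c : ℂ) ^ s * z ^ s := by
  have hc0 : (c : ℂ) ≠ 0 := by exact_mod_cast hc.ne'
  rw [Complex.cpow_def_of_ne_zero (mul_ne_zero hc0 hz), Complex.log_ofReal_mul hc hz,
    Complex.cpow_def_of_ne_zero hc0, Complex.cpow_def_of_ne_zero hz, ← Complex.exp_add,
    Complex.ofReal_log hc.le, add_mul]

lemma rot_term_cpow {w : ℂ} (hw : 0 < w.re) (n : ℕ) (s : ℂ) :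
    (1 / ((Real.pi * ((n : ℝ) + 1) ^ 2 : ℝ) * w)) ^ s =
      w⁻¹ ^ s * (Real.pi : ℂ) ^ (-s) * (1 / ((n : ℂ) + 1) ^ (2 * s)) := by
  have hw0 : w ≠ 0 := fun h ↦ by simp [h] at hw
  have hn : (0 : ℝ) < (n : ℝ) + 1 := by positivity
  have hpi := Real.pi_pos
  have hnc : ((n : ℂ) + 1) ≠ 0 := by exact_mod_cast hn.ne'
  have hpc : (Real.pi : ℂ) ≠ 0 := by exact_mod_cast hpi.ne'
  have e : (1 : ℂ) / ((Real.pi * ((n : ℝ) + 1) ^ 2 : ℝ) * w) =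
      ((Real.pi⁻¹ * (((n : ℝ) + 1)⁻¹) ^ 2 : ℝ) : ℂ) * w⁻¹ := by
    push_cast
    field_simp
  have e2 : (((Real.pi⁻¹ * (((n : ℝ) + 1)⁻¹) ^ 2 : ℝ) : ℂ)) ^ s =
      (Real.pi : ℂ) ^ (-s) * (1 / ((n : ℂ) + 1) ^ (2 * s)) := by
    rw [Complex.cpow_def_of_ne_zero (by exact_mod_cast (by positivity)), ← Complex.ofReal_log
      (by positivity), Real.log_mul (by positivity) (by positivity), Real.log_pow, Real.log_inv,
      Real.log_inv, Complex.cpow_def_of_ne_zero hpc, Complex.cpow_def_of_ne_zero hnc,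
      one_div, ← Complex.exp_neg, ← Complex.exp_add]
    congr 1
    rw [← Complex.ofReal_log hpi.le,
      show ((n : ℂ) + 1) = (((n : ℝ) + 1 : ℝ) : ℂ) by push_cast; rfl, ← Complex.ofReal_log hn.le]
    push_cast
    ring
  rw [e, ofReal_mul_cpow (by positivity) (inv_ne_zero hw0), e2]
  ring

lemma integral_norm_rot_term {w : ℂ} (hw : 0 < w.re) (n : ℕ) {σ : ℝ} (hσ : 0 < σ) :
    ∫ t in Set.Ioi (0 : ℝ), ‖(t : ℂ) ^ ((σ : ℂ) - 1) *
      Complex.exp (-((Real.pi * ((n : ℝ) + 1) ^ 2 : ℝ) * w * t))‖ =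
      (1 / (Real.pi * w.re)) ^ σ * Real.Gamma σ * (1 / ((n : ℝ) + 1) ^ (2 * σ)) := by
  have hn : (0 : ℝ) < (n : ℝ) + 1 := by positivity
  have hc : 0 < Real.pi * ((n : ℝ) + 1) ^ 2 * w.re := by have := Real.pi_pos; positivity
  have h := Real.integral_rpow_mul_exp_neg_mul_Ioi hσ hc
  have e : 1 / (Real.pi * ((n : ℝ) + 1) ^ 2 * w.re) =
      1 / (Real.pi * w.re) * (((n : ℝ) + 1)⁻¹) ^ (2 : ℝ) := by
    rw [Real.rpow_two]; field_simp
  rw [e, Real.mul_rpow (by have := Real.pi_pos; positivity) (by positivity), ← Real.rpow_mul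
    (by positivity), Real.inv_rpow hn.le] at h
  rw [mul_right_comm, one_div ((_ : ℝ) ^ (2 * σ)), ← h]
  refine setIntegral_congr_fun measurableSet_Ioi fun t ht ↦ ?_
  rw [norm_cpow_mul_exp_neg_mul _ _ ht, Real.rpow_one, Complex.re_ofReal_mul]
  simp

lemma rotPair_Λ_of_real {w : ℂ} (hw : 0 < w.re) {σ : ℝ} (hσ : 1 < σ) :
    (rotPair w hw).Λ σ = 2 * w⁻¹ ^ (σ : ℂ) * completedRiemannZeta (2 * σ) := by
  have hσ0 : (0 : ℝ) < ((σ : ℂ)).re := by simp; linarith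
  have hs2 : 1 < (2 * (σ : ℂ)).re := by simp; linarith
  have hm := (rotPair w hw).hasMellin (s := σ) (by
    change (1 / 2 : ℝ) < _
    simp; linarith)
  have hr (n : ℕ) : 0 < (((Real.pi * ((n : ℝ) + 1) ^ 2 : ℝ) : ℂ) * w).re := by
    rw [Complex.re_ofReal_mul]; have := Real.pi_pos; positivity
  have h1 := hasSum_integral_of_summable_integral_norm
    (μ := volume.restrict (Set.Ioi (0 : ℝ)))
    (F := fun (n : ℕ) (t : ℝ) ↦ (t : ℂ) ^ ((σ : ℂ) - 1) *
      Complex.exp (-((Real.pi * ((n : ℝ) + 1) ^ 2 : ℝ) * w * t)))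
    (fun n ↦ integrableOn_cpow_mul_exp_neg_mul (by simp; linarith) (hr n)) (by
      simp_rw [integral_norm_rot_term hw _ (show 0 < σ by linarith)]
      refine Summable.mul_left _ ?_
      have := (summable_nat_add_iff 1).2 (Real.summable_one_div_nat_rpow.2
        (show 1 < 2 * σ by linarith))
      simpa using this)
  have h2 : ∀ n : ℕ, ∫ t in Set.Ioi (0 : ℝ), (t : ℂ) ^ ((σ : ℂ) - 1) *
      Complex.exp (-((Real.pi * ((n : ℝ) + 1) ^ 2 : ℝ) * w * t)) =
      w⁻¹ ^ (σ : ℂ) * (Real.pi : ℂ) ^ (-(σ : ℂ)) * Complex.Gamma σ *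
        (1 / ((n : ℂ) + 1) ^ (2 * (σ : ℂ))) := fun n ↦ by
    rw [integral_cpow_mul_cexp_neg_mul hσ0 (hr n), rot_term_cpow hw]
    ring
  have h3 : ∫ t in Set.Ioi (0 : ℝ), (∑' n : ℕ, (t : ℂ) ^ ((σ : ℂ) - 1) *
      Complex.exp (-((Real.pi * ((n : ℝ) + 1) ^ 2 : ℝ) * w * t))) =
      (rotPair w hw).Λ σ / 2 := by
    rw [← hm.2, mellin, ← integral_div]
    refine setIntegral_congr_fun measurableSet_Ioi fun t ht ↦ ?_
    rw [tsum_mul_left, smul_eq_mul, mul_div_assoc]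
    congr 1
    refine Eq.trans ?_ (hasSum_rotTheta hw ht).tsum_eq
    refine tsum_congr fun n ↦ ?_
    congr 1
    push_cast
    ring
  rw [h3] at h1
  simp_rw [h2] at h1
  have h4 := h1.tsum_eq
  rw [tsum_mul_left, ← zeta_eq_tsum_one_div_nat_add_one_cpow hs2, riemannZeta_def_of_ne_zero
    (by intro h; rw [h] at hs2; simp at hs2; linarith), Complex.Gammaℝ_def] at h4
  have hG : Complex.Gamma (σ : ℂ) ≠ 0 := Complex.Gamma_ne_zero_of_re_pos hσ0
  have hP : (Real.pi : ℂ) ^ (-(σ : ℂ)) ≠ 0 := by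
    rw [Complex.cpow_def_of_ne_zero (by exact_mod_cast Real.pi_ne_zero)]
    exact Complex.exp_ne_zero _
  rw [show -(2 * (σ : ℂ)) / 2 = -σ by ring, show 2 * (σ : ℂ) / 2 = σ by ring] at h4
  generalize w⁻¹ ^ (σ : ℂ) = W at h4 ⊢
  field_simp at h4
  rw [mul_comm 2 (σ : ℂ)]
  linear_combination -h4

/-- The regularised Mellin transform identity linking `rotTheta` with the Riemann zeta function. -/
lemma mellin_rotPair_eq {w : ℂ} (hw : 0 < w.re) {s : ℂ} (h0 : s ≠ 0) (h1 : s ≠ 1 / 2) :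
    mellin (rotPair w hw).f_modif s = 2 * w⁻¹ ^ s * completedRiemannZeta (2 * s) + 1 / s +
      w⁻¹ ^ (1 / 2 : ℂ) / (1 / 2 - s) := by
  have hw0 : w ≠ 0 := fun h ↦ by simp [h] at hw
  obtain ⟨L, hL⟩ : ∃ L : ℂ → ℂ, L = fun s ↦ s * (1 / 2 - s) * (rotPair w hw).Λ₀ s -
    (1 / 2 - s) - s * w⁻¹ ^ (1 / 2 : ℂ) := ⟨_, rfl⟩
  obtain ⟨R, hR⟩ : ∃ R : ℂ → ℂ, R = fun s ↦ 2 * w⁻¹ ^ s *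
    (s * (1 / 2 - s) * completedRiemannZeta₀ (2 * s) - (1 / 2 - s) / 2 - s / 2) := ⟨_, rfl⟩
  have hΛ (z : ℂ) : (rotPair w hw).Λ z = (rotPair w hw).Λ₀ z - 1 / z -
      w⁻¹ ^ (1 / 2 : ℂ) / (1 / 2 - z) := by
    simp [WeakFEPair.Λ, rotPair]
  have hLz {z : ℂ} (h0 : z ≠ 0) (h1 : 1 / 2 - z ≠ 0) :
      L z = z * (1 / 2 - z) * (rotPair w hw).Λ z := by
    rw [hL, hΛ]
    linear_combination (1 / 2 - z) * mul_one_div_cancel h0 +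
      (z * w⁻¹ ^ (1 / 2 : ℂ)) * mul_inv_cancel₀ h1
  have hRz {z : ℂ} (h0 : z ≠ 0) (h1 : 1 / 2 - z ≠ 0) :
      R z = z * (1 / 2 - z) * (2 * w⁻¹ ^ z * completedRiemannZeta (2 * z)) := by
    have h2 : 1 - 2 * z ≠ 0 := fun h ↦ h1 (by linear_combination h / 2)
    rw [hR, completedRiemannZeta_eq]
    field_simp
  have dL : Differentiable ℂ L := by
    have := (rotPair w hw).differentiable_Λ₀
    rw [hL]; fun_prop
  have dR : Differentiable ℂ R := by
    have := differentiable_completedZeta₀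
    have h2 : Differentiable ℂ fun z : ℂ ↦ w⁻¹ ^ z :=
      differentiable_id.const_cpow (Or.inl (inv_ne_zero hw0))
    rw [hR]
    fun_prop
  have hLR : L = R := by
    refine AnalyticOnNhd.eq_of_frequently_eq (z₀ := ((2 : ℝ) : ℂ)) (𝕜 := ℂ)
      (fun z _ ↦ dL.analyticAt z) (fun z _ ↦ dR.analyticAt z)
      (frequently_of_forall_real (Ioi_mem_nhds one_lt_two) fun x hx ↦ ?_)
    have hx' : 1 < x := hx
    have h0 : (x : ℂ) ≠ 0 := by exact_mod_cast (by linarith : x ≠ 0)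
    have h1 : 1 / 2 - (x : ℂ) ≠ 0 := by
      intro h
      have := congrArg Complex.re h
      simp at this
      linarith
    rw [hLz h0 h1, hRz h0 h1, rotPair_Λ_of_real hw hx']
  have h1' : 1 / 2 - s ≠ 0 := sub_ne_zero.2 h1.symm
  have h := congrFun hLR s
  rw [hLz h0 h1', hRz h0 h1', hΛ] at h
  have h' := mul_left_cancel₀ (mul_ne_zero h0 h1') h
  change (rotPair w hw).Λ₀ s = _
  linear_combination h'

lemma hasDerivAt_neg_exp_mul_rpow_div {z : ℂ} (hz : z ≠ 0) {x : ℝ} (hx : 0 < x) :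
    HasDerivAt (fun x : ℝ ↦ -(Complex.exp (-(z * x)) * ((x ^ (-(1 / 2) : ℝ) : ℝ) : ℂ)) / z)
      (Complex.exp (-(z * x)) * ((x ^ (-(1 / 2) : ℝ) : ℝ) : ℂ) +
        Complex.exp (-(z * x)) * ((x ^ (-(3 / 2) : ℝ) : ℝ) : ℂ) / (2 * z)) x := by
  have h1 : HasDerivAt (fun x : ℝ ↦ Complex.exp (-(z * x))) (Complex.exp (-(z * x)) * (-z)) x := by
    have h : HasDerivAt (fun y : ℂ ↦ Complex.exp (-(z * y))) (Complex.exp (-(z * x)) * (-z)) x :=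
      HasDerivAt.cexp ((hasDerivAt_const_mul (x := (x : ℂ)) z).fun_neg)
    exact h.comp_ofReal
  have h2 : HasDerivAt (fun x : ℝ ↦ ((x ^ (-(1 / 2) : ℝ) : ℝ) : ℂ))
      ((-(1 / 2) * x ^ (-(1 / 2) - 1 : ℝ) : ℝ) : ℂ) x :=
    (Real.hasDerivAt_rpow_const (Or.inl hx.ne')).ofReal_comp
  refine ((h1.fun_mul h2).fun_neg.div_const z).congr_deriv ?_
  rw [show (-(1 / 2) - 1 : ℝ) = -(3 / 2) by norm_num]
  push_cast
  field_simp
  ring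

lemma integrableOn_exp_mul_rpow {z : ℂ} (hz : 0 < z.re) {r : ℝ} (hr : r ≤ 0) :
    IntegrableOn (fun x : ℝ ↦ Complex.exp (-(z * x)) * ((x ^ r : ℝ) : ℂ)) (Set.Ioi 1) := by
  refine Integrable.mono' (integrableOn_exp_mul_Ioi (neg_lt_zero.2 hz) 1)
    (ContinuousOn.aestronglyMeasurable ?_ measurableSet_Ioi) ?_
  · intro x hx
    have hx0 : x ≠ 0 := (zero_lt_one.trans hx).ne'
    have h2 : ContinuousAt (fun x : ℝ ↦ x ^ r) x := Real.continuousAt_rpow_const _ _ (Or.inl hx0)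
    have h3 : ContinuousAt (fun x : ℝ ↦ ((x ^ r : ℝ) : ℂ)) x :=
      Complex.continuous_ofReal.continuousAt.comp h2
    exact (ContinuousAt.mul (by fun_prop) h3).continuousWithinAt
  · filter_upwards [ae_restrict_mem measurableSet_Ioi] with x hx
    have hx1 : (1 : ℝ) < x := hx
    rw [norm_mul, Complex.norm_exp, Complex.norm_real, Real.norm_of_nonneg (by positivity)]
    have : x ^ r ≤ 1 := Real.rpow_le_one_of_one_le_of_nonpos hx1.le hr
    calc _ ≤ Real.exp (-(z * x)).re * 1 := by gcongr
      _ = _ := by simp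

lemma norm_integral_exp_mul_rpow_le {z : ℂ} (hz : 0 < z.re) :
    ‖∫ x in Set.Ioi (1 : ℝ), Complex.exp (-(z * x)) * ((x ^ (-(1 / 2) : ℝ) : ℝ) : ℂ)‖ ≤
      2 * Real.exp (-z.re) / ‖z‖ := by
  have hz0 : z ≠ 0 := fun h ↦ by simp [h] at hz
  have hzn : 0 < ‖z‖ := norm_pos_iff.2 hz0
  have i1 := integrableOn_exp_mul_rpow hz (r := -(1 / 2)) (by norm_num)
  have i2 := integrableOn_exp_mul_rpow hz (r := -(3 / 2)) (by norm_num)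
  have i3 : IntegrableOn (fun x : ℝ ↦ Complex.exp (-(z * x)) * ((x ^ (-(3 / 2) : ℝ) : ℝ) : ℂ) /
    (2 * z)) (Set.Ioi 1) := i2.div_const _
  have ht : Filter.Tendsto (fun x : ℝ ↦
      -(Complex.exp (-(z * x)) * ((x ^ (-(1 / 2) : ℝ) : ℝ) : ℂ)) / z) Filter.atTop (nhds 0) := by
    rw [tendsto_zero_iff_norm_tendsto_zero]
    have h : Filter.Tendsto (fun x : ℝ ↦ x ^ (-(1 / 2) : ℝ) / ‖z‖) Filter.atTop (nhds 0) := by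
      simpa using (tendsto_rpow_neg_atTop (show (0 : ℝ) < 1 / 2 by norm_num)).div_const ‖z‖
    refine tendsto_of_tendsto_of_tendsto_of_le_of_le' tendsto_const_nhds h
      (Filter.Eventually.of_forall fun _ ↦ norm_nonneg _) ?_
    filter_upwards [Filter.eventually_gt_atTop 0] with x hx
    rw [norm_div, norm_neg, norm_mul, Complex.norm_exp, Complex.norm_real,
      Real.norm_of_nonneg (by positivity)]
    gcongr
    have : Real.exp (-(z * x)).re ≤ 1 := Real.exp_le_one_iff.2 (by simp; positivity)
    exact mul_le_of_le_one_left (by positivity) this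
  have h := integral_Ioi_of_hasDerivAt_of_tendsto'
    (fun x (hx : x ∈ Set.Ici (1 : ℝ)) ↦ hasDerivAt_neg_exp_mul_rpow_div hz0
      (zero_lt_one.trans_le hx)) (i1.add i3) ht
  rw [integral_add i1 i3, integral_div] at h
  have h2 : ‖∫ x in Set.Ioi (1 : ℝ), Complex.exp (-(z * x)) * ((x ^ (-(3 / 2) : ℝ) : ℝ) : ℂ)‖ ≤
      Real.exp (-z.re) * 2 := by
    have hI : IntegrableOn (fun x : ℝ ↦ Real.exp (-z.re) * x ^ (-(3 / 2) : ℝ)) (Set.Ioi 1) :=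
      (integrableOn_Ioi_rpow_of_lt (by norm_num) one_pos).const_mul _
    refine (norm_integral_le_of_norm_le hI ?_).trans (le_of_eq ?_)
    · filter_upwards [ae_restrict_mem measurableSet_Ioi] with x hx
      have hx1 : (1 : ℝ) < x := hx
      rw [norm_mul, Complex.norm_exp, Complex.norm_real, Real.norm_of_nonneg (by positivity)]
      gcongr
      simp
      nlinarith
    · rw [integral_const_mul, integral_Ioi_rpow_of_lt (by norm_num) one_pos]
      norm_num
  have h3 : ∫ x in Set.Ioi (1 : ℝ), Complex.exp (-(z * x)) * ((x ^ (-(1 / 2) : ℝ) : ℝ) : ℂ) =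
      Complex.exp (-z) / z - (∫ x in Set.Ioi (1 : ℝ),
        Complex.exp (-(z * x)) * ((x ^ (-(3 / 2) : ℝ) : ℝ) : ℂ)) / (2 * z) := by
    have h' := h
    simp only [Complex.ofReal_one, mul_one, Real.one_rpow] at h'
    linear_combination h'
  rw [h3]
  refine (norm_sub_le _ _).trans ?_
  rw [norm_div, norm_div, norm_mul, Complex.norm_exp, Complex.neg_re, Complex.norm_ofNat]
  calc _ ≤ Real.exp (-z.re) / ‖z‖ + (Real.exp (-z.re) * 2) / (2 * ‖z‖) := by gcongr
    _ = _ := by field_simp; norm_num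

lemma integral_inv_mul_one_add_mul_inv {η : ℝ} (hη : 0 < η) :
    IntegrableOn (fun x : ℝ ↦ 1 / (x * (1 + η * x))) (Set.Ioi 1) ∧
    ∫ x in Set.Ioi (1 : ℝ), 1 / (x * (1 + η * x)) = Real.log (1 + 1 / η) := by
  have hd : ∀ x ∈ Set.Ici (1 : ℝ), HasDerivAt (fun x ↦ -Real.log (1 / x + η))
      (1 / (x * (1 + η * x))) x := fun x hx ↦ by
    have hx0 : 0 < x := zero_lt_one.trans_le hx
    have h1 : HasDerivAt (fun x : ℝ ↦ 1 / x + η) (-(x ^ 2)⁻¹) x := by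
      simpa using (hasDerivAt_inv hx0.ne').add_const η
    refine (h1.log (by positivity)).fun_neg.congr_deriv ?_
    field_simp
  have ht : Filter.Tendsto (fun x : ℝ ↦ -Real.log (1 / x + η)) Filter.atTop
      (nhds (-Real.log η)) := by
    have h1 : Filter.Tendsto (fun x : ℝ ↦ 1 / x + η) Filter.atTop (nhds η) := by
      simpa using (tendsto_inv_atTop_zero (𝕜 := ℝ)).add_const η
    exact (h1.log hη.ne').neg
  have hn : ∀ x ∈ Set.Ioi (1 : ℝ), 0 ≤ 1 / (x * (1 + η * x)) := fun x hx ↦ by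
    have hx0 : 0 < x := zero_lt_one.trans hx
    positivity
  refine ⟨integrableOn_Ioi_deriv_of_nonneg' hd hn ht, ?_⟩
  rw [integral_Ioi_of_hasDerivAt_of_nonneg' hd hn ht,
    show 1 + 1 / η = (1 / 1 + η) / η by field_simp; ring,
    Real.log_div (by positivity) hη.ne']
  ring

lemma sum_inv_sq_sub_sq_le (n : ℕ) :
    ∑ m ∈ Finset.range n, 1 / (((n : ℝ) + 1) ^ 2 - ((m : ℝ) + 1) ^ 2) ≤ 1 := by
  calc _ ≤ ∑ m ∈ Finset.range n, 1 / ((n : ℝ) + 1) := by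
        refine Finset.sum_le_sum fun m hm ↦ ?_
        have : (m : ℝ) + 1 ≤ n := by exact_mod_cast Finset.mem_range.1 hm
        have hm0 : (0 : ℝ) ≤ m := m.cast_nonneg
        gcongr
        nlinarith
    _ ≤ 1 := by
        rw [Finset.sum_const, Finset.card_range, nsmul_eq_mul, mul_one_div,
          div_le_one (by positivity)]
        linarith

lemma sum_range_sum_range_eq {M : Type*} [AddCommMonoid M] (a : ℕ → ℕ → M) (K : ℕ) :
    ∑ n ∈ Finset.range K, ∑ m ∈ Finset.range K, a n m =
      ∑ n ∈ Finset.range K, (a n n + ∑ m ∈ Finset.range n, (a n m + a m n)) := by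
  induction K with
  | zero => simp
  | succ K ih =>
    rw [Finset.sum_range_succ _ K, Finset.sum_range_succ (fun n ↦ a n n + _) K, ← ih,
      Finset.sum_range_succ (a K) K]
    simp_rw [Finset.sum_range_succ _ K, Finset.sum_add_distrib]
    abel

/-- The frequency attached to the product of the `n`-th term and the conjugate `m`-th term. -/
noncomputable def rotFreq (w : ℂ) (n m : ℕ) : ℂ :=
  Real.pi * (((n : ℂ) + 1) ^ 2 * w + ((m : ℂ) + 1) ^ 2 * (starRingEnd ℂ) w)

lemma rotFreq_re (w : ℂ) (n m : ℕ) :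
    (rotFreq w n m).re = Real.pi * (((n : ℝ) + 1) ^ 2 + ((m : ℝ) + 1) ^ 2) * w.re := by
  have : rotFreq w n m = ((Real.pi * ((n : ℝ) + 1) ^ 2 : ℝ) : ℂ) * w +
      ((Real.pi * ((m : ℝ) + 1) ^ 2 : ℝ) : ℂ) * (starRingEnd ℂ) w := by
    rw [rotFreq]; push_cast; ring
  rw [this, Complex.add_re, Complex.re_ofReal_mul, Complex.re_ofReal_mul, Complex.conj_re]
  ring

lemma rotFreq_im (w : ℂ) (n m : ℕ) :
    (rotFreq w n m).im = Real.pi * (((n : ℝ) + 1) ^ 2 - ((m : ℝ) + 1) ^ 2) * w.im := by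
  have : rotFreq w n m = ((Real.pi * ((n : ℝ) + 1) ^ 2 : ℝ) : ℂ) * w +
      ((Real.pi * ((m : ℝ) + 1) ^ 2 : ℝ) : ℂ) * (starRingEnd ℂ) w := by
    rw [rotFreq]; push_cast; ring
  rw [this, Complex.add_im, Complex.im_ofReal_mul, Complex.im_ofReal_mul, Complex.conj_im]
  ring

lemma rotFreq_re_pos {w : ℂ} (hw : 0 < w.re) (n m : ℕ) : 0 < (rotFreq w n m).re := by
  rw [rotFreq_re]; have := Real.pi_pos; positivity

/-- The weighted exponential of frequency `rotFreq w n m`. -/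
noncomputable def rotExp (w : ℂ) (n m : ℕ) (x : ℝ) : ℂ :=
  Complex.exp (-(rotFreq w n m * x)) * ((x ^ (-(1 / 2) : ℝ) : ℝ) : ℂ)

lemma integrableOn_rotExp {w : ℂ} (hw : 0 < w.re) (n m : ℕ) :
    IntegrableOn (rotExp w n m) (Set.Ioi 1) :=
  integrableOn_exp_mul_rpow (rotFreq_re_pos hw n m) (by norm_num)

lemma norm_integral_rotExp_add_le {w : ℂ} (hw : 0 < w.re) (him : 1 / 2 ≤ |w.im|) {n m : ℕ}
    (hmn : m < n) :
    ‖(∫ x in Set.Ioi (1 : ℝ), rotExp w n m x) + ∫ x in Set.Ioi (1 : ℝ), rotExp w m n x‖ ≤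
      4 * (Real.exp (-(Real.pi * ((n : ℝ) + 1) ^ 2 * w.re)) *
        (1 / (((n : ℝ) + 1) ^ 2 - ((m : ℝ) + 1) ^ 2))) := by
  have hπ := Real.pi_gt_three
  have hm : (m : ℝ) + 1 ≤ n := by exact_mod_cast hmn
  have hm0 : (0 : ℝ) ≤ m := m.cast_nonneg
  have hd : 0 < ((n : ℝ) + 1) ^ 2 - ((m : ℝ) + 1) ^ 2 := by nlinarith
  have key : ∀ a b : ℕ, |(((a : ℝ) + 1) ^ 2 - ((b : ℝ) + 1) ^ 2)| =
      ((n : ℝ) + 1) ^ 2 - ((m : ℝ) + 1) ^ 2 → ((a : ℝ) + 1) ^ 2 + ((b : ℝ) + 1) ^ 2 ≥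
      ((n : ℝ) + 1) ^ 2 → ‖∫ x in Set.Ioi (1 : ℝ), rotExp w a b x‖ ≤
      2 * (Real.exp (-(Real.pi * ((n : ℝ) + 1) ^ 2 * w.re)) *
        (1 / (((n : ℝ) + 1) ^ 2 - ((m : ℝ) + 1) ^ 2))) := fun a b h1 h2 ↦ by
    refine (norm_integral_exp_mul_rpow_le (rotFreq_re_pos hw a b)).trans ?_
    have h3 : ((n : ℝ) + 1) ^ 2 - ((m : ℝ) + 1) ^ 2 ≤ ‖rotFreq w a b‖ := by
      refine le_trans ?_ (Complex.abs_im_le_norm _)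
      rw [rotFreq_im, abs_mul, abs_mul, h1, abs_of_pos Real.pi_pos]
      nlinarith [mul_pos Real.pi_pos hd]
    rw [rotFreq_re, mul_one_div, mul_div_assoc]
    gcongr
  refine (norm_add_le _ _).trans ?_
  have k1 := key n m (abs_of_pos hd) (by nlinarith)
  have k2 := key m n (by rw [abs_sub_comm]; exact abs_of_pos hd) (by nlinarith)
  linarith

lemma normSq_sum_rot_eq (w : ℂ) (K : ℕ) (x : ℝ) :
    ((‖∑ n ∈ Finset.range K, Complex.exp (-((Real.pi * (n + 1) ^ 2 * x : ℝ) * w))‖ ^ 2 *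
      x ^ (-(1 / 2) : ℝ) : ℝ) : ℂ) =
      ∑ n ∈ Finset.range K, (rotExp w n n x + ∑ m ∈ Finset.range n,
        (rotExp w n m x + rotExp w m n x)) := by
  rw [← sum_range_sum_range_eq fun n m ↦ rotExp w n m x]
  rw [Complex.ofReal_mul, Complex.ofReal_pow, ← Complex.mul_conj', map_sum, Finset.sum_mul_sum,
    Finset.sum_mul]
  refine Finset.sum_congr rfl fun n _ ↦ ?_
  rw [Finset.sum_mul]
  refine Finset.sum_congr rfl fun m _ ↦ ?_
  rw [rotExp, ← Complex.exp_conj, ← Complex.exp_add]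
  congr 2
  rw [map_neg, map_mul, Complex.conj_ofReal, rotFreq]
  push_cast
  ring

lemma sum_rotExp_diag_le {w : ℂ} (hw : 0 < w.re) (K : ℕ) {x : ℝ} (hx : 0 < x) :
    ‖∑ n ∈ Finset.range K, rotExp w n n x‖ ≤ 1 / (2 * √w.re) * (1 / (x * (1 + w.re * x))) := by
  have hπ := Real.pi_gt_three
  have hwx : 0 < w.re * x := mul_pos hw hx
  have h1 : ∀ n : ℕ, ‖rotExp w n n x‖ ≤ Real.exp (-(Real.pi * ((n : ℝ) + 1) ^ 2 * (w.re * x))) *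
      (1 / (1 + w.re * x) * x ^ (-(1 / 2) : ℝ)) := fun n ↦ by
    have hn : (1 : ℝ) ≤ ((n : ℝ) + 1) ^ 2 := by
      have : (0 : ℝ) ≤ n := n.cast_nonneg
      nlinarith
    rw [rotExp, norm_mul, Complex.norm_real, Real.norm_of_nonneg (by positivity),
      Complex.norm_exp, ← mul_assoc, Complex.neg_re, Complex.re_mul_ofReal, rotFreq_re]
    gcongr
    have h2 : Real.exp (-(w.re * x)) ≤ 1 / (1 + w.re * x) := by
      rw [Real.exp_neg, ← one_div]
      gcongr
      linarith [Real.add_one_le_exp (w.re * x)]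
    refine le_trans ?_ (mul_le_mul_of_nonneg_left h2 (Real.exp_pos _).le)
    rw [← Real.exp_add]
    gcongr
    have : w.re * x ≤ Real.pi * ((n : ℝ) + 1) ^ 2 * (w.re * x) :=
      le_mul_of_one_le_left hwx.le (by nlinarith)
    nlinarith
  refine (norm_sum_le_of_le _ fun n _ ↦ h1 n).trans ?_
  rw [← Finset.sum_mul]
  refine (mul_le_mul_of_nonneg_right (sum_exp_neg_sq_le hwx K) (by positivity)).trans (le_of_eq ?_)
  rw [Real.sqrt_mul hw.le, Real.rpow_neg hx.le, ← Real.sqrt_eq_rpow]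
  have : √x ^ 2 = x := Real.sq_sqrt hx.le
  field_simp
  rw [this]

lemma integral_normSq_sum_rot_le {w : ℂ} (hw : 0 < w.re) (him : 1 / 2 ≤ |w.im|) (K : ℕ) :
    ∫ x in Set.Ioi (1 : ℝ),
      ‖∑ n ∈ Finset.range K, Complex.exp (-((Real.pi * (n + 1) ^ 2 * x : ℝ) * w))‖ ^ 2 *
        x ^ (-(1 / 2) : ℝ) ≤ (Real.log (1 + 1 / w.re) + 4) / (2 * √w.re) := by
  have hI := integrableOn_rotExp hw
  have i1 : IntegrableOn (fun x ↦ ∑ n ∈ Finset.range K, rotExp w n n x) (Set.Ioi 1) :=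
    integrable_finsetSum _ fun n _ ↦ hI n n
  have i4 : ∀ n m, IntegrableOn (fun x ↦ rotExp w n m x + rotExp w m n x) (Set.Ioi 1) :=
    fun n m ↦ (hI n m).add (hI m n)
  have i3 : ∀ n, IntegrableOn (fun x ↦ ∑ m ∈ Finset.range n,
      (rotExp w n m x + rotExp w m n x)) (Set.Ioi 1) := fun n ↦
    integrable_finsetSum _ fun m _ ↦ i4 n m
  have i2 : IntegrableOn (fun x ↦ ∑ n ∈ Finset.range K, ∑ m ∈ Finset.range n,
      (rotExp w n m x + rotExp w m n x)) (Set.Ioi 1) :=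
    integrable_finsetSum _ fun n _ ↦ i3 n
  refine (le_abs_self _).trans ?_
  rw [← Real.norm_eq_abs, ← Complex.norm_real, ← integral_complex_ofReal]
  simp_rw [normSq_sum_rot_eq, Finset.sum_add_distrib]
  simp only [Finset.sum_add_distrib] at i2
  rw [integral_add i1 i2]
  refine (norm_add_le _ _).trans ?_
  have hη := integral_inv_mul_one_add_mul_inv hw
  have b1 : ‖∫ x in Set.Ioi (1 : ℝ), ∑ n ∈ Finset.range K, rotExp w n n x‖ ≤
      1 / (2 * √w.re) * Real.log (1 + 1 / w.re) := by
    rw [← hη.2, ← integral_const_mul]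
    refine norm_integral_le_of_norm_le (hη.1.const_mul _) ?_
    filter_upwards [ae_restrict_mem measurableSet_Ioi] with x hx
    exact sum_rotExp_diag_le hw K (zero_lt_one.trans hx)
  have b2 : ‖∫ x in Set.Ioi (1 : ℝ), ∑ n ∈ Finset.range K, ∑ m ∈ Finset.range n,
      (rotExp w n m x + rotExp w m n x)‖ ≤ 4 * (1 / (2 * √w.re)) := by
    rw [integral_finsetSum _ fun n _ ↦ i3 n]
    have h2 : ∀ n ∈ Finset.range K, ‖∫ x in Set.Ioi (1 : ℝ), ∑ m ∈ Finset.range n,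
        (rotExp w n m x + rotExp w m n x)‖ ≤
        4 * Real.exp (-(Real.pi * ((n : ℝ) + 1) ^ 2 * w.re)) := fun n _ ↦ by
      rw [integral_finsetSum _ fun m _ ↦ i4 n m]
      have h3 : ∀ m ∈ Finset.range n, ‖∫ x in Set.Ioi (1 : ℝ),
          (rotExp w n m x + rotExp w m n x)‖ ≤
          4 * Real.exp (-(Real.pi * ((n : ℝ) + 1) ^ 2 * w.re)) *
            (1 / (((n : ℝ) + 1) ^ 2 - ((m : ℝ) + 1) ^ 2)) := fun m hm ↦ by
        rw [integral_add (hI n m) (hI m n), mul_assoc]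
        exact norm_integral_rotExp_add_le hw him (Finset.mem_range.1 hm)
      refine (norm_sum_le_of_le _ h3).trans ?_
      rw [← Finset.mul_sum]
      exact mul_le_of_le_one_right (by positivity) (sum_inv_sq_sub_sq_le n)
    refine (norm_sum_le_of_le _ h2).trans ?_
    rw [← Finset.mul_sum]
    exact mul_le_mul_of_nonneg_left (sum_exp_neg_sq_le hw K) (by norm_num)
  simp only [Finset.sum_add_distrib] at b2
  calc _ ≤ _ := add_le_add b1 b2
    _ = _ := by ring

lemma integral_normSq_rotTheta_le {w : ℂ} (hw : 0 < w.re) (him : 1 / 2 ≤ |w.im|) :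
    ∫ x in Set.Ioi (1 : ℝ), ‖rotTheta w x - 1‖ ^ 2 * x ^ (-(1 / 2) : ℝ) ≤
      2 * (Real.log (1 + 1 / w.re) + 4) / √w.re := by
  have hI : IntegrableOn (fun x : ℝ ↦ 1 / w.re * x ^ (-(3 / 2) : ℝ)) (Set.Ioi 1) :=
    (integrableOn_Ioi_rpow_of_lt (by norm_num) one_pos).const_mul _
  have ht := tendsto_integral_of_dominated_convergence (μ := volume.restrict (Set.Ioi (1 : ℝ)))
    (F := fun (K : ℕ) (x : ℝ) ↦
      ‖∑ n ∈ Finset.range K, Complex.exp (-((Real.pi * (n + 1) ^ 2 * x : ℝ) * w))‖ ^ 2 *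
        x ^ (-(1 / 2) : ℝ))
    (f := fun x ↦ ‖(rotTheta w x - 1) / 2‖ ^ 2 * x ^ (-(1 / 2) : ℝ))
    (fun x : ℝ ↦ 1 / w.re * x ^ (-(3 / 2) : ℝ)) (fun K ↦ ?_) hI (fun K ↦ ?_) ?_
  · have h := le_of_tendsto' ht (integral_normSq_sum_rot_le hw him)
    have e : ∀ x : ℝ, ‖(rotTheta w x - 1) / 2‖ ^ 2 * x ^ (-(1 / 2) : ℝ) =
        (1 / 4) * (‖rotTheta w x - 1‖ ^ 2 * x ^ (-(1 / 2) : ℝ)) := fun x ↦ by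
      rw [norm_div, Complex.norm_ofNat]; ring
    simp_rw [e] at h
    rw [integral_const_mul] at h
    have e2 : 2 * (Real.log (1 + 1 / w.re) + 4) / √w.re =
        4 * ((Real.log (1 + 1 / w.re) + 4) / (2 * √w.re)) := by
      field_simp; ring
    rw [e2]
    linarith
  · have h1 : ContinuousOn (fun x : ℝ ↦ x ^ (-(1 / 2) : ℝ)) (Set.Ioi 1) := fun x hx ↦
      (Real.continuousAt_rpow_const _ _
        (Or.inl (zero_lt_one.trans hx).ne')).continuousWithinAt
    exact ContinuousOn.aestronglyMeasurable (by fun_prop) measurableSet_Ioi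
  · filter_upwards [ae_restrict_mem measurableSet_Ioi] with x hx
    have hx0 : (0 : ℝ) < x := zero_lt_one.trans hx
    rw [Real.norm_of_nonneg (by positivity)]
    have h1 : ‖∑ n ∈ Finset.range K,
        Complex.exp (-((Real.pi * (n + 1) ^ 2 * x : ℝ) * w))‖ ^ 2 ≤ 1 / (w.re * x) := by
      refine (pow_le_pow_left₀ (norm_nonneg _) (norm_sum_rot_le hw hx0 K) 2).trans ?_
      have : 0 < w.re * x := mul_pos hw hx0
      rw [div_pow, mul_pow, Real.sq_sqrt this.le, one_pow]
      apply one_div_le_one_div_of_le this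
      linarith
    refine (mul_le_mul_of_nonneg_right h1 (by positivity)).trans (le_of_eq ?_)
    rw [show (-(3 / 2) : ℝ) = -(1 / 2) - 1 by norm_num, Real.rpow_sub_one hx0.ne']
    field_simp
  · filter_upwards [ae_restrict_mem measurableSet_Ioi] with x hx
    have hx0 : (0 : ℝ) < x := zero_lt_one.trans hx
    exact ((hasSum_rotTheta hw hx0).tendsto_sum_nat.norm.pow 2).mul_const _

/-- The centred theta function in logarithmic coordinates. -/
noncomputable def rotH (w : ℂ) (u : ℝ) : ℂ :=
  (Real.exp (u / 4) : ℂ) * (rotTheta w (Real.exp u) - 1)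

/-- The function whose Fourier transform is the regularised Mellin transform of `rotTheta`. -/
noncomputable def rotG (w : ℂ) (u : ℝ) : ℂ :=
  (Set.Iio 0).indicator (fun u ↦ rotH w (-u)) u +
    (Set.Ioi 0).indicator (fun u ↦ w⁻¹ ^ (1 / 2 : ℂ) * rotH w⁻¹ u) u

lemma continuous_rotH {w : ℂ} (hw : 0 < w.re) : Continuous (rotH w) := by
  have h : Continuous fun u ↦ rotTheta w (Real.exp u) :=
    (continuousOn_rotTheta hw).comp_continuous Real.continuous_exp fun u ↦ Real.exp_pos u
  unfold rotH
  fun_prop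

lemma norm_rotH_le {w : ℂ} (hw : 0 < w.re) (u : ℝ) :
    ‖rotH w u‖ ≤ 1 / √w.re * Real.exp (-(u / 4)) := by
  rw [rotH, norm_mul, Complex.norm_real, Real.norm_of_nonneg (Real.exp_pos _).le]
  refine (mul_le_mul_of_nonneg_left (norm_rotTheta_sub_one_le hw (Real.exp_pos u))
    (Real.exp_pos _).le).trans (le_of_eq ?_)
  rw [Real.sqrt_mul hw.le, ← Real.exp_half, show u / 2 = u / 4 + u / 4 by ring, Real.exp_add,
    Real.exp_neg]
  field_simp

lemma norm_sqrt_inv_eq_one {w : ℂ} (h1 : ‖w‖ = 1) : ‖w⁻¹ ^ (1 / 2 : ℂ)‖ = 1 := by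
  have := Complex.norm_cpow_real w⁻¹ (1 / 2)
  push_cast at this
  rw [this, norm_inv, h1]
  simp

lemma inv_re_eq {w : ℂ} (h1 : ‖w‖ = 1) : w⁻¹.re = w.re := by
  rw [Complex.inv_re, Complex.normSq_eq_norm_sq, h1]; simp

lemma inv_im_eq {w : ℂ} (h1 : ‖w‖ = 1) : w⁻¹.im = -w.im := by
  rw [Complex.inv_im, Complex.normSq_eq_norm_sq, h1]; simp

lemma norm_rotG_le {w : ℂ} (hw : 0 < w.re) (h1 : ‖w‖ = 1) (u : ℝ) :
    ‖rotG w u‖ ≤ 1 / √w.re * Real.exp (-|u| / 4) := by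
  rcases lt_trichotomy u 0 with h | rfl | h
  · rw [rotG, Set.indicator_of_mem (Set.mem_Iio.2 h), Set.indicator_of_notMem (by simp [h.le]), add_zero,
      abs_of_neg h]
    exact (norm_rotH_le hw (-u)).trans (le_of_eq (by ring_nf))
  · simp [rotG]
  · rw [rotG, Set.indicator_of_mem (Set.mem_Ioi.2 h), Set.indicator_of_notMem (by simp [h.le]), zero_add,
      abs_of_pos h, norm_mul, norm_sqrt_inv_eq_one h1, one_mul]
    refine (norm_rotH_le (inv_re_pos hw) u).trans (le_of_eq ?_)
    rw [inv_re_eq h1]; ring_nf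

lemma norm_rotG_le_const {w : ℂ} (hw : 0 < w.re) (h1 : ‖w‖ = 1) (u : ℝ) :
    ‖rotG w u‖ ≤ 1 / √w.re := by
  refine (norm_rotG_le hw h1 u).trans (mul_le_of_le_one_right (by positivity) ?_)
  exact Real.exp_le_one_iff.2 (by have := abs_nonneg u; linarith)

lemma measurable_rotG {w : ℂ} (hw : 0 < w.re) : Measurable (rotG w) := by
  refine Measurable.add ?_ ?_
  · exact ((continuous_rotH hw).comp continuous_neg).measurable.indicator measurableSet_Iio
  · exact (continuous_const.mul (continuous_rotH (inv_re_pos hw))).measurable.indicator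
      measurableSet_Ioi

lemma integrable_exp_neg_abs_div_four : Integrable fun u : ℝ ↦ Real.exp (-|u| / 4) := by
  have h1 : IntegrableOn (fun u : ℝ ↦ Real.exp (-|u| / 4)) (Set.Ioi 0) :=
    (integrableOn_exp_mul_Ioi (show (-(1 / 4) : ℝ) < 0 by norm_num) 0).congr_fun
      (fun u hu ↦ by
        have hu' : (0 : ℝ) < u := hu
        simp only; rw [abs_of_pos hu']; ring_nf) measurableSet_Ioi
  have h2 : IntegrableOn (fun u : ℝ ↦ Real.exp (-|u| / 4)) (Set.Iic 0) :=
    (integrableOn_exp_mul_Iic (show (0 : ℝ) < 1 / 4 by norm_num) 0).congr_fun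
      (fun u hu ↦ by
        have hu' : u ≤ (0 : ℝ) := hu
        simp only; rw [abs_of_nonpos hu']; ring_nf) measurableSet_Iic
  rw [← integrableOn_univ, ← Set.Iic_union_Ioi (a := (0 : ℝ))]
  exact h2.union h1

lemma integrable_rotG {w : ℂ} (hw : 0 < w.re) (h1 : ‖w‖ = 1) : Integrable (rotG w) :=
  Integrable.mono' (integrable_exp_neg_abs_div_four.const_mul (1 / √w.re))
    (measurable_rotG hw).aestronglyMeasurable
    (Filter.Eventually.of_forall fun u ↦ norm_rotG_le hw h1 u)

lemma integral_norm_rotG_le {w : ℂ} (hw : 0 < w.re) (h1 : ‖w‖ = 1) :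
    ∫ u, ‖rotG w u‖ ≤ 8 / √w.re := by
  refine (integral_mono (integrable_rotG hw h1).norm
    (integrable_exp_neg_abs_div_four.const_mul (1 / √w.re)) (norm_rotG_le hw h1)).trans
    (le_of_eq ?_)
  rw [integral_const_mul, integral_comp_abs (f := fun u ↦ Real.exp (-u / 4))]
  have := integral_exp_mul_Ioi (show (-(1 / 4) : ℝ) < 0 by norm_num) 0
  have e : ∀ u : ℝ, -u / 4 = -(1 / 4) * u := fun u ↦ by ring
  simp_rw [e]
  rw [this]
  norm_num
  ring

lemma integrable_normSq_rotG {w : ℂ} (hw : 0 < w.re) (h1 : ‖w‖ = 1) :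
    Integrable fun u ↦ ‖rotG w u‖ ^ 2 := by
  refine Integrable.mono' ((integrable_rotG hw h1).norm.const_mul (1 / √w.re))
    ((measurable_rotG hw).norm.pow_const 2).aestronglyMeasurable
    (Filter.Eventually.of_forall fun u ↦ ?_)
  rw [Real.norm_of_nonneg (by positivity), sq]
  exact mul_le_mul_of_nonneg_right (norm_rotG_le_const hw h1 u) (norm_nonneg _)

lemma integral_normSq_rotH {w : ℂ} :
    ∫ u in Set.Ioi (0 : ℝ), ‖rotH w u‖ ^ 2 =
      ∫ x in Set.Ioi (1 : ℝ), ‖rotTheta w x - 1‖ ^ 2 * x ^ (-(1 / 2) : ℝ) := by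
  have himg : Real.exp '' Set.Ioi 0 = Set.Ioi 1 := by
    ext x
    constructor
    · rintro ⟨u, hu, rfl⟩
      exact Real.one_lt_exp_iff.2 hu
    · intro hx
      exact ⟨Real.log x, Real.log_pos hx, Real.exp_log (zero_lt_one.trans hx)⟩
  rw [← himg, integral_image_eq_integral_abs_deriv_smul measurableSet_Ioi
    (fun u _ ↦ (Real.hasDerivAt_exp u).hasDerivWithinAt) Real.exp_injective.injOn]
  refine setIntegral_congr_fun measurableSet_Ioi fun u _ ↦ ?_
  rw [rotH, norm_mul, mul_pow, Complex.norm_real, Real.norm_of_nonneg (Real.exp_pos _).le,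
    abs_of_pos (Real.exp_pos _), smul_eq_mul, ← Real.exp_mul, ← Real.exp_nat_mul, mul_left_comm,
    ← Real.exp_add, mul_comm]
  congr 2
  push_cast
  ring

lemma integral_normSq_rotG_le {w : ℂ} (hw : 0 < w.re) (h1 : ‖w‖ = 1) (him : 1 / 2 ≤ |w.im|) :
    ∫ u, ‖rotG w u‖ ^ 2 ≤ 4 * (Real.log (1 + 1 / w.re) + 4) / √w.re := by
  have hI := integrable_normSq_rotG hw h1
  have e1 : ∫ u in Set.Iic (0 : ℝ), ‖rotG w u‖ ^ 2 = ∫ u in Set.Ioi (0 : ℝ), ‖rotH w u‖ ^ 2 := by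
    have := integral_comp_neg_Ioi (0 : ℝ) fun u ↦ ‖rotG w u‖ ^ 2
    rw [neg_zero] at this
    rw [← this]
    refine setIntegral_congr_fun measurableSet_Ioi fun u hu ↦ ?_
    have hu' : (0 : ℝ) < u := hu
    simp [rotG, hu', hu'.le]
  have e2 : ∫ u in Set.Ioi (0 : ℝ), ‖rotG w u‖ ^ 2 =
      ∫ u in Set.Ioi (0 : ℝ), ‖rotH w⁻¹ u‖ ^ 2 := by
    refine setIntegral_congr_fun measurableSet_Ioi fun u hu ↦ ?_
    have hu' : (0 : ℝ) < u := hu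
    have := norm_sqrt_inv_eq_one h1
    rw [rotG, Set.indicator_of_mem hu, Set.indicator_of_notMem (by simp [hu'.le]), zero_add,
      norm_mul, this, one_mul]
  rw [← intervalIntegral.integral_Iic_add_Ioi hI.integrableOn hI.integrableOn (b := 0),
    e1, e2, integral_normSq_rotH, integral_normSq_rotH]
  have b1 := integral_normSq_rotTheta_le hw him
  have b2 := integral_normSq_rotTheta_le (inv_re_pos hw) (by rwa [inv_im_eq h1, abs_neg])
  rw [inv_re_eq h1] at b2
  calc _ ≤ _ := add_le_add b1 b2
    _ = _ := by ring

lemma mellin_rotPair_eq_integral_rotG {w : ℂ} (hw : 0 < w.re) (t : ℝ) :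
    mellin (rotPair w hw).f_modif (1 / 4 + Complex.I * t / 2) =
      ∫ u, Complex.exp (Complex.I * (-(u / 2) : ℝ) * t) * rotG w u := by
  rw [mellin_eq_fourier, Real.fourier_real_eq_integral_exp_smul]
  have e1 : (1 / 4 + Complex.I * t / 2 : ℂ).re = 1 / 4 := by simp
  have e2 : (1 / 4 + Complex.I * t / 2 : ℂ).im = t / 2 := by simp
  rw [e1, e2]
  refine integral_congr_ae (Filter.Eventually.of_forall fun u ↦ ?_)
  simp only [smul_eq_mul]
  congr 1
  · congr 1
    push_cast
    have : (Real.pi : ℂ) ≠ 0 := by exact_mod_cast Real.pi_ne_zero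
    field_simp
  · rcases lt_trichotomy u 0 with h | rfl | h
    · rw [rotG, Set.indicator_of_mem (Set.mem_Iio.2 h), Set.indicator_of_notMem (by simp [h.le]),
        add_zero, WeakFEPair.f_modif, Pi.add_apply, Set.indicator_of_mem
          (by simpa using h), Set.indicator_of_notMem (by simp [h.le]), add_zero, rotH]
      simp only [rotPair, Complex.real_smul]
      congr 2
      ring_nf
    · simp [rotG, WeakFEPair.f_modif]
    · have h' := (rotPair w hw).hf_modif_FE (Real.exp u) (Real.exp_pos u)
      rw [one_div, ← Real.exp_neg] at h'
      rw [h', rotG, Set.indicator_of_mem (Set.mem_Ioi.2 h), Set.indicator_of_notMem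
        (by simp [h.le]), zero_add, WeakFEPair.g_modif, Pi.add_apply, Set.indicator_of_mem
          (by simpa using h), Set.indicator_of_notMem (by simp [h.le]), add_zero, rotH]
      simp only [rotPair, Complex.real_smul, smul_eq_mul]
      rw [← Real.exp_mul, show u / 4 = -(1 / 4) * u + u * (1 / 2) by ring, Real.exp_add]
      push_cast
      ring

/-- The Fourier-type integral `∫ F(u) e^{-iut/2} du`. -/
noncomputable def halfFourier (F : ℝ → ℂ) (t : ℝ) : ℂ :=
  ∫ u, Complex.exp (Complex.I * (-(u / 2) : ℝ) * t) * F u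

lemma norm_cexp_I_mul_mul (l t : ℝ) : ‖Complex.exp (Complex.I * l * t)‖ = 1 := by
  rw [show Complex.I * (l : ℂ) * t = ((l * t : ℝ) : ℂ) * Complex.I by push_cast; ring]
  exact Complex.norm_exp_ofReal_mul_I _

lemma norm_halfFourier_le (F : ℝ → ℂ) (t : ℝ) : ‖halfFourier F t‖ ≤ ∫ u, ‖F u‖ := by
  refine (norm_integral_le_integral_norm _).trans (le_of_eq ?_)
  simp_rw [norm_mul, norm_cexp_I_mul_mul, one_mul]

lemma continuous_halfFourier {F : ℝ → ℂ} (hF : Measurable F) (hi : Integrable F) :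
    Continuous (halfFourier F) := by
  refine continuous_of_dominated (bound := fun u ↦ ‖F u‖) (fun t ↦ ?_)
    (fun t ↦ Filter.Eventually.of_forall fun u ↦ ?_) hi.norm
    (Filter.Eventually.of_forall fun u ↦ by fun_prop)
  · exact (Measurable.mul (by fun_prop) hF).aestronglyMeasurable
  · rw [norm_mul, norm_cexp_I_mul_mul, one_mul]

/-- The Gaussian kernel dual to a window of width `Δ`, in the variable `u / 2`. -/
noncomputable def gaussKernel (Δ u : ℝ) : ℝ :=
  √Real.pi * Δ * Real.exp (-(u / 2 * Δ) ^ 2 / 4)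

lemma gaussKernel_nonneg {Δ : ℝ} (hΔ : 0 < Δ) (u : ℝ) : 0 ≤ gaussKernel Δ u := by
  unfold gaussKernel; positivity

lemma continuous_gaussKernel (Δ : ℝ) : Continuous (gaussKernel Δ) := by
  unfold gaussKernel; fun_prop

lemma gaussKernel_neg (Δ u : ℝ) : gaussKernel Δ (-u) = gaussKernel Δ u := by
  unfold gaussKernel; congr 3; ring

lemma gaussKernel_eq (Δ u : ℝ) :
    gaussKernel Δ u = √Real.pi * Δ * Real.exp (-(Δ ^ 2 / 16) * u ^ 2) := by
  unfold gaussKernel; congr 2; ring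

lemma integrable_gaussKernel {Δ : ℝ} (hΔ : 0 < Δ) : Integrable (gaussKernel Δ) := by
  have := (integrable_exp_neg_mul_sq (show 0 < Δ ^ 2 / 16 by positivity)).const_mul
    (√Real.pi * Δ)
  exact this.congr (Filter.Eventually.of_forall fun u ↦ (gaussKernel_eq Δ u).symm)

lemma integral_gaussKernel {Δ : ℝ} (hΔ : 0 < Δ) : ∫ u, gaussKernel Δ u = 4 * Real.pi := by
  simp_rw [gaussKernel_eq]
  rw [integral_const_mul, integral_gaussian, show Real.pi / (Δ ^ 2 / 16) = Real.pi * (4 / Δ) ^ 2 by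
    field_simp; norm_num, Real.sqrt_mul Real.pi_pos.le, Real.sqrt_sq (by positivity)]
  have := Real.mul_self_sqrt Real.pi_pos.le
  field_simp
  linear_combination this

lemma norm_integral_cexp_mul_gaussWindow {Δ : ℝ} (hΔ : 0 < Δ) (τ u : ℝ) :
    ‖∫ t : ℝ, Complex.exp (Complex.I * (-(u / 2) : ℝ) * t) * (gaussWindow Δ τ t : ℂ)‖ =
      gaussKernel Δ u := by
  rw [integral_cexp_mul_gaussWindow hΔ, norm_mul, norm_cexp_I_mul_mul, mul_one,
    Complex.norm_real, Real.norm_of_nonneg (by positivity), gaussKernel]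
  congr 3; ring

lemma norm_integral_halfFourier_mul_gaussWindow_le {F : ℝ → ℂ} (hF : Measurable F)
    (hi : Integrable F) {K : ℝ} (hK : ∀ u, ‖F u‖ ≤ K) {Δ : ℝ} (hΔ : 0 < Δ) (τ : ℝ) :
    ‖∫ t : ℝ, halfFourier F t * (gaussWindow Δ τ t : ℂ)‖ ≤ 4 * Real.pi * K := by
  have hg := (integrable_gaussWindow hΔ τ).ofReal (𝕜 := ℂ)
  have hI : Integrable (Function.uncurry fun (t u : ℝ) ↦
      Complex.exp (Complex.I * (-(u / 2) : ℝ) * t) * F u * (gaussWindow Δ τ t : ℂ))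
      (volume.prod volume) := by
    refine Integrable.mono (hg.mul_prod hi) (Measurable.aestronglyMeasurable ?_)
      (Filter.Eventually.of_forall fun p ↦ le_of_eq ?_)
    · have := continuous_gaussWindow Δ τ
      exact Measurable.mul (Measurable.mul (by fun_prop) (hF.comp measurable_snd)) (by fun_prop)
    · simp only [Function.uncurry, norm_mul, norm_cexp_I_mul_mul, one_mul]
      rw [mul_comm]; rfl
  have e : ∫ t : ℝ, halfFourier F t * (gaussWindow Δ τ t : ℂ) =
      ∫ u : ℝ, (∫ t : ℝ, Complex.exp (Complex.I * (-(u / 2) : ℝ) * t) *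
        (gaussWindow Δ τ t : ℂ)) * F u := by
    simp_rw [halfFourier, ← integral_mul_const]
    rw [integral_integral_swap hI]
    refine integral_congr_ae (Filter.Eventually.of_forall fun u ↦
      integral_congr_ae (Filter.Eventually.of_forall fun t ↦ ?_))
    simp only; ring
  rw [e]
  refine (norm_integral_le_of_norm_le ((integrable_gaussKernel hΔ).mul_const K)
    (Filter.Eventually.of_forall fun u ↦ ?_)).trans
    (le_of_eq (by rw [integral_mul_const, integral_gaussKernel hΔ]))
  rw [norm_mul, norm_integral_cexp_mul_gaussWindow hΔ]
  exact mul_le_mul_of_nonneg_left (hK u) (gaussKernel_nonneg hΔ u)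

lemma integrable_mul_gaussKernel_sub {f : ℝ → ℝ} (hf : Measurable f) (hi : Integrable f)
    {Δ : ℝ} (hΔ : 0 < Δ) :
    Integrable (fun p : ℝ × ℝ ↦ f p.1 * gaussKernel Δ (p.1 - p.2)) (volume.prod volume) := by
  have hk := integrable_gaussKernel hΔ
  have hm : Measurable fun p : ℝ × ℝ ↦ f p.1 * gaussKernel Δ (p.1 - p.2) :=
    (hf.comp measurable_fst).mul
      ((continuous_gaussKernel Δ).measurable.comp (measurable_fst.sub measurable_snd))
  rw [integrable_prod_iff hm.aestronglyMeasurable]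
  refine ⟨Filter.Eventually.of_forall fun u ↦ (hk.comp_sub_left u).const_mul (f u), ?_⟩
  have : ∀ u : ℝ, ∫ v, ‖f u * gaussKernel Δ (u - v)‖ = ‖f u‖ * (4 * Real.pi) := fun u ↦ by
    simp_rw [norm_mul, Real.norm_of_nonneg (gaussKernel_nonneg hΔ _)]
    rw [integral_const_mul, integral_sub_left_eq_self (gaussKernel Δ), integral_gaussKernel hΔ]
  simp only [this]
  exact hi.norm.mul_const _

lemma integral_mul_gaussKernel_sub {f : ℝ → ℝ} (hf : Measurable f) (hi : Integrable f)
    {Δ : ℝ} (hΔ : 0 < Δ) :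
    ∫ p : ℝ × ℝ, f p.1 * gaussKernel Δ (p.1 - p.2) = 4 * Real.pi * ∫ u, f u := by
  rw [Measure.volume_eq_prod, integral_prod _ (integrable_mul_gaussKernel_sub hf hi hΔ),
    ← integral_const_mul]
  refine integral_congr_ae (Filter.Eventually.of_forall fun u ↦ ?_)
  simp only
  rw [integral_const_mul, integral_sub_left_eq_self (gaussKernel Δ), integral_gaussKernel hΔ]
  ring

/-- A smoothed form of Bessel's inequality for the Fourier transform. -/
lemma integral_normSq_halfFourier_mul_gaussWindow_le {F : ℝ → ℂ} (hF : Measurable F)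
    (hi : Integrable F) (hi2 : Integrable fun u ↦ ‖F u‖ ^ 2) {Δ : ℝ} (hΔ : 0 < Δ) (τ : ℝ) :
    ∫ t : ℝ, ‖halfFourier F t‖ ^ 2 * gaussWindow Δ τ t ≤ 4 * Real.pi * ∫ u, ‖F u‖ ^ 2 := by
  have hg := (integrable_gaussWindow hΔ τ).ofReal (𝕜 := ℂ)
  have hc : Integrable fun v ↦ (starRingEnd ℂ) (F v) :=
    (Complex.conjLIE.toContinuousLinearEquiv.integrable_comp_iff (φ := F)).2 hi
  have hcm : Measurable fun v ↦ (starRingEnd ℂ) (F v) := Complex.continuous_conj.measurable.comp hF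
  have hI : Integrable (Function.uncurry fun (t : ℝ) (p : ℝ × ℝ) ↦
      Complex.exp (Complex.I * (-((p.1 - p.2) / 2) : ℝ) * t) * (gaussWindow Δ τ t : ℂ) *
        (F p.1 * (starRingEnd ℂ) (F p.2))) (volume.prod volume) := by
    refine Integrable.mono (hg.mul_prod (hi.mul_prod hc)) (Measurable.aestronglyMeasurable ?_)
      (Filter.Eventually.of_forall fun p ↦ le_of_eq ?_)
    · have := continuous_gaussWindow Δ τ
      exact Measurable.mul (by fun_prop) ((hF.comp (by fun_prop)).mul (hcm.comp (by fun_prop)))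
    · simp only [Function.uncurry, norm_mul, norm_cexp_I_mul_mul, one_mul]
      rfl
  have e1 : ∀ t : ℝ, ((‖halfFourier F t‖ ^ 2 * gaussWindow Δ τ t : ℝ) : ℂ) =
      ∫ p : ℝ × ℝ, Complex.exp (Complex.I * (-((p.1 - p.2) / 2) : ℝ) * t) *
        (gaussWindow Δ τ t : ℂ) * (F p.1 * (starRingEnd ℂ) (F p.2)) := fun t ↦ by
    rw [Complex.ofReal_mul, Complex.ofReal_pow, ← Complex.mul_conj', halfFourier, ← integral_conj,
      ← integral_prod_mul, ← integral_mul_const]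
    refine integral_congr_ae (Filter.Eventually.of_forall fun p ↦ ?_)
    simp only
    rw [map_mul, ← Complex.exp_conj, map_mul, map_mul, Complex.conj_I, Complex.conj_ofReal,
      Complex.conj_ofReal, show Complex.I * (-((p.1 - p.2) / 2) : ℝ) * (t : ℂ) =
      Complex.I * (-(p.1 / 2) : ℝ) * (t : ℂ) + -Complex.I * (-(p.2 / 2) : ℝ) * (t : ℂ) by
        push_cast; ring, Complex.exp_add]
    ring
  refine (le_abs_self _).trans ?_
  rw [← Real.norm_eq_abs, ← Complex.norm_real, ← integral_complex_ofReal]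
  simp_rw [e1]
  rw [integral_integral_swap hI]
  simp_rw [integral_mul_const]
  have hm2 : Measurable fun u ↦ ‖F u‖ ^ 2 := hF.norm.pow_const 2
  have j1 := integrable_mul_gaussKernel_sub hm2 hi2 hΔ
  have j2 : Integrable (fun p : ℝ × ℝ ↦ ‖F p.2‖ ^ 2 * gaussKernel Δ (p.1 - p.2))
      (volume.prod volume) := by
    refine j1.swap.congr (Filter.Eventually.of_forall fun p ↦ ?_)
    simp only [Function.comp_apply, Prod.fst_swap, Prod.snd_swap]
    rw [← gaussKernel_neg, neg_sub]
  have e2 : ∫ p : ℝ × ℝ, ‖F p.2‖ ^ 2 * gaussKernel Δ (p.1 - p.2) =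
      4 * Real.pi * ∫ u, ‖F u‖ ^ 2 := by
    rw [← integral_mul_gaussKernel_sub hm2 hi2 hΔ, Measure.volume_eq_prod,
      ← integral_prod_swap fun p : ℝ × ℝ ↦ ‖F p.1‖ ^ 2 * gaussKernel Δ (p.1 - p.2)]
    refine integral_congr_ae (Filter.Eventually.of_forall fun p ↦ ?_)
    simp only [Prod.fst_swap, Prod.snd_swap]
    rw [← gaussKernel_neg, neg_sub]
  have j3 : Integrable (fun p : ℝ × ℝ ↦ (1 / 2) * (‖F p.1‖ ^ 2 * gaussKernel Δ (p.1 - p.2) +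
      ‖F p.2‖ ^ 2 * gaussKernel Δ (p.1 - p.2))) (volume.prod volume) := (j1.add j2).const_mul _
  refine (norm_integral_le_of_norm_le j3 (Filter.Eventually.of_forall fun p ↦ ?_)).trans
    (le_of_eq ?_)
  · rw [norm_mul, norm_mul, RCLike.norm_conj, norm_integral_cexp_mul_gaussWindow hΔ]
    have := gaussKernel_nonneg hΔ (p.1 - p.2)
    nlinarith [mul_nonneg this (sq_nonneg (‖F p.1‖ - ‖F p.2‖))]
  · rw [integral_const_mul, integral_add j1 j2, ← Measure.volume_eq_prod, e2,
      integral_mul_gaussKernel_sub hm2 hi2 hΔ]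
    ring

lemma prod_normSq_midpoint_ge (y : ℝ) (m : ℕ) :
    ((m + 5 / 4 : ℝ) / (m + 1 / 4) / 5) * ∏ j ∈ Finset.range m, (((5 / 4 + j : ℝ)) ^ 2 + y ^ 2) ^ 2 ≤
      ∏ j ∈ Finset.range m, (((3 / 4 + j : ℝ)) ^ 2 + y ^ 2) * (((7 / 4 + j : ℝ)) ^ 2 + y ^ 2) := by
  induction m with
  | zero => norm_num
  | succ m ih =>
    rw [Finset.prod_range_succ, Finset.prod_range_succ]
    have h0 : (0 : ℝ) ≤ ∏ j ∈ Finset.range m, (((5 / 4 + j : ℝ)) ^ 2 + y ^ 2) ^ 2 :=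
      Finset.prod_nonneg fun j _ ↦ by positivity
    have hm : (0 : ℝ) ≤ m := m.cast_nonneg
    have key : ((m + 1 / 4 : ℝ) * (m + 9 / 4) / (m + 5 / 4) ^ 2) *
        ((((5 / 4 + m : ℝ)) ^ 2 + y ^ 2) ^ 2) ≤
        (((3 / 4 + m : ℝ)) ^ 2 + y ^ 2) * (((7 / 4 + m : ℝ)) ^ 2 + y ^ 2) := by
      rw [div_mul_eq_mul_div, div_le_iff₀ (by positivity)]
      obtain ⟨a, ha⟩ : ∃ a : ℝ, a = m + 5 / 4 := ⟨_, rfl⟩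
      have hm' : (m : ℝ) = a - 5 / 4 := by linarith
      have ha0 : 1 ≤ a := by linarith
      simp only [hm']
      have : 0 ≤ a ^ 4 / 2 + 5 / 2 * a ^ 2 * y ^ 2 + y ^ 4 + a ^ 2 / 16 := by positivity
      linear_combination this
    have := mul_le_mul ih key (by positivity) (Finset.prod_nonneg fun j _ ↦ by positivity)
    refine le_trans (le_of_eq ?_) this
    push_cast
    field_simp
    ring

open Filter Topology in
lemma norm_Gamma_midpoint (y : ℝ) :
    ‖Complex.Gamma (3 / 4 + Complex.I * y)‖ ^ 2 * ‖Complex.Gamma (7 / 4 + Complex.I * y)‖ ^ 2 ≤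
      5 * ‖Complex.Gamma (5 / 4 + Complex.I * y)‖ ^ 4 := by
  have L := fun s : ℂ ↦ (Complex.GammaSeq_tendsto_Gamma s).norm
  refine le_of_tendsto_of_tendsto (((L _).pow 2).mul ((L _).pow 2)) (((L _).pow 4).const_mul 5) ?_
  filter_upwards [eventually_gt_atTop 0] with n hn
  have hn' : (0 : ℝ) < n := by exact_mod_cast hn
  have G : ∀ a : ℝ, 0 < a → ‖Complex.GammaSeq (a + Complex.I * y) n‖ ^ 2 =
      ((n : ℝ) ^ a * n.factorial) ^ 2 / ∏ j ∈ Finset.range (n + 1), ((a + j) ^ 2 + y ^ 2) := by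
    intro a ha
    rw [Complex.GammaSeq, norm_div, div_pow, norm_mul, Complex.norm_natCast_cpow_of_pos hn,
      norm_prod, ← Finset.prod_pow, Complex.norm_natCast]
    congr 1
    · simp
    · refine Finset.prod_congr rfl fun j _ ↦ ?_
      rw [← Complex.normSq_eq_norm_sq, Complex.normSq_apply]
      simp; ring
  have h1 := G (3 / 4) (by norm_num)
  have h2 := G (7 / 4) (by norm_num)
  have h3 := G (5 / 4) (by norm_num)
  push_cast at h1 h2 h3
  rw [h1, h2, show ∀ x : ℝ, x ^ 4 = (x ^ 2) ^ 2 from fun x ↦ by ring, h3]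
  have e1 : (n : ℝ) ^ (3 / 4 : ℝ) * (n : ℝ) ^ (7 / 4 : ℝ) = ((n : ℝ) ^ (5 / 4 : ℝ)) ^ 2 := by
    rw [← Real.rpow_add hn', ← Real.rpow_natCast, ← Real.rpow_mul hn'.le]; norm_num
  have P : ∀ a : ℝ, 0 < a → 0 < ∏ j ∈ Finset.range (n + 1), ((a + j) ^ 2 + y ^ 2) := fun a ha ↦
    Finset.prod_pos fun j _ ↦ by positivity
  have key := prod_normSq_midpoint_ge y (n + 1)
  rw [Finset.prod_pow, Finset.prod_mul_distrib] at key
  have p1 := P (3 / 4) (by norm_num)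
  have p2 := P (7 / 4) (by norm_num)
  have p3 := P (5 / 4) (by norm_num)
  generalize (∏ j ∈ Finset.range (n + 1), ((3 / 4 + (j : ℝ)) ^ 2 + y ^ 2)) = A at *
  generalize (∏ j ∈ Finset.range (n + 1), ((7 / 4 + (j : ℝ)) ^ 2 + y ^ 2)) = B at *
  generalize (∏ j ∈ Finset.range (n + 1), ((5 / 4 + (j : ℝ)) ^ 2 + y ^ 2)) = D at *
  have k2 : D ^ 2 ≤ 5 * (A * B) := by
    have : (1 : ℝ) / 5 ≤ (((n + 1 : ℕ) : ℝ) + 5 / 4) / (((n + 1 : ℕ) : ℝ) + 1 / 4) / 5 := by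
      gcongr
      rw [one_le_div (by positivity)]; linarith
    nlinarith [sq_nonneg D]
  rw [div_mul_div_comm, ← mul_pow, div_pow, ← mul_div_assoc, div_le_div_iff₀ (by positivity) (by positivity)]
  have e2 : (n : ℝ) ^ (3 / 4 : ℝ) * n.factorial * ((n : ℝ) ^ (7 / 4 : ℝ) * n.factorial) =
      ((n : ℝ) ^ (5 / 4 : ℝ) * n.factorial) ^ 2 := by
    rw [mul_pow, ← e1]; ring
  rw [e2]
  calc _ ≤ ((((n : ℝ) ^ (5 / 4 : ℝ) * n.factorial) ^ 2) ^ 2) * (5 * (A * B)) := by gcongr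
    _ = _ := by ring

lemma norm_Gamma_half_add_sq_ge (y : ℝ) (hy : 0 ≤ y) :
    Real.pi * Real.exp (-(Real.pi * y)) ≤ ‖Complex.Gamma (1 / 2 + Complex.I * y)‖ ^ 2 := by
  have h := Complex.Gamma_mul_Gamma_one_sub (1 / 2 + Complex.I * y)
  have hc : (starRingEnd ℂ) (1 / 2 + Complex.I * y) = 1 - (1 / 2 + Complex.I * y) := by
    refine Complex.ext ?_ ?_ <;> simp; norm_num
  rw [← hc, Complex.Gamma_conj, Complex.mul_conj, show (Real.pi : ℂ) * (1 / 2 + Complex.I * y) =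
    (Real.pi * y : ℝ) * Complex.I + Real.pi / 2 by push_cast; ring, Complex.sin_add_pi_div_two,
    Complex.cos_mul_I, ← Complex.ofReal_cosh] at h
  rw [← Complex.normSq_eq_norm_sq, show Complex.normSq (Complex.Gamma (1 / 2 + Complex.I * y)) =
    Real.pi / Real.cosh (Real.pi * y) by exact_mod_cast h, le_div_iff₀ (Real.cosh_pos _), mul_assoc]
  refine mul_le_of_le_one_right Real.pi_pos.le ?_
  rw [Real.cosh_eq]
  have : Real.exp (-(Real.pi * y)) * Real.exp (Real.pi * y) = 1 := by rw [← Real.exp_add]; simp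
  have h2 : Real.exp (-(Real.pi * y)) ≤ 1 := Real.exp_le_one_iff.2 (by have := Real.pi_pos; nlinarith)
  nlinarith [Real.exp_pos (-(Real.pi * y))]

lemma norm_Gamma_quarter_pow_ge (y : ℝ) (hy : 1 ≤ y) :
    1 ≤ ‖Complex.Gamma (1 / 4 + Complex.I * y)‖ ^ 8 * y ^ 2 * Real.exp (4 * Real.pi * y) := by
  have hm := norm_Gamma_midpoint y
  have r1 : Complex.Gamma (5 / 4 + Complex.I * y) =
      (1 / 4 + Complex.I * y) * Complex.Gamma (1 / 4 + Complex.I * y) := by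
    rw [← Complex.Gamma_add_one]
    · ring_nf
    · intro h; have := congrArg Complex.re h; simp at this
  have r2 : Complex.Gamma (7 / 4 + Complex.I * y) =
      (3 / 4 + Complex.I * y) * Complex.Gamma (3 / 4 + Complex.I * y) := by
    rw [← Complex.Gamma_add_one]
    · ring_nf
    · intro h; have := congrArg Complex.re h; simp at this
  have n1 : ‖(1 / 4 + Complex.I * y : ℂ)‖ ^ 2 = 1 / 16 + y ^ 2 := by
    rw [← Complex.normSq_eq_norm_sq, Complex.normSq_apply]; simp; ring
  have n2 : ‖(3 / 4 + Complex.I * y : ℂ)‖ ^ 2 = 9 / 16 + y ^ 2 := by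
    rw [← Complex.normSq_eq_norm_sq, Complex.normSq_apply]; simp; ring
  have dup := congrArg (fun z : ℂ ↦ ‖z‖) (Complex.Gamma_mul_Gamma_add_half (1 / 4 + Complex.I * y))
  simp only [norm_mul] at dup
  have e : (2 : ℂ) ^ (1 - 2 * (1 / 4 + Complex.I * y)) = ((2 : ℝ) : ℂ) ^ (1 - 2 * (1 / 4 + Complex.I * y)) := by
    norm_num
  rw [e, Complex.norm_cpow_eq_rpow_re_of_pos (by norm_num), Complex.norm_real,
    Real.norm_of_nonneg (Real.sqrt_nonneg _),
    show (1 / 4 + Complex.I * y + 1 / 2 : ℂ) = 3 / 4 + Complex.I * y by ring,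
    show (2 * (1 / 4 + Complex.I * y) : ℂ) = 1 / 2 + Complex.I * (2 * y : ℝ) by push_cast; ring] at dup
  have e3 : (1 - (1 / 2 + Complex.I * (2 * y : ℝ)) : ℂ).re = 1 / 2 := by simp; norm_num
  rw [e3, ← Real.sqrt_eq_rpow] at dup
  have hh := norm_Gamma_half_add_sq_ge (2 * y) (by linarith)
  rw [r1, r2, norm_mul, norm_mul, mul_pow, mul_pow, n2, show ‖(1 / 4 + Complex.I * y : ℂ)‖ ^ 4 =
    (‖(1 / 4 + Complex.I * y : ℂ)‖ ^ 2) ^ 2 by ring, n1] at hm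
  generalize ‖Complex.Gamma (1 / 4 + Complex.I * y)‖ = X at *
  generalize ‖Complex.Gamma (3 / 4 + Complex.I * y)‖ = Y at *
  generalize ‖Complex.Gamma (1 / 2 + Complex.I * (2 * y : ℝ))‖ = W at *
  have hXY : (X * Y) ^ 2 = W ^ 2 * 2 * Real.pi := by
    rw [dup, mul_pow, mul_pow, Real.sq_sqrt (by norm_num), Real.sq_sqrt Real.pi_pos.le]
  have h4 : 2 * Real.pi ^ 2 * Real.exp (-(Real.pi * (2 * y))) ≤ (X * Y) ^ 2 := by
    rw [hXY]; nlinarith [Real.pi_pos]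
  have h5 : (2 * Real.pi ^ 2) ^ 2 * Real.exp (-(Real.pi * (2 * y))) ^ 2 ≤ (X * Y) ^ 4 := by
    rw [← mul_pow, show (X * Y) ^ 4 = ((X * Y) ^ 2) ^ 2 by ring]
    gcongr
  have h6 : Real.exp (-(Real.pi * (2 * y))) ^ 2 * Real.exp (4 * Real.pi * y) = 1 := by
    rw [← Real.exp_nat_mul, ← Real.exp_add]; simp; ring
  have h7 : (9 / 16 + y ^ 2) * (X * Y) ^ 4 ≤ 5 * (1 / 16 + y ^ 2) ^ 2 * X ^ 8 := by
    linear_combination mul_le_mul_of_nonneg_left hm (by positivity : (0 : ℝ) ≤ X ^ 4)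
  have h8 : 5 * (1 / 16 + y ^ 2) ^ 2 * X ^ 8 ≤ 20 * y ^ 4 * X ^ 8 := by
    have : (1 / 16 + y ^ 2) ^ 2 ≤ (2 * y ^ 2) ^ 2 := by gcongr; nlinarith
    have h9 : (0 : ℝ) ≤ X ^ 8 := by positivity
    nlinarith
  have h10 : y ^ 2 * (X * Y) ^ 4 ≤ y ^ 2 * (20 * y ^ 2 * X ^ 8) := by
    have : 0 ≤ (X * Y) ^ 4 := by positivity
    nlinarith
  have h11 : (X * Y) ^ 4 ≤ 20 * y ^ 2 * X ^ 8 := le_of_mul_le_mul_left h10 (by positivity)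
  have h12 : (20 : ℝ) ≤ (2 * Real.pi ^ 2) ^ 2 := by
    have : (9 : ℝ) ≤ Real.pi ^ 2 := by nlinarith [Real.pi_gt_three]
    nlinarith
  have h13 := mul_le_mul_of_nonneg_right (h5.trans h11) (Real.exp_pos (4 * Real.pi * y)).le
  rw [mul_assoc, h6] at h13
  nlinarith

lemma norm_Gamma_quarter_ge (y : ℝ) (hy : 1 ≤ y) :
    y ^ (-(1 / 4) : ℝ) * Real.exp (-(Real.pi * y / 2)) ≤ ‖Complex.Gamma (1 / 4 + Complex.I * y)‖ := by
  have h := norm_Gamma_quarter_pow_ge y hy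
  refine le_of_pow_le_pow_left₀ (n := 8) (by norm_num) (norm_nonneg _) ?_
  have hy0 : 0 < y := by linarith
  have e1 : (y ^ (-(1 / 4) : ℝ)) ^ 8 * y ^ 2 = 1 := by
    rw [← Real.rpow_natCast, ← Real.rpow_natCast, ← Real.rpow_mul hy0.le, ← Real.rpow_add hy0]
    norm_num
  have e2 : Real.exp (-(Real.pi * y / 2)) ^ 8 * Real.exp (4 * Real.pi * y) = 1 := by
    rw [← Real.exp_nat_mul, ← Real.exp_add]
    convert Real.exp_zero using 2
    push_cast; ring
  have : (y ^ (-(1 / 4) : ℝ) * Real.exp (-(Real.pi * y / 2))) ^ 8 * (y ^ 2 * Real.exp (4 * Real.pi * y)) = 1 := by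
    linear_combination Real.exp (-(Real.pi * y / 2)) ^ 8 * Real.exp (4 * Real.pi * y) * e1 + e2
  refine le_of_mul_le_mul_right (a := y ^ 2 * Real.exp (4 * Real.pi * y)) ?_ (by positivity)
  rw [this]; linarith

/-- The completed zeta function on the critical line. -/
noncomputable def lineXi (t : ℝ) : ℝ := (completedRiemannZeta (1 / 2 + Complex.I * t)).re

lemma half_add_ne_zero (t : ℝ) : (1 / 2 + Complex.I * t : ℂ) ≠ 0 := fun h ↦ by
  have := congrArg Complex.re h; simp at this

lemma half_add_ne_one (t : ℝ) : (1 / 2 + Complex.I * t : ℂ) ≠ 1 := fun h ↦ by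
  have := congrArg Complex.re h; norm_num at this

lemma Gammaℝ_half_ne_zero (t : ℝ) : Complex.Gammaℝ (1 / 2 + Complex.I * t) ≠ 0 :=
  Complex.Gammaℝ_ne_zero_of_re_pos (by simp)

lemma completedRiemannZeta_half_eq (t : ℝ) :
    completedRiemannZeta (1 / 2 + Complex.I * t) =
      Complex.Gammaℝ (1 / 2 + Complex.I * t) * riemannZeta (1 / 2 + Complex.I * t) := by
  rw [riemannZeta_def_of_ne_zero (half_add_ne_zero t), mul_div_cancel₀ _ (Gammaℝ_half_ne_zero t)]

lemma conj_half_add (t : ℝ) :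
    (starRingEnd ℂ) (1 / 2 + Complex.I * t) = 1 - (1 / 2 + Complex.I * t) := by
  refine Complex.ext ?_ ?_ <;> simp; norm_num

lemma Gammaℝ_conj (s : ℂ) :
    Complex.Gammaℝ ((starRingEnd ℂ) s) = (starRingEnd ℂ) (Complex.Gammaℝ s) := by
  rw [Complex.Gammaℝ_def, Complex.Gammaℝ_def, map_mul, ← Complex.Gamma_conj, map_div₀,
    Complex.conj_ofNat, show -(starRingEnd ℂ) s / 2 = (starRingEnd ℂ) (-s / 2) by
      rw [map_div₀, map_neg, Complex.conj_ofNat], Complex.cpow_conj]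
  · simp
  · rw [Complex.arg_ofReal_of_nonneg Real.pi_pos.le]; exact Real.pi_pos.ne

lemma ofReal_lineXi (t : ℝ) : (lineXi t : ℂ) = completedRiemannZeta (1 / 2 + Complex.I * t) := by
  rw [lineXi, ← Complex.conj_eq_iff_re]
  have h : completedRiemannZeta ((starRingEnd ℂ) (1 / 2 + Complex.I * t)) =
      (starRingEnd ℂ) (completedRiemannZeta (1 / 2 + Complex.I * t)) := by
    have e : (starRingEnd ℂ) (1 / 2 + Complex.I * t) = 1 / 2 + Complex.I * (-t : ℝ) := by
      refine Complex.ext ?_ ?_ <;> simp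
    rw [e, completedRiemannZeta_half_eq, completedRiemannZeta_half_eq, ← e, riemannZeta_conj,
      Gammaℝ_conj, map_mul]
  rw [← h, conj_half_add, completedRiemannZeta_one_sub]

lemma norm_Gammaℝ_half (t : ℝ) : ‖Complex.Gammaℝ (1 / 2 + Complex.I * t)‖ =
    Real.pi ^ (-(1 / 4) : ℝ) * ‖Complex.Gamma (1 / 4 + Complex.I * t / 2)‖ := by
  rw [Complex.Gammaℝ_def, norm_mul, Complex.norm_cpow_eq_rpow_re_of_pos Real.pi_pos]
  congr 2
  · simp; norm_num
  · congr 1; ring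

lemma hardyZ_mul_norm_Gammaℝ (t : ℝ) :
    HardyZ t * ‖Complex.Gammaℝ (1 / 2 + Complex.I * t)‖ = lineXi t := by
  rw [lineXi, completedRiemannZeta_half_eq, HardyZ, ← Complex.re_mul_ofReal]
  congr 1
  rw [mul_right_comm]
  congr 1
  have hG : Complex.Gamma (1 / 4 + Complex.I * t / 2) ≠ 0 :=
    Complex.Gamma_ne_zero_of_re_pos (by simp)
  have hp : (Real.pi : ℂ) ^ (-(1 / 2 + Complex.I * t) / 2 : ℂ) =
      (Real.pi : ℂ) ^ (-(Complex.I * t) / 2 : ℂ) * (Real.pi ^ (-(1 / 4) : ℝ) : ℝ) := by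
    rw [Complex.ofReal_cpow Real.pi_pos.le, ← Complex.cpow_add _ _
      (Complex.ofReal_ne_zero.2 Real.pi_pos.ne')]
    congr 1; push_cast; ring
  rw [norm_Gammaℝ_half, eTheta, Complex.Gammaℝ_def, hp,
    show (1 / 2 + Complex.I * t : ℂ) / 2 = 1 / 4 + Complex.I * t / 2 by ring]
  have : (‖Complex.Gamma (1 / 4 + Complex.I * t / 2)‖ : ℂ) ≠ 0 :=
    Complex.ofReal_ne_zero.2 (norm_ne_zero_iff.2 hG)
  rw [Complex.ofReal_mul]
  generalize Complex.Gamma (1 / 4 + Complex.I * t / 2) = z at *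
  field_simp

lemma hardyZ_neg_iff (t : ℝ) : HardyZ t < 0 ↔ lineXi t < 0 := by
  rw [← hardyZ_mul_norm_Gammaℝ]
  have : 0 < ‖Complex.Gammaℝ (1 / 2 + Complex.I * t)‖ := norm_pos_iff.2 (Gammaℝ_half_ne_zero t)
  exact ⟨fun h ↦ mul_neg_of_neg_of_pos h this, fun h ↦ by
    by_contra! h2
    exact absurd h (not_lt.2 (mul_nonneg h2 this.le))⟩

lemma continuous_lineXi : Continuous lineXi := by
  refine Complex.continuous_re.comp (continuous_iff_continuousAt.2 fun t ↦ ?_)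
  have h := (differentiableAt_completedZeta (half_add_ne_zero t) (half_add_ne_one t)).continuousAt
  exact ContinuousAt.comp (f := fun t : ℝ ↦ (1 / 2 + Complex.I * t : ℂ)) h (by fun_prop)

/-- The completed zeta function on the critical line with the exponential decay mostly removed. -/
noncomputable def twistXi (φ t : ℝ) : ℝ := lineXi t * Real.exp (φ * t / 2)

lemma continuous_twistXi (φ : ℝ) : Continuous (twistXi φ) := by
  have := continuous_lineXi
  unfold twistXi; fun_prop

lemma twistXi_neg_iff (φ t : ℝ) : twistXi φ t < 0 ↔ HardyZ t < 0 := by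
  rw [hardyZ_neg_iff, twistXi]
  exact ⟨fun h ↦ by
    by_contra! h2
    exact absurd h (not_lt.2 (mul_nonneg h2 (Real.exp_pos _).le)),
    fun h ↦ mul_neg_of_neg_of_pos h (Real.exp_pos _)⟩

lemma two_mul_twistXi_eq {φ : ℝ} (h0 : 0 < φ) (h1 : φ < Real.pi / 2) (t : ℝ) :
    2 * Complex.exp (-(φ / 4 : ℝ) * Complex.I) * (twistXi φ t : ℂ) =
      halfFourier (rotG (Complex.exp (φ * Complex.I))) t - 1 / (1 / 4 + Complex.I * t / 2) -
        (Complex.exp (φ * Complex.I))⁻¹ ^ (1 / 2 : ℂ) / (1 / 4 - Complex.I * t / 2) := by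
  have hw : 0 < (Complex.exp (φ * Complex.I)).re := by
    rw [Complex.exp_ofReal_mul_I_re]
    exact Real.cos_pos_of_mem_Ioo ⟨by linarith, h1⟩
  have hs0 : (1 / 4 + Complex.I * t / 2 : ℂ) ≠ 0 := fun h ↦ by
    have := congrArg Complex.re h; simp at this
  have hs1 : (1 / 4 + Complex.I * t / 2 : ℂ) ≠ 1 / 2 := fun h ↦ by
    have := congrArg Complex.re h; norm_num at this
  have hm := mellin_rotPair_eq hw hs0 hs1
  rw [mellin_rotPair_eq_integral_rotG hw] at hm
  rw [halfFourier, hm, show (2 * (1 / 4 + Complex.I * t / 2) : ℂ) = 1 / 2 + Complex.I * t by ring,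
    ← ofReal_lineXi, show (1 / 2 - (1 / 4 + Complex.I * t / 2) : ℂ) = 1 / 4 - Complex.I * t / 2 by
      ring]
  have hc : (Complex.exp (φ * Complex.I))⁻¹ ^ (1 / 4 + Complex.I * t / 2 : ℂ) =
      Complex.exp (-(φ / 4 : ℝ) * Complex.I) * (Real.exp (φ * t / 2) : ℝ) := by
    rw [← Complex.exp_neg, Complex.cpow_def_of_ne_zero (Complex.exp_ne_zero _),
      Complex.log_exp (by simp; linarith) (by simp; linarith), Complex.ofReal_exp, ← Complex.exp_add]
    congr 1
    push_cast
    linear_combination (-(φ : ℂ) * t / 2) * Complex.I_sq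
  rw [hc, twistXi, Complex.ofReal_mul]
  ring

lemma norm_quarter_add_ge (t : ℝ) : 1 / 4 ≤ ‖(1 / 4 + Complex.I * t / 2 : ℂ)‖ ∧
    |t| / 2 ≤ ‖(1 / 4 + Complex.I * t / 2 : ℂ)‖ := by
  refine ⟨le_trans (by simp) (Complex.re_le_norm _), le_trans (le_of_eq ?_) (Complex.abs_im_le_norm _)⟩
  simp [abs_div]

lemma norm_quarter_sub_eq (t : ℝ) : ‖(1 / 4 - Complex.I * t / 2 : ℂ)‖ =
    ‖(1 / 4 + Complex.I * t / 2 : ℂ)‖ := by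
  rw [← Complex.norm_conj]; congr 1
  refine Complex.ext ?_ ?_
  · rw [Complex.conj_re]; simp
  · rw [Complex.conj_im]; simp

lemma norm_exp_ofReal_mul_I_eq_one (φ : ℝ) : ‖Complex.exp (φ * Complex.I)‖ = 1 := Complex.norm_exp_ofReal_mul_I φ

lemma exp_rot_re (φ : ℝ) : (Complex.exp (φ * Complex.I)).re = Real.cos φ :=
  Complex.exp_ofReal_mul_I_re φ

lemma exp_rot_im (φ : ℝ) : (Complex.exp (φ * Complex.I)).im = Real.sin φ :=
  Complex.exp_ofReal_mul_I_im φ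

lemma norm_two_mul_twistXi_sub_le {φ : ℝ} (h0 : 0 < φ) (h1 : φ < Real.pi / 2) (t : ℝ) :
    ‖2 * Complex.exp (-(φ / 4 : ℝ) * Complex.I) * (twistXi φ t : ℂ) -
      halfFourier (rotG (Complex.exp (φ * Complex.I))) t‖ ≤
        2 / ‖(1 / 4 + Complex.I * t / 2 : ℂ)‖ := by
  rw [two_mul_twistXi_eq h0 h1, show ∀ a b c : ℂ, a - b - c - a = -(b + c) from fun a b c ↦ by ring,
    norm_neg]
  refine (norm_add_le _ _).trans (le_of_eq ?_)
  rw [norm_div, norm_div, norm_sqrt_inv_eq_one (norm_exp_ofReal_mul_I_eq_one φ), norm_quarter_sub_eq]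
  simp; ring

lemma norm_two_mul_exp_mul (φ x : ℝ) :
    ‖2 * Complex.exp (-(φ / 4 : ℝ) * Complex.I) * (x : ℂ)‖ = 2 * |x| := by
  rw [norm_mul, norm_mul, ← Complex.ofReal_neg, Complex.norm_exp_ofReal_mul_I, Complex.norm_real]
  simp

lemma two_div_norm_le (t : ℝ) : 2 / ‖(1 / 4 + Complex.I * t / 2 : ℂ)‖ ≤ 8 := by
  have := (norm_quarter_add_ge t).1
  rw [div_le_iff₀ (by linarith)]; linarith

lemma two_div_norm_le_div {T t : ℝ} (hT : 0 < T) (h : T ≤ t) :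
    2 / ‖(1 / 4 + Complex.I * t / 2 : ℂ)‖ ≤ 4 / T := by
  have h2 := (norm_quarter_add_ge t).2
  rw [abs_of_pos (by linarith)] at h2
  rw [div_le_div_iff₀ (by linarith) hT]; linarith

lemma abs_twistXi_le {φ : ℝ} (h0 : 0 < φ) (h1 : φ < Real.pi / 2) (t : ℝ) :
    |twistXi φ t| ≤ 4 / √(Real.cos φ) + 4 := by
  have hw : 0 < (Complex.exp (φ * Complex.I)).re := by
    rw [exp_rot_re]; exact Real.cos_pos_of_mem_Ioo ⟨by linarith, h1⟩
  have a := norm_two_mul_twistXi_sub_le h0 h1 t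
  have b := norm_halfFourier_le (rotG (Complex.exp (φ * Complex.I))) t
  have c := integral_norm_rotG_le hw (norm_exp_ofReal_mul_I_eq_one φ)
  rw [exp_rot_re] at c
  have d := norm_sub_norm_le (2 * Complex.exp (-(φ / 4 : ℝ) * Complex.I) * (twistXi φ t : ℂ))
    (halfFourier (rotG (Complex.exp (φ * Complex.I))) t)
  rw [norm_two_mul_exp_mul] at d
  have e := two_div_norm_le t
  have : 8 / √(Real.cos φ) = 2 * (4 / √(Real.cos φ)) := by ring
  linarith

lemma integrable_twistXi_mul {φ : ℝ} (h0 : 0 < φ) (h1 : φ < Real.pi / 2) {Δ : ℝ} (hΔ : 0 < Δ)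
    (τ : ℝ) : Integrable fun t ↦ twistXi φ t * gaussWindow Δ τ t :=
  (integrable_gaussWindow hΔ τ).bdd_mul (continuous_twistXi φ).aestronglyMeasurable
    (Filter.Eventually.of_forall fun t ↦ abs_twistXi_le h0 h1 t)

lemma abs_integral_twistXi_le {φ : ℝ} (h0 : 0 < φ) (h1 : φ < Real.pi / 2) {T Δ τ : ℝ} (hT : 0 < T)
    (hΔ : 0 < Δ) (hτ : 5 / 4 * T ≤ τ)
    (tail : ∀ t, T / 4 ≤ |t - τ| → (1 + t ^ 2) * gaussWindow Δ τ t ≤ 1 / T * (1 + t ^ 2)⁻¹) :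
    |∫ t, twistXi φ t * gaussWindow Δ τ t| ≤
      2 * Real.pi / √(Real.cos φ) + 2 * √Real.pi * Δ / T + 4 * Real.pi / T := by
  have hw : 0 < (Complex.exp (φ * Complex.I)).re := by
    rw [exp_rot_re]; exact Real.cos_pos_of_mem_Ioo ⟨by linarith, h1⟩
  obtain ⟨F, hF⟩ : ∃ F, F = rotG (Complex.exp (φ * Complex.I)) := ⟨_, rfl⟩
  have hFm : Measurable F := hF ▸ measurable_rotG hw
  have hFi : Integrable F := hF ▸ integrable_rotG hw (norm_exp_ofReal_mul_I_eq_one φ)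
  have hFK : ∀ u, ‖F u‖ ≤ 1 / √(Real.cos φ) := fun u ↦ by
    rw [hF, ← exp_rot_re]; exact norm_rotG_le_const hw (norm_exp_ofReal_mul_I_eq_one φ) u
  have hM := norm_integral_halfFourier_mul_gaussWindow_le hFm hFi hFK hΔ τ
  have hg := integrable_gaussWindow hΔ τ
  have hE : ∀ t, ‖2 * Complex.exp (-(φ / 4 : ℝ) * Complex.I) * (twistXi φ t : ℂ) - halfFourier F t‖ ≤
      2 / ‖(1 / 4 + Complex.I * t / 2 : ℂ)‖ := hF ▸ norm_two_mul_twistXi_sub_le h0 h1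
  have i1 : Integrable fun t ↦ 2 * Complex.exp (-(φ / 4 : ℝ) * Complex.I) *
      ((twistXi φ t * gaussWindow Δ τ t : ℝ) : ℂ) :=
    (integrable_twistXi_mul h0 h1 hΔ τ).ofReal.const_mul _
  have i2 : Integrable fun t ↦ halfFourier F t * (gaussWindow Δ τ t : ℂ) :=
    hg.ofReal.bdd_mul (continuous_halfFourier hFm hFi).aestronglyMeasurable
      (Filter.Eventually.of_forall fun t ↦ norm_halfFourier_le F t)
  have hD : ‖∫ t, (2 * Complex.exp (-(φ / 4 : ℝ) * Complex.I) *
      ((twistXi φ t * gaussWindow Δ τ t : ℝ) : ℂ) - halfFourier F t * (gaussWindow Δ τ t : ℂ))‖ ≤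
      ∫ t, (4 / T * gaussWindow Δ τ t + 8 / T * (1 + t ^ 2)⁻¹) := by
    refine norm_integral_le_of_norm_le ((hg.const_mul _).add
      (integrable_inv_one_add_sq.const_mul _)) (Filter.Eventually.of_forall fun t ↦ ?_)
    rw [show 2 * Complex.exp (-(φ / 4 : ℝ) * Complex.I) * ((twistXi φ t * gaussWindow Δ τ t : ℝ) : ℂ) -
      halfFourier F t * (gaussWindow Δ τ t : ℂ) = (2 * Complex.exp (-(φ / 4 : ℝ) * Complex.I) *
        (twistXi φ t : ℂ) - halfFourier F t) * (gaussWindow Δ τ t : ℂ) by push_cast; ring,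
      norm_mul, Complex.norm_real, Real.norm_of_nonneg (gaussWindow_pos Δ τ t).le]
    have hp := (gaussWindow_pos Δ τ t).le
    have hq : 0 ≤ 8 / T * (1 + t ^ 2)⁻¹ := by positivity
    by_cases ht : T / 4 ≤ |t - τ|
    · have h8 := mul_le_mul_of_nonneg_right ((hE t).trans (two_div_norm_le t)) hp
      have h9 := tail t ht
      have h10 : 0 ≤ 4 / T * gaussWindow Δ τ t := by positivity
      have h11 : 8 / T * (1 + t ^ 2)⁻¹ = 8 * (1 / T * (1 + t ^ 2)⁻¹) := by ring
      have h12 : gaussWindow Δ τ t ≤ (1 + t ^ 2) * gaussWindow Δ τ t :=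
        le_mul_of_one_le_left hp (by nlinarith [sq_nonneg t])
      linarith
    · have h3 := abs_lt.1 (not_le.1 ht)
      have := mul_le_mul_of_nonneg_right ((hE t).trans (two_div_norm_le_div hT (by linarith : T ≤ t))) hp
      linarith
  rw [integral_sub i1 i2, integral_const_mul, integral_complex_ofReal, integral_add (hg.const_mul _)
    (integrable_inv_one_add_sq.const_mul _), integral_const_mul, integral_const_mul,
    integral_gaussWindow hΔ, integral_univ_inv_one_add_sq] at hD
  have d := (norm_sub_norm_le _ _).trans hD
  rw [norm_two_mul_exp_mul] at d
  have e1 : 4 * Real.pi * (1 / √(Real.cos φ)) = 2 * (2 * Real.pi / √(Real.cos φ)) := by ring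
  have e2 : 4 / T * (√Real.pi * Δ) + 8 / T * Real.pi =
    2 * (2 * √Real.pi * Δ / T + 4 * Real.pi / T) := by ring
  linarith

lemma integral_sq_twistXi_le {φ : ℝ} (h0 : 0 < φ) (h1 : φ < Real.pi / 2)
    (h2 : 1 / 2 ≤ Real.sin φ) {T : ℝ} (hT : 0 < T) :
    ∫ t in Set.Ioc T (2 * T), twistXi φ t ^ 2 ≤
      16 * Real.pi * (Real.log (1 + 1 / Real.cos φ) + 4) / √(Real.cos φ) + 8 / T := by
  have hc : 0 < Real.cos φ := Real.cos_pos_of_mem_Ioo ⟨by linarith, h1⟩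
  have hw : 0 < (Complex.exp (φ * Complex.I)).re := by rwa [exp_rot_re]
  have hn := norm_exp_ofReal_mul_I_eq_one φ
  obtain ⟨F, hF⟩ : ∃ F, F = rotG (Complex.exp (φ * Complex.I)) := ⟨_, rfl⟩
  have hFm : Measurable F := hF ▸ measurable_rotG hw
  have hFi : Integrable F := hF ▸ integrable_rotG hw hn
  have hF2 : Integrable fun u ↦ ‖F u‖ ^ 2 := hF ▸ integrable_normSq_rotG hw hn
  have hFb : ∫ u, ‖F u‖ ^ 2 ≤ 4 * (Real.log (1 + 1 / Real.cos φ) + 4) / √(Real.cos φ) := by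
    rw [hF, ← exp_rot_re]
    refine integral_normSq_rotG_le hw hn ?_
    rw [exp_rot_im]; exact h2.trans (le_abs_self _)
  have hP := integral_normSq_halfFourier_mul_gaussWindow_le hFm hFi hF2 hT (3 / 2 * T)
  have hE : ∀ t, ‖2 * Complex.exp (-(φ / 4 : ℝ) * Complex.I) * (twistXi φ t : ℂ) - halfFourier F t‖ ≤
      2 / ‖(1 / 4 + Complex.I * t / 2 : ℂ)‖ := hF ▸ norm_two_mul_twistXi_sub_le h0 h1
  have cF := continuous_halfFourier hFm hFi
  have iG : Integrable fun t ↦ ‖halfFourier F t‖ ^ 2 * gaussWindow T (3 / 2 * T) t := by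
    refine (integrable_gaussWindow hT _).bdd_mul (c := (∫ u, ‖F u‖) ^ 2)
      (cF.norm.pow 2).aestronglyMeasurable (Filter.Eventually.of_forall fun t ↦ ?_)
    rw [Real.norm_of_nonneg (by positivity)]
    exact pow_le_pow_left₀ (norm_nonneg _) (norm_halfFourier_le F t) 2
  have step : ∫ t in Set.Ioc T (2 * T), twistXi φ t ^ 2 ≤
      ∫ t in Set.Ioc T (2 * T), (‖halfFourier F t‖ ^ 2 * gaussWindow T (3 / 2 * T) t + 8 / T ^ 2) := by
    refine setIntegral_mono_on ((continuous_twistXi φ).pow 2).integrableOn_Ioc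
      (iG.integrableOn.add (continuous_const.integrableOn_Ioc)) measurableSet_Ioc fun t ht ↦ ?_
    have a := (hE t).trans (two_div_norm_le_div hT ht.1.le)
    have d := (norm_sub_norm_le _ _).trans a
    rw [norm_two_mul_exp_mul] at d
    have hg : 1 / 2 ≤ gaussWindow T (3 / 2 * T) t := by
      have h3 : ((t - 3 / 2 * T) / T) ^ 2 ≤ 1 / 4 := by
        rw [div_pow, div_le_iff₀ (by positivity)]
        nlinarith [ht.1, ht.2, mul_nonneg (sub_nonneg.2 ht.1.le) (sub_nonneg.2 ht.2)]
      have := Real.add_one_le_exp (-((t - 3 / 2 * T) / T) ^ 2)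
      rw [gaussWindow]
      linarith
    have h5 : (2 * |twistXi φ t|) ^ 2 ≤ (‖halfFourier F t‖ + 4 / T) ^ 2 := by
      gcongr; linarith
    rw [mul_pow, sq_abs] at h5
    have h6 : (‖halfFourier F t‖ + 4 / T) ^ 2 ≤ 2 * ‖halfFourier F t‖ ^ 2 + 2 * (4 / T) ^ 2 := by
      linarith [sq_nonneg (‖halfFourier F t‖ - 4 / T)]
    have h7 := mul_le_mul_of_nonneg_left hg (sq_nonneg ‖halfFourier F t‖)
    have h8 : 2 * (4 / T) ^ 2 = 4 * (8 / T ^ 2) := by ring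
    linarith
  rw [integral_add iG.integrableOn (continuous_const.integrableOn_Ioc), setIntegral_const] at step
  have h9 : ∫ t in Set.Ioc T (2 * T), ‖halfFourier F t‖ ^ 2 * gaussWindow T (3 / 2 * T) t ≤
      ∫ t, ‖halfFourier F t‖ ^ 2 * gaussWindow T (3 / 2 * T) t :=
    setIntegral_le_integral iG (Filter.Eventually.of_forall fun t ↦
      mul_nonneg (sq_nonneg _) (gaussWindow_pos _ _ _).le)
  have h10 : (volume.real (Set.Ioc T (2 * T))) • (8 / T ^ 2) = 8 / T := by
    rw [Real.volume_real_Ioc_of_le (by linarith), smul_eq_mul]; field_simp; norm_num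
  rw [h10] at step
  have h11 := mul_le_mul_of_nonneg_left hFb (by positivity : (0 : ℝ) ≤ 4 * Real.pi)
  have h12 : 4 * Real.pi * (4 * (Real.log (1 + 1 / Real.cos φ) + 4) / √(Real.cos φ)) =
      16 * Real.pi * (Real.log (1 + 1 / Real.cos φ) + 4) / √(Real.cos φ) := by ring
  linarith

lemma abs_twistXi_ge {T t : ℝ} (hT : 2 ≤ T) (ht : t ∈ Set.Icc T (2 * T)) :
    1 / 8 * T ^ (-(1 / 4) : ℝ) * ‖riemannZeta ((1 / 2 : ℝ) + t * Complex.I)‖ ≤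
      |twistXi (Real.pi / 2 - 1 / T) t| := by
  have hx : |lineXi t| = Real.pi ^ (-(1 / 4) : ℝ) * ‖Complex.Gamma (1 / 4 + Complex.I * t / 2)‖ *
      ‖riemannZeta ((1 / 2 : ℝ) + t * Complex.I)‖ := by
    rw [← norm_Gammaℝ_half, ← Real.norm_eq_abs, ← Complex.norm_real, ofReal_lineXi,
      completedRiemannZeta_half_eq, norm_mul]
    congr 3; push_cast; ring
  have hG := norm_Gamma_quarter_ge (t / 2) (by linarith [ht.1])
  rw [show (1 / 4 + Complex.I * (t / 2 : ℝ) : ℂ) = 1 / 4 + Complex.I * t / 2 by push_cast; ring] at hG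
  rw [twistXi, abs_mul, Real.abs_exp, hx]
  have t0 : 0 < t := by linarith [ht.1]
  have h1 : T ^ (-(1 / 4) : ℝ) ≤ (t / 2) ^ (-(1 / 4) : ℝ) :=
    Real.rpow_le_rpow_of_nonpos (by positivity) (by linarith [ht.2]) (by norm_num)
  have h2 : (1 / 2 : ℝ) ≤ Real.pi ^ (-(1 / 4) : ℝ) := by
    have : (16 : ℝ) ^ (-(1 / 4) : ℝ) ≤ Real.pi ^ (-(1 / 4) : ℝ) :=
      Real.rpow_le_rpow_of_nonpos Real.pi_pos (by linarith [Real.pi_lt_four]) (by norm_num)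
    refine le_trans (le_of_eq ?_) this
    rw [show (16 : ℝ) = 2 ^ (4 : ℝ) by norm_num, ← Real.rpow_mul (by norm_num)]
    norm_num [Real.rpow_neg_one]
  have h3 : (1 / 4 : ℝ) ≤ Real.exp (-(Real.pi * (t / 2) / 2)) *
      Real.exp ((Real.pi / 2 - 1 / T) * t / 2) := by
    rw [← Real.exp_add]
    have e : -(Real.pi * (t / 2) / 2) + (Real.pi / 2 - 1 / T) * t / 2 = -(t / T / 2) := by ring
    have h4 : t / T ≤ 2 := by rw [div_le_iff₀ (by linarith)]; exact ht.2
    have h5 : Real.exp (-1) ≤ Real.exp (-(t / T / 2)) := Real.exp_le_exp.2 (by linarith)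
    rw [e]
    refine le_trans ?_ h5
    have := Real.exp_neg_one_gt_d9
    linarith
  obtain ⟨z, hz⟩ : ∃ z, z = ‖riemannZeta ((1 / 2 : ℝ) + t * Complex.I)‖ := ⟨_, rfl⟩
  have hz0 : 0 ≤ z := hz ▸ norm_nonneg _
  rw [← hz]
  calc 1 / 8 * T ^ (-(1 / 4) : ℝ) * z = 1 / 2 * (T ^ (-(1 / 4) : ℝ) * (1 / 4)) * z := by ring
    _ ≤ Real.pi ^ (-(1 / 4) : ℝ) * ((t / 2) ^ (-(1 / 4) : ℝ) *
        (Real.exp (-(Real.pi * (t / 2) / 2)) * Real.exp ((Real.pi / 2 - 1 / T) * t / 2))) * z := by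
      gcongr
    _ = Real.pi ^ (-(1 / 4) : ℝ) * ((t / 2) ^ (-(1 / 4) : ℝ) *
        Real.exp (-(Real.pi * (t / 2) / 2))) * z * Real.exp ((Real.pi / 2 - 1 / T) * t / 2) := by ring
    _ ≤ _ := by gcongr

lemma exists_pow_mul_exp_neg_rpow_le (C : ℝ) : ∃ D₀ : ℝ, 1 ≤ D₀ ∧ ∀ D ≥ D₀,
    C * D ^ 5 * Real.exp (-(D ^ (1 / 4 : ℝ) / 16)) ≤ 1 := by
  have h := (tendsto_rpow_mul_exp_neg_mul_atTop_nhds_zero 20 (1 / 16) (by norm_num)).const_mul C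
  have h2 := h.comp (tendsto_rpow_atTop (show (0 : ℝ) < 1 / 4 by norm_num))
  rw [mul_zero] at h2
  obtain ⟨D₀, hD⟩ := Filter.eventually_atTop.1 (h2.eventually_le_const one_pos)
  refine ⟨max D₀ 1, le_max_right _ _, fun D hD1 ↦ ?_⟩
  have hD0 : 0 ≤ D := by linarith [le_max_right D₀ 1]
  have := hD D ((le_max_left _ _).trans hD1)
  refine le_trans (le_of_eq ?_) this
  simp only [Function.comp]
  rw [← Real.rpow_mul hD0, show (1 / 4 * 20 : ℝ) = (5 : ℕ) by norm_num, Real.rpow_natCast]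
  ring_nf

lemma exists_gaussWindow_tail_le : ∃ T₀ : ℝ, 1 ≤ T₀ ∧ ∀ T ≥ T₀, ∀ τ, 0 ≤ τ → τ ≤ 2 * T →
    ∀ t, T / 4 ≤ |t - τ| →
      (1 + t ^ 2) * gaussWindow (T ^ (7 / 8 : ℝ)) τ t ≤ 1 / T * (1 + t ^ 2)⁻¹ := by
  obtain ⟨D₀, h1, hD⟩ := exists_pow_mul_exp_neg_rpow_le 26896
  refine ⟨4 * D₀, by linarith, fun T hT τ hτ0 hτ t ht ↦ ?_⟩
  have hT0 : 0 < T := by linarith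
  obtain ⟨D, hDe⟩ : ∃ D, D = |t - τ| := ⟨_, rfl⟩
  rw [← hDe] at ht
  have hD1 : 1 ≤ D := by linarith
  have hT4 : T ≤ 4 * D := by linarith
  have key := hD D (by linarith)
  have ht9 : |t| ≤ 9 * D := by
    have : |t| ≤ |t - τ| + |τ| := by simpa using abs_add_le (t - τ) τ
    rw [abs_of_nonneg hτ0] at this
    linarith
  have ht2 : 1 + t ^ 2 ≤ 82 * D ^ 2 := by
    rw [← sq_abs]; nlinarith [abs_nonneg t]
  have hx : D ^ (1 / 4 : ℝ) / 16 ≤ ((t - τ) / T ^ (7 / 8 : ℝ)) ^ 2 := by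
    rw [div_pow, ← sq_abs, ← hDe, le_div_iff₀ (by positivity), ← Real.rpow_natCast (T ^ (7 / 8 : ℝ)),
      ← Real.rpow_mul hT0.le]
    have a : T ^ (7 / 8 * ((2 : ℕ) : ℝ)) ≤ (4 * D) ^ (7 / 8 * ((2 : ℕ) : ℝ)) := by gcongr
    have b : (4 : ℝ) ^ (7 / 8 * ((2 : ℕ) : ℝ)) ≤ 16 := by
      calc (4 : ℝ) ^ (7 / 8 * ((2 : ℕ) : ℝ)) ≤ 4 ^ (2 : ℝ) :=
            Real.rpow_le_rpow_of_exponent_le (by norm_num) (by norm_num)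
        _ = 16 := by norm_num
    rw [Real.mul_rpow (by norm_num) (by linarith)] at a
    have e : D ^ (1 / 4 : ℝ) * D ^ (7 / 8 * ((2 : ℕ) : ℝ)) = D ^ 2 := by
      rw [← Real.rpow_add (by linarith), ← Real.rpow_natCast]; norm_num
    calc D ^ (1 / 4 : ℝ) / 16 * T ^ (7 / 8 * ((2 : ℕ) : ℝ)) ≤
        D ^ (1 / 4 : ℝ) / 16 * (16 * D ^ (7 / 8 * ((2 : ℕ) : ℝ))) := by
          gcongr; exact a.trans (by gcongr)
      _ = D ^ 2 := by rw [← e]; ring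
  have hg : gaussWindow (T ^ (7 / 8 : ℝ)) τ t ≤ Real.exp (-(D ^ (1 / 4 : ℝ) / 16)) := by
    rw [gaussWindow]; exact Real.exp_le_exp.2 (by linarith)
  have hp := gaussWindow_pos (T ^ (7 / 8 : ℝ)) τ t
  rw [one_div_mul_eq_div, le_div_iff₀ hT0, ← one_div, le_div_iff₀ (by positivity)]
  calc (1 + t ^ 2) * gaussWindow (T ^ (7 / 8 : ℝ)) τ t * T * (1 + t ^ 2) =
      (1 + t ^ 2) ^ 2 * T * gaussWindow (T ^ (7 / 8 : ℝ)) τ t := by ring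
    _ ≤ (82 * D ^ 2) ^ 2 * (4 * D) * Real.exp (-(D ^ (1 / 4 : ℝ) / 16)) := by gcongr
    _ = 26896 * D ^ 5 * Real.exp (-(D ^ (1 / 4 : ℝ) / 16)) := by ring
    _ ≤ 1 := key

lemma exists_le_zetaMean_rpow : ∃ c > 0, ∃ T₀ : ℝ, 1 ≤ T₀ ∧ ∀ T ≥ T₀, ∀ τ,
    c * T ^ (7 / 8 : ℝ) * Real.log T ^ (1 / 4 : ℝ) ≤ zetaMean (T ^ (7 / 8 : ℝ)) τ := by
  obtain ⟨c, hc, N₀, h⟩ := exists_le_zetaMean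
  have hl := (tendsto_rpow_atTop (show (0 : ℝ) < 1 / 16 by norm_num)).eventually_ge_atTop
    (max (N₀ + 1 : ℝ) 2)
  obtain ⟨T₀, hT₀⟩ := Filter.eventually_atTop.1 hl
  refine ⟨c / 2, by positivity, max T₀ 1, le_max_right _ _, fun T hT τ ↦ ?_⟩
  have hT1 : 1 ≤ T := (le_max_right _ _).trans hT
  have hT0 : 0 < T := by linarith
  have hx := hT₀ T ((le_max_left _ _).trans hT)
  obtain ⟨x, hxe⟩ : ∃ x, x = T ^ (1 / 16 : ℝ) := ⟨_, rfl⟩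
  rw [← hxe] at hx
  have hx2 : 2 ≤ x := (le_max_right _ _).trans hx
  have hxN : N₀ + 1 ≤ x := (le_max_left _ _).trans hx
  have e8 : T ^ (1 / 8 : ℝ) = x ^ 2 := by
    rw [hxe, ← Real.rpow_natCast, ← Real.rpow_mul hT0.le]; norm_num
  have e14 : T ^ (7 / 8 : ℝ) = x ^ 14 := by
    rw [hxe, ← Real.rpow_natCast, ← Real.rpow_mul hT0.le]; norm_num
  obtain ⟨N, hN⟩ : ∃ N, N = ⌊x ^ 2⌋₊ := ⟨_, rfl⟩
  have hNle : (N : ℝ) ≤ x ^ 2 := hN ▸ Nat.floor_le (by positivity)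
  have hNgt : x ^ 2 - 1 < N := hN ▸ Nat.sub_one_lt_floor _
  have hNx : x ≤ N := by nlinarith
  have hNN : N₀ ≤ N := by
    have : (N₀ : ℝ) ≤ N := by linarith
    exact_mod_cast this
  have hsq : (N : ℝ) ^ 2 ≤ x ^ 14 := by
    calc (N : ℝ) ^ 2 ≤ (x ^ 2) ^ 2 := by gcongr
      _ = x ^ 4 := by ring
      _ ≤ x ^ 14 := pow_le_pow_right₀ (by linarith) (by norm_num)
  rw [e14]
  refine le_trans ?_ (h N hNN (x ^ 14) hsq τ)
  have hlog : Real.log T / 16 ≤ Real.log N := by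
    refine le_trans (le_of_eq ?_) (Real.log_le_log (by linarith) hNx)
    rw [hxe, Real.log_rpow hT0]; ring
  have hl0 : 0 ≤ Real.log T := Real.log_nonneg hT1
  have h16 : (Real.log T / 16) ^ (1 / 4 : ℝ) = Real.log T ^ (1 / 4 : ℝ) / 2 := by
    rw [Real.div_rpow hl0 (by norm_num), show (16 : ℝ) = 2 ^ (4 : ℝ) by norm_num,
      ← Real.rpow_mul (by norm_num)]
    norm_num
  have := Real.rpow_le_rpow (by positivity) hlog (show (0 : ℝ) ≤ 1 / 4 by norm_num)
  rw [h16] at this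
  have h3 := mul_le_mul_of_nonneg_left this (by positivity : 0 ≤ c * x ^ 14)
  linarith

lemma inv_two_mul_le_cos {T : ℝ} (hT : 1 ≤ T) : 1 / (2 * T) ≤ Real.cos (Real.pi / 2 - 1 / T) := by
  rw [Real.cos_pi_div_two_sub]
  have h1 : 1 / T ≤ 1 := by rw [div_le_one (by linarith)]; exact hT
  have h := Real.mul_le_sin (x := 1 / T) (by positivity) (by linarith [Real.pi_gt_three])
  refine le_trans ?_ h
  rw [show 1 / (2 * T) = 1 / 2 * (1 / T) by field_simp]
  refine mul_le_mul_of_nonneg_right ?_ (by positivity)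
  rw [div_le_div_iff₀ (by norm_num) Real.pi_pos]; linarith [Real.pi_lt_four]

lemma inv_sqrt_cos_le {T : ℝ} (hT : 1 ≤ T) : 1 / √(Real.cos (Real.pi / 2 - 1 / T)) ≤ 2 * √T := by
  have h := inv_two_mul_le_cos hT
  have h0 : 0 < 1 / (2 * T) := by positivity
  have h1 : √(1 / (2 * T)) ≤ √(Real.cos (Real.pi / 2 - 1 / T)) := Real.sqrt_le_sqrt h
  refine (one_div_le_one_div_of_le (Real.sqrt_pos.2 h0) h1).trans ?_
  rw [one_div (2 * T), Real.sqrt_inv, one_div, inv_inv]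
  refine Real.sqrt_le_iff.2 ⟨by positivity, ?_⟩
  rw [mul_pow, Real.sq_sqrt (by linarith)]; linarith

lemma half_le_sin {T : ℝ} (hT : 2 ≤ T) : 1 / 2 ≤ Real.sin (Real.pi / 2 - 1 / T) := by
  rw [Real.sin_pi_div_two_sub]
  have h1 : 1 / T ≤ 1 / 2 := one_div_le_one_div_of_le (by norm_num) hT
  have h0 : 0 < 1 / T := by positivity
  have := Real.one_sub_sq_div_two_le_cos (x := 1 / T)
  nlinarith

/-- The negative part of the twisted completed zeta function on the critical line, where the twist
is adapted to heights of size `T`. -/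
noncomputable def negXi (T t : ℝ) : ℝ := max (-twistXi (Real.pi / 2 - 1 / T) t) 0

lemma continuous_negXi (T : ℝ) : Continuous (negXi T) :=
  (continuous_twistXi _).neg.max continuous_const

lemma negXi_nonneg (T t : ℝ) : 0 ≤ negXi T t := le_max_right _ _

lemma abs_twistXi_eq (T t : ℝ) : |twistXi (Real.pi / 2 - 1 / T) t| =
    twistXi (Real.pi / 2 - 1 / T) t + 2 * negXi T t := by
  rw [negXi]
  rcases le_total 0 (twistXi (Real.pi / 2 - 1 / T) t) with h | h
  · rw [abs_of_nonneg h, max_eq_right (by linarith)]; ring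
  · rw [abs_of_nonpos h, max_eq_left (by linarith)]; ring

lemma negXi_le_abs (T t : ℝ) : negXi T t ≤ |twistXi (Real.pi / 2 - 1 / T) t| :=
  max_le (neg_le_abs _) (abs_nonneg _)

lemma twist_angle_mem {T : ℝ} (hT : 1 ≤ T) :
    0 < Real.pi / 2 - 1 / T ∧ Real.pi / 2 - 1 / T < Real.pi / 2 := by
  have h1 : 1 / T ≤ 1 := by rw [div_le_one (by linarith)]; exact hT
  have h0 : 0 < 1 / T := by positivity
  constructor <;> linarith [Real.pi_gt_three]

lemma abs_twistXi_le_sqrt {T : ℝ} (hT : 1 ≤ T) (t : ℝ) :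
    |twistXi (Real.pi / 2 - 1 / T) t| ≤ 12 * √T := by
  have h := abs_twistXi_le (twist_angle_mem hT).1 (twist_angle_mem hT).2 t
  have h2 := inv_sqrt_cos_le hT
  have h3 : 1 ≤ √T := Real.one_le_sqrt.2 hT
  rw [show ∀ x : ℝ, 4 / x = 4 * (1 / x) from fun x ↦ by ring] at h
  linarith

lemma integral_negXi_window_ge {T τ c : ℝ} (hT : 2 ≤ T) (h1 : 5 / 4 * T ≤ τ) (h2 : τ ≤ 7 / 4 * T)
    (tail : ∀ t, T / 4 ≤ |t - τ| →
      (1 + t ^ 2) * gaussWindow (T ^ (7 / 8 : ℝ)) τ t ≤ 1 / T * (1 + t ^ 2)⁻¹)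
    (hz : c * T ^ (7 / 8 : ℝ) * Real.log T ^ (1 / 4 : ℝ) ≤ zetaMean (T ^ (7 / 8 : ℝ)) τ) :
    c / 8 * T ^ (5 / 8 : ℝ) * Real.log T ^ (1 / 4 : ℝ) - 200 * √T ≤
      2 * ∫ t in Set.Ioc T (2 * T), negXi T t * gaussWindow (T ^ (7 / 8 : ℝ)) τ t := by
  have hT0 : 0 < T := by linarith
  have hT1 : 1 ≤ T := by linarith
  obtain ⟨hφ0, hφ1⟩ := twist_angle_mem hT1
  have hsT : 1 ≤ √T := Real.one_le_sqrt.2 hT1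
  have hmean := abs_integral_twistXi_le hφ0 hφ1 hT0 (Real.rpow_pos_of_pos hT0 (7 / 8)) h1 tail
  have hΔT : T ^ (7 / 8 : ℝ) ≤ T := by
    calc T ^ (7 / 8 : ℝ) ≤ T ^ (1 : ℝ) := Real.rpow_le_rpow_of_exponent_le hT1 (by norm_num)
      _ = T := Real.rpow_one T
  have hΔ : 0 < T ^ (7 / 8 : ℝ) := Real.rpow_pos_of_pos hT0 _
  have hprod : T ^ (-(1 / 4) : ℝ) * T ^ (7 / 8 : ℝ) = T ^ (5 / 8 : ℝ) := by
    rw [← Real.rpow_add hT0]; norm_num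
  have hq1 : T ^ (-(1 / 4) : ℝ) ≤ 1 := Real.rpow_le_one_of_one_le_of_nonpos hT1 (by norm_num)
  have hq0 : 0 < T ^ (-(1 / 4) : ℝ) := Real.rpow_pos_of_pos hT0 _
  have hsqrt := inv_sqrt_cos_le hT1
  generalize T ^ (7 / 8 : ℝ) = Δ at *
  have hlow := fun t (ht : t ∈ Set.Icc T (2 * T)) ↦ abs_twistXi_ge hT ht
  generalize T ^ (-(1 / 4) : ℝ) = q at *
  have hmean2 : ∫ t, twistXi (Real.pi / 2 - 1 / T) t * gaussWindow Δ τ t ≤ 40 * √T := by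
    refine (le_abs_self _).trans (hmean.trans ?_)
    have a : 2 * Real.pi / √(Real.cos (Real.pi / 2 - 1 / T)) ≤ 16 * √T := by
      rw [show ∀ x : ℝ, 2 * Real.pi / x = 2 * Real.pi * (1 / x) from fun x ↦ by ring]
      calc 2 * Real.pi * (1 / √(Real.cos (Real.pi / 2 - 1 / T))) ≤ 2 * 4 * (2 * √T) := by
            gcongr; exact Real.pi_lt_four.le
        _ = _ := by ring
    have b : 2 * √Real.pi * Δ / T ≤ 4 := by
      have : √Real.pi ≤ 2 := Real.sqrt_le_iff.2 ⟨by norm_num, by linarith [Real.pi_lt_four]⟩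
      rw [div_le_iff₀ hT0]
      calc 2 * √Real.pi * Δ ≤ 2 * 2 * T := by gcongr
        _ = _ := by ring
    have d : 4 * Real.pi / T ≤ 16 := by
      rw [div_le_iff₀ hT0]; nlinarith [Real.pi_lt_four]
    linarith
  have i1 := integrable_twistXi_mul hφ0 hφ1 hΔ τ
  have i2 : Integrable fun t ↦ (Set.Ioc T (2 * T)).indicator
      (fun t ↦ 2 * (negXi T t * gaussWindow Δ τ t)) t := by
    rw [integrable_indicator_iff measurableSet_Ioc]
    exact (((continuous_negXi T).mul (continuous_gaussWindow Δ τ)).const_mul 2).integrableOn_Ioc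
  have i3 : Integrable fun t : ℝ ↦ (28 * √T) / T * (1 + t ^ 2)⁻¹ :=
    integrable_inv_one_add_sq.const_mul _
  have pw : ∀ t : ℝ, q / 8 * (‖riemannZeta ((1 / 2 : ℝ) + t * Complex.I)‖ * gaussWindow Δ τ t) ≤
      twistXi (Real.pi / 2 - 1 / T) t * gaussWindow Δ τ t + (Set.Ioc T (2 * T)).indicator
        (fun t ↦ 2 * (negXi T t * gaussWindow Δ τ t)) t + (28 * √T) / T * (1 + t ^ 2)⁻¹ := by
    intro t
    have hp := (gaussWindow_pos Δ τ t).le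
    have hrest : 0 ≤ (28 * √T) / T * (1 + t ^ 2)⁻¹ := by positivity
    by_cases ht : t ∈ Set.Ioc T (2 * T)
    · rw [Set.indicator_of_mem ht]
      have := mul_le_mul_of_nonneg_right (hlow t (Set.Ioc_subset_Icc_self ht)) hp
      rw [abs_twistXi_eq] at this
      linarith
    · rw [Set.indicator_of_notMem ht]
      have hfar : T / 4 ≤ |t - τ| := by
        by_contra! hlt
        have := abs_lt.1 hlt
        exact ht ⟨by linarith, by linarith⟩
      have ht1 := tail t hfar
      have hζ := mul_le_mul_of_nonneg_right (norm_riemannZeta_half_le t) hp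
      have hv := neg_le_of_abs_le (abs_twistXi_le_sqrt hT1 t)
      have hv2 := mul_le_mul_of_nonneg_right hv hp
      have hg : gaussWindow Δ τ t ≤ (1 + t ^ 2) * gaussWindow Δ τ t :=
        le_mul_of_one_le_left hp (by nlinarith [sq_nonneg t])
      obtain ⟨E, hE⟩ : ∃ E, E = 1 / T * (1 + t ^ 2)⁻¹ := ⟨_, rfl⟩
      have hE0 : 0 ≤ E := hE ▸ by positivity
      rw [← hE] at ht1
      have e : (28 * √T) / T * (1 + t ^ 2)⁻¹ = 28 * (√T * E) := by rw [hE]; ring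
      rw [e]
      have k1 : q / 8 * (‖riemannZeta ((1 / 2 : ℝ) + t * Complex.I)‖ * gaussWindow Δ τ t) ≤
          1 / 8 * (30 * E) :=
        mul_le_mul (by linarith) (by linarith) (mul_nonneg (norm_nonneg _) hp) (by norm_num)
      have k2 : √T * gaussWindow Δ τ t ≤ √T * E := by gcongr; linarith
      have k3 : E ≤ √T * E := le_mul_of_one_le_left hE0 hsT
      linarith
  have i4 : Integrable fun t : ℝ ↦
      q / 8 * (‖riemannZeta ((1 / 2 : ℝ) + t * Complex.I)‖ * gaussWindow Δ τ t) :=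
    (integrable_zeta_half_mul_gaussWindow hΔ τ).const_mul _
  have i12 : Integrable fun t : ℝ ↦ twistXi (Real.pi / 2 - 1 / T) t * gaussWindow Δ τ t +
      (Set.Ioc T (2 * T)).indicator (fun t ↦ 2 * (negXi T t * gaussWindow Δ τ t)) t := i1.add i2
  have hI := integral_mono i4 (i12.add i3) pw
  simp only [Pi.add_apply] at hI
  rw [integral_add i12 i3, integral_add i1 i2, integral_indicator measurableSet_Ioc,
    integral_const_mul, integral_const_mul, integral_const_mul, integral_univ_inv_one_add_sq] at hI
  change q / 8 * zetaMean Δ τ ≤ _ at hI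
  have hl := mul_le_mul_of_nonneg_left hz (by positivity : 0 ≤ q / 8)
  have e1 : q / 8 * (c * Δ * Real.log T ^ (1 / 4 : ℝ)) =
      c / 8 * T ^ (5 / 8 : ℝ) * Real.log T ^ (1 / 4 : ℝ) := by rw [← hprod]; ring
  have e2 : (28 * √T) / T * Real.pi ≤ 112 * √T := by
    rw [div_mul_eq_mul_div, div_le_iff₀ hT0]
    calc 28 * √T * Real.pi ≤ 28 * √T * 4 := by gcongr; exact Real.pi_lt_four.le
      _ = 112 * √T * 1 := by ring
      _ ≤ 112 * √T * T := by gcongr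
  linarith

lemma gaussWindow_comm (Δ τ t : ℝ) : gaussWindow Δ τ t = gaussWindow Δ t τ := by
  unfold gaussWindow; congr 1; ring

lemma setIntegral_setIntegral_gaussWindow_le {f : ℝ → ℝ} (hf : Continuous f) (h0 : ∀ t, 0 ≤ f t)
    {K : ℝ} (hK : ∀ t, |f t| ≤ K) {Δ : ℝ} (hΔ : 0 < Δ) (a b c d : ℝ) :
    IntegrableOn (fun τ ↦ ∫ t in Set.Ioc a b, f t * gaussWindow Δ τ t) (Set.Ioc c d) ∧
    ∫ τ in Set.Ioc c d, ∫ t in Set.Ioc a b, f t * gaussWindow Δ τ t ≤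
      √Real.pi * Δ * ∫ t in Set.Ioc a b, f t := by
  have hgc : Continuous fun p : ℝ × ℝ ↦ f p.2 * gaussWindow Δ p.1 p.2 := by
    unfold gaussWindow; fun_prop
  have hI : Integrable (Function.uncurry fun τ t ↦ f t * gaussWindow Δ τ t)
      ((volume.restrict (Set.Ioc c d)).prod (volume.restrict (Set.Ioc a b))) := by
    refine Integrable.of_bound hgc.aestronglyMeasurable K (Filter.Eventually.of_forall fun p ↦ ?_)
    simp only [Function.uncurry, norm_mul]
    rw [Real.norm_of_nonneg (gaussWindow_pos _ _ _).le]
    exact (mul_le_of_le_one_right (norm_nonneg _) (gaussWindow_le_one _ _ _)).trans (hK _)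
  refine ⟨hI.integral_prod_left, ?_⟩
  rw [integral_integral_swap hI, ← integral_const_mul]
  refine integral_mono_of_nonneg (Filter.Eventually.of_forall fun t ↦ integral_nonneg fun τ ↦
    mul_nonneg (h0 t) (gaussWindow_pos _ _ _).le) (hf.integrableOn_Ioc.const_mul _)
    (Filter.Eventually.of_forall fun t ↦ ?_)
  simp only
  rw [integral_const_mul, mul_comm]
  refine mul_le_mul_of_nonneg_right ?_ (h0 t)
  simp_rw [gaussWindow_comm Δ _ t]
  refine (setIntegral_le_integral (integrable_gaussWindow hΔ t)
    (Filter.Eventually.of_forall fun τ ↦ (gaussWindow_pos _ _ _).le)).trans (le_of_eq ?_)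
  exact integral_gaussWindow hΔ t

lemma exists_le_integral_negXi : ∃ c > 0, ∃ T₀ : ℝ, 3 ≤ T₀ ∧ ∀ T ≥ T₀,
    c * T ^ (3 / 4 : ℝ) * Real.log T ^ (1 / 4 : ℝ) ≤ ∫ t in Set.Ioc T (2 * T), negXi T t := by
  obtain ⟨c, hc, T₁, hT₁, hz⟩ := exists_le_zetaMean_rpow
  obtain ⟨T₂, hT₂, htail⟩ := exists_gaussWindow_tail_le
  obtain ⟨T₃, hT₃⟩ := Filter.eventually_atTop.1
    ((tendsto_rpow_atTop (show (0 : ℝ) < 1 / 8 by norm_num)).eventually_ge_atTop (3200 / c))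
  refine ⟨c / 128, by positivity, max (max T₁ T₂) (max T₃ 3),
    (le_max_right _ _).trans (le_max_right _ _), fun T hT ↦ ?_⟩
  have hTT₁ : T₁ ≤ T := ((le_max_left _ _).trans (le_max_left _ _)).trans hT
  have hTT₂ : T₂ ≤ T := ((le_max_right _ _).trans (le_max_left _ _)).trans hT
  have hTT₃ : T₃ ≤ T := ((le_max_left _ _).trans (le_max_right _ _)).trans hT
  have hT3 : 3 ≤ T := ((le_max_right _ _).trans (le_max_right _ _)).trans hT
  have hT0 : 0 < T := by linarith
  have hL : 1 ≤ Real.log T := by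
    rw [Real.le_log_iff_exp_le hT0]; linarith [Real.exp_one_lt_d9]
  have hL4 : 1 ≤ Real.log T ^ (1 / 4 : ℝ) := Real.one_le_rpow hL (by norm_num)
  have h8 : 3200 ≤ c * T ^ (1 / 8 : ℝ) := by
    have := hT₃ T hTT₃
    rwa [div_le_iff₀ hc, mul_comm] at this
  have e1 : T ^ (5 / 8 : ℝ) = √T * T ^ (1 / 8 : ℝ) := by
    rw [Real.sqrt_eq_rpow, ← Real.rpow_add hT0]; norm_num
  have e2 : T * T ^ (5 / 8 : ℝ) = T ^ (7 / 8 : ℝ) * T ^ (3 / 4 : ℝ) := by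
    nth_rw 1 [← Real.rpow_one T]
    rw [← Real.rpow_add hT0, ← Real.rpow_add hT0]; norm_num
  have hΔ : 0 < T ^ (7 / 8 : ℝ) := Real.rpow_pos_of_pos hT0 _
  have hW : ∀ τ ∈ Set.Ioc (5 / 4 * T) (7 / 4 * T),
      c / 32 * T ^ (5 / 8 : ℝ) * Real.log T ^ (1 / 4 : ℝ) ≤
        ∫ t in Set.Ioc T (2 * T), negXi T t * gaussWindow (T ^ (7 / 8 : ℝ)) τ t := by
    intro τ hτ
    have h := integral_negXi_window_ge (by linarith) hτ.1.le hτ.2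
      (htail T hTT₂ τ (by linarith [hτ.1]) (by linarith [hτ.2])) (hz T hTT₁ τ)
    have h200 : 200 * √T ≤ c / 16 * T ^ (5 / 8 : ℝ) * Real.log T ^ (1 / 4 : ℝ) := by
      rw [e1]
      calc 200 * √T ≤ (c * T ^ (1 / 8 : ℝ) / 16) * √T * 1 := by
            rw [mul_one]; gcongr; linarith
        _ ≤ (c * T ^ (1 / 8 : ℝ) / 16) * √T * Real.log T ^ (1 / 4 : ℝ) := by gcongr
        _ = _ := by ring
    linarith
  obtain ⟨hi, hle⟩ := setIntegral_setIntegral_gaussWindow_le (continuous_negXi T) (negXi_nonneg T)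
    (fun t ↦ (abs_of_nonneg (negXi_nonneg T t)).trans_le ((negXi_le_abs T t).trans
      (abs_twistXi_le_sqrt (by linarith) t))) hΔ T (2 * T) (5 / 4 * T) (7 / 4 * T)
  have hge := setIntegral_mono_on (continuous_const.integrableOn_Ioc) hi measurableSet_Ioc hW
  rw [setIntegral_const, Real.volume_real_Ioc_of_le (by linarith), smul_eq_mul] at hge
  have hpi : √Real.pi ≤ 2 := Real.sqrt_le_iff.2 ⟨by norm_num, by linarith [Real.pi_lt_four]⟩
  have hn : 0 ≤ ∫ t in Set.Ioc T (2 * T), negXi T t := integral_nonneg (negXi_nonneg T)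
  have h2 : √Real.pi * T ^ (7 / 8 : ℝ) * ∫ t in Set.Ioc T (2 * T), negXi T t ≤
      2 * T ^ (7 / 8 : ℝ) * ∫ t in Set.Ioc T (2 * T), negXi T t := by gcongr
  have h3 := hge.trans (hle.trans h2)
  refine le_of_mul_le_mul_left ?_ (by positivity : 0 < 2 * T ^ (7 / 8 : ℝ))
  refine le_trans (le_of_eq ?_) h3
  linear_combination (-(c / 64) * Real.log T ^ (1 / 4 : ℝ)) * e2

lemma integral_sq_twistXi_le_log {T : ℝ} (hT : 3 ≤ T) :
    ∫ t in Set.Ioc T (2 * T), twistXi (Real.pi / 2 - 1 / T) t ^ 2 ≤ 800 * √T * Real.log T := by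
  have hT0 : 0 < T := by linarith
  have hT1 : 1 ≤ T := by linarith
  have hL : 1 ≤ Real.log T := by
    rw [Real.le_log_iff_exp_le hT0]; linarith [Real.exp_one_lt_d9]
  have hs : 1 ≤ √T := Real.one_le_sqrt.2 hT1
  refine (integral_sq_twistXi_le (twist_angle_mem hT1).1 (twist_angle_mem hT1).2
    (half_le_sin (by linarith)) hT0).trans ?_
  have hc := inv_two_mul_le_cos hT1
  have h2 := inv_sqrt_cos_le hT1
  generalize Real.cos (Real.pi / 2 - 1 / T) = η at *
  have hη : 0 < η := lt_of_lt_of_le (by positivity) hc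
  have hi : 1 / η ≤ 2 * T := by
    have := one_div_le_one_div_of_le (by positivity) hc
    rwa [one_div_one_div] at this
  have hlog : Real.log (1 + 1 / η) ≤ 2 * Real.log T := by
    rw [show 2 * Real.log T = Real.log (T ^ 2) by rw [Real.log_pow]; norm_num]
    exact Real.log_le_log (by positivity) (by nlinarith)
  have h8 : 8 / T ≤ 8 * (√T * Real.log T) := by
    have : 8 / T ≤ 8 := by rw [div_le_iff₀ hT0]; linarith
    nlinarith
  have hlog0 : 0 ≤ Real.log (1 + 1 / η) := Real.log_nonneg (by
    have : 0 < 1 / η := by positivity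
    linarith)
  have h9 : 16 * Real.pi * (Real.log (1 + 1 / η) + 4) / √η ≤ 768 * (√T * Real.log T) := by
    rw [show ∀ x y : ℝ, x / y = x * (1 / y) from fun x y ↦ by ring]
    calc 16 * Real.pi * (Real.log (1 + 1 / η) + 4) * (1 / √η) ≤
        16 * 4 * (6 * Real.log T) * (2 * √T) := by
          gcongr
          · exact Real.pi_lt_four.le
          · linarith
      _ = _ := by ring
  nlinarith

lemma jmeasminus_cauchy_schwarz {T : ℝ} {l : ℝ} (hl : 0 < l) :
    2 * ∫ t in Set.Ioc T (2 * T), negXi T t ≤ l * Jmeasminus T +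
      (∫ t in Set.Ioc T (2 * T), twistXi (Real.pi / 2 - 1 / T) t ^ 2) / l := by
  obtain ⟨S, hS⟩ : ∃ S, S = {t : ℝ | t ∈ Set.Ioc T (2 * T) ∧ HardyZ t < 0} := ⟨_, rfl⟩
  have cv := continuous_twistXi (Real.pi / 2 - 1 / T)
  have hSm : MeasurableSet S := by
    have : S = Set.Ioc T (2 * T) ∩ {t | twistXi (Real.pi / 2 - 1 / T) t < 0} := by
      rw [hS]; ext t; simp [twistXi_neg_iff]
    rw [this]
    exact measurableSet_Ioc.inter (measurableSet_lt cv.measurable measurable_const)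
  have hsub : S ⊆ Set.Ioc T (2 * T) := hS ▸ fun t ht ↦ ht.1
  have hJ : ∫ t in Set.Ioc T (2 * T), S.indicator (fun _ ↦ l) t = l * Jmeasminus T := by
    rw [setIntegral_indicator hSm, Set.inter_eq_right.2 hsub, setIntegral_const, smul_eq_mul,
      Jmeasminus, ← hS, Measure.real, mul_comm]
  have i1 : IntegrableOn (S.indicator fun _ ↦ l) (Set.Ioc T (2 * T)) :=
    (continuous_const.integrableOn_Ioc : IntegrableOn (fun _ : ℝ ↦ l) _ _).indicator hSm
  have i2 : IntegrableOn (fun t ↦ twistXi (Real.pi / 2 - 1 / T) t ^ 2 / l) (Set.Ioc T (2 * T)) :=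
    ((cv.pow 2).div_const l).integrableOn_Ioc
  rw [← hJ, ← integral_div, ← integral_const_mul, ← integral_add i1 i2]
  refine setIntegral_mono_on ((continuous_negXi T).const_mul 2).integrableOn_Ioc (i1.add i2)
    measurableSet_Ioc fun t ht ↦ ?_
  by_cases h : HardyZ t < 0
  · have hv := (twistXi_neg_iff (Real.pi / 2 - 1 / T) t).2 h
    rw [Set.indicator_of_mem (hS ▸ ⟨ht, h⟩), negXi, max_eq_left (by linarith)]
    generalize twistXi (Real.pi / 2 - 1 / T) t = v
    have : l + v ^ 2 / l - 2 * -v = (l + v) ^ 2 / l := by field_simp; ring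
    have h2 : 0 ≤ (l + v) ^ 2 / l := by positivity
    linarith
  · have hv := mt (twistXi_neg_iff (Real.pi / 2 - 1 / T) t).1 h
    rw [Set.indicator_of_notMem (hS ▸ fun h3 ↦ h h3.2), negXi, max_eq_right (by linarith)]
    have : 0 ≤ twistXi (Real.pi / 2 - 1 / T) t ^ 2 / l := by positivity
    linarith

theorem Jmeasminus_lower_bound :
    ∃ c > (0 : ℝ), ∃ T₀ : ℝ, ∀ T ≥ T₀,
      c * T * (Real.log T) ^ (-(1 : ℝ) / 2) ≤ Jmeasminus T := by
  obtain ⟨c, hc, T₀, hT₀, h⟩ := exists_le_integral_negXi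
  refine ⟨c ^ 2 / 800, by positivity, T₀, fun T hT ↦ ?_⟩
  have hA := h T hT
  have hT3 : 3 ≤ T := hT₀.trans hT
  have hT0 : 0 < T := by linarith
  have hB := integral_sq_twistXi_le_log hT3
  have hL : 0 < Real.log T := Real.log_pos (by linarith)
  obtain ⟨a, ha⟩ : ∃ a, a = c * T ^ (3 / 4 : ℝ) * Real.log T ^ (1 / 4 : ℝ) := ⟨_, rfl⟩
  obtain ⟨b, hb⟩ : ∃ b, b = 800 * √T * Real.log T := ⟨_, rfl⟩
  rw [← ha] at hA
  rw [← hb] at hB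
  have ha0 : 0 < a := by rw [ha]; positivity
  have hb0 : 0 < b := by rw [hb]; positivity
  have hcs := jmeasminus_cauchy_schwarz (T := T) (div_pos hb0 ha0)
  have h1 : (∫ t in Set.Ioc T (2 * T), twistXi (Real.pi / 2 - 1 / T) t ^ 2) / (b / a) ≤ a := by
    rw [div_le_iff₀ (div_pos hb0 ha0), mul_div_cancel₀ _ ha0.ne']; exact hB
  have h2 : a ≤ b / a * Jmeasminus T := by linarith
  rw [div_mul_eq_mul_div, le_div_iff₀ ha0] at h2
  have e1 : T ^ (3 / 4 : ℝ) * T ^ (3 / 4 : ℝ) = T * √T := by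
    rw [Real.sqrt_eq_rpow]
    nth_rw 3 [← Real.rpow_one T]
    rw [← Real.rpow_add hT0, ← Real.rpow_add hT0]; norm_num
  have e2 : Real.log T ^ (1 / 4 : ℝ) * Real.log T ^ (1 / 4 : ℝ) =
      Real.log T * Real.log T ^ (-(1 : ℝ) / 2) := by
    nth_rw 3 [← Real.rpow_one (Real.log T)]
    rw [← Real.rpow_add hL, ← Real.rpow_add hL]; norm_num
  refine le_of_mul_le_mul_left ?_ hb0
  refine le_trans (le_of_eq ?_) h2
  calc b * (c ^ 2 / 800 * T * Real.log T ^ (-(1 : ℝ) / 2)) =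
      c ^ 2 * (T * √T) * (Real.log T * Real.log T ^ (-(1 : ℝ) / 2)) := by rw [hb]; ring
    _ = a * a := by rw [← e1, ← e2, ha]; ring
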